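/- arXiv:0904.1295 — 3 statements merged into one kernel-verified Lean document; each statement's English description precedes it below -/
import Mathlib

section
/- Let f be an entire function, R > 0, and let U be a connected component of A_R = {z ∈ ℂ : |f(z)| > R} such that for all sufficiently large r the circle {z : |z| = r} is not contained in U. Let 0 < β < 1/2, put V = {z ∈ U : |f(z)| ≥ exp(|z|^β)} and ψ(r) = Lebesgue measure of {t ∈ [0,2π] : r e^{it} ∈ V}. Then for every κ ∈ (0,1) there exist constants C and r_0 such that ψ(t) > 0 for t ≥ r_0 and log log M(r,f) ≥ π ∫_{r_0}^{κr} dt/(t ψ(t)) − C for all r ≥ r_0/κ. -/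
open MeasureTheory Filter Topology

/-- The maximum modulus `M(r,f) = max_{|z|=r} |f(z)|`. -/
noncomputable def maxModulus (f : ℂ → ℂ) (r : ℝ) : ℝ :=
  sSup ((fun z => ‖f z‖) '' Metric.sphere (0 : ℂ) r)

/-- The set of connected components of `A_R = {z : |f(z)| > R}`. -/
def componentsAR (f : ℂ → ℂ) (R : ℝ) : Set (Set ℂ) :=
  {S | ∃ z, R < ‖f z‖ ∧
    S = connectedComponentIn {w : ℂ | R < ‖f w‖} z}

/-- `ψ(r)`: the Lebesgue measure of the set of angles `t ∈ [0,2π]` with `r e^{it} ∈ V`. -/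
noncomputable def angularMeasure (V : Set ℂ) (r : ℝ) : ℝ :=
  (volume {t : ℝ | t ∈ Set.Icc 0 (2 * Real.pi) ∧
    (r : ℂ) * Complex.exp (t * Complex.I) ∈ V}).toReal

/-- A product with a factor vanishing at the base point, the other factor being merely
continuous. -/
theorem HasDerivAt.mul_continuousAt_of_eq_zero {u φ : ℝ → ℝ} {u' x : ℝ} (hu : HasDerivAt u u' x)
    (hux : u x = 0) (hφ : ContinuousAt φ x) :
    HasDerivAt (fun y => u y * φ y) (u' * φ x) x := by
  rw [hasDerivAt_iff_tendsto_slope] at hu ⊢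
  have h := hu.mul (hφ.tendsto.mono_left (nhdsWithin_le_nhds (s := {x}ᶜ)))
  refine h.congr fun y => ?_
  simp only [slope_def_field, hux]
  ring

/-- Wirtinger's inequality in terms of the measure of the positivity set, away from the
critical constant. -/
theorem wirtinger_of_lt {v v' : ℝ → ℝ} {a b c : ℝ} (hab : a ≤ b)
    (hv : ∀ x, HasDerivAt v (v' x) x) (hv' : Continuous v') (h0 : ∀ x, 0 ≤ v x)
    (ha : v a = 0) (hb : v b = 0) (hc : 0 ≤ c)
    (hE : c * (∫ x in a..b, {x | 0 < v x}.indicator 1 x) < Real.pi) :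
    c ^ 2 * (∫ x in a..b, v x ^ 2) ≤ ∫ x in a..b, v' x ^ 2 := by
  have hvc : Continuous v := continuous_iff_continuousAt.2 fun x => (hv x).continuousAt
  set E : Set ℝ := {x | 0 < v x} with hEdef
  have hEo : IsOpen E := isOpen_lt continuous_const hvc
  set e : ℝ → ℝ := E.indicator 1 with he
  have heL : LocallyIntegrable e := by
    refine (locallyIntegrable_const (1 : ℝ)).indicator hEo.measurableSet
  have heI : ∀ x y : ℝ, IntervalIntegrable e volume x y := fun x y =>
    (heL.integrableOn_isCompact isCompact_uIcc).intervalIntegrable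
  have he0 : ∀ x, 0 ≤ e x := fun x => Set.indicator_nonneg (fun _ _ => zero_le_one) x
  set m : ℝ → ℝ := fun x => ∫ s in a..x, e s with hm
  have hmc : Continuous m := intervalIntegral.continuous_primitive heI a
  have hm0 : ∀ x ∈ Set.Icc a b, 0 ≤ m x := fun x hx =>
    intervalIntegral.integral_nonneg hx.1 fun s _ => he0 s
  have hmb : ∀ x ∈ Set.Icc a b, m x ≤ m b := fun x hx => by
    have h1 : m x + ∫ s in x..b, e s = m b :=
      intervalIntegral.integral_add_adjacent_intervals (heI _ _) (heI _ _)
    have h2 : 0 ≤ ∫ s in x..b, e s := intervalIntegral.integral_nonneg hx.2 fun s _ => he0 s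
    linarith
  have hmd : ∀ x ∈ E, HasDerivAt m 1 x := fun x hx => by
    have hev : e =ᶠ[𝓝 x] fun _ => 1 := by
      filter_upwards [hEo.mem_nhds hx] with y hy
      simp [he, hy]
    have hce : ContinuousAt e x := continuousAt_const.congr hev.symm
    have := intervalIntegral.integral_hasDerivAt_right (heI a x)
      (heL.aestronglyMeasurable.stronglyMeasurableAtFilter) hce
    rwa [hev.eq_of_nhds] at this
  set δ : ℝ := (Real.pi - c * m b) / 2 with hδ
  have hδ0 : 0 < δ := by rw [hδ]; linarith
  have hsin : ∀ x ∈ Set.Icc a b, 0 < Real.sin (c * m x + δ) := fun x hx => by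
    have h1 := mul_nonneg hc (hm0 x hx)
    have h2 := mul_le_mul_of_nonneg_left (hmb x hx) hc
    exact Real.sin_pos_of_pos_of_lt_pi (by linarith) (by linarith)
  set k : ℝ → ℝ := fun x => Real.cos (c * m x + δ) / Real.sin (c * m x + δ) with hk
  have hkc : ContinuousOn k (Set.Icc a b) := fun x hx => by
    refine ContinuousAt.continuousWithinAt ?_
    exact ContinuousAt.div (by fun_prop) (by fun_prop) (hsin x hx).ne'
  have key := intervalIntegral.sub_le_integral_of_hasDeriv_right_of_le
    (g := fun x => c * (v x ^ 2 * k x))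
    (g' := fun x => c * (2 * v x * v' x * k x) - c ^ 2 * v x ^ 2 * (1 + k x ^ 2))
    (φ := fun x => v' x ^ 2 - c ^ 2 * v x ^ 2) hab
    (continuousOn_const.mul ((hvc.pow 2).continuousOn.mul hkc)) ?_
    (Continuous.integrableOn_Icc (by fun_prop)) ?_
  · simp only [ha, hb] at key
    rw [intervalIntegral.integral_sub (Continuous.intervalIntegrable (by fun_prop) _ _)
      (Continuous.intervalIntegrable (by fun_prop) _ _), intervalIntegral.integral_const_mul] at key
    nlinarith
  · intro x hx
    have hx' := Set.Ioo_subset_Icc_self hx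
    have hs := hsin x hx'
    apply HasDerivAt.hasDerivWithinAt
    by_cases hxE : x ∈ E
    · have hin : HasDerivAt (fun x => c * m x + δ) c x := by
        simpa using ((hmd x hxE).const_mul c).add_const δ
      have hkd : HasDerivAt k (-c * (1 + k x ^ 2)) x := by
        refine (hin.cos.fun_div hin.sin hs.ne').congr_deriv ?_
        simp only [hk]
        field_simp
        ring
      refine ((((hv x).fun_pow 2).fun_mul hkd).const_mul c).congr_deriv ?_
      simp
      ring
    · have hvx : v x = 0 := le_antisymm (not_lt.1 hxE) (h0 x)
      have := ((hv x).fun_pow 2).mul_continuousAt_of_eq_zero (by simp [hvx])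
        (hkc.continuousAt (Icc_mem_nhds hx.1 hx.2))
      refine (this.const_mul c).congr_deriv ?_
      simp [hvx]
  · intro x _
    nlinarith [sq_nonneg (v' x - c * v x * k x)]

/-- Wirtinger's inequality in terms of the measure of the positivity set. -/
theorem wirtinger {v v' : ℝ → ℝ} {a b c : ℝ} (hab : a ≤ b)
    (hv : ∀ x, HasDerivAt v (v' x) x) (hv' : Continuous v') (h0 : ∀ x, 0 ≤ v x)
    (ha : v a = 0) (hb : v b = 0) (hc : 0 ≤ c)
    (hE : c * (∫ x in a..b, {x | 0 < v x}.indicator 1 x) ≤ Real.pi) :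
    c ^ 2 * (∫ x in a..b, v x ^ 2) ≤ ∫ x in a..b, v' x ^ 2 := by
  have hT : Tendsto (fun s : ℝ => (s * c) ^ 2 * (∫ x in a..b, v x ^ 2)) (𝓝[<] 1)
      (𝓝 ((1 * c) ^ 2 * (∫ x in a..b, v x ^ 2))) :=
    Tendsto.mono_left (Continuous.tendsto (by fun_prop) 1) nhdsWithin_le_nhds
  rw [one_mul] at hT
  refine le_of_tendsto hT ?_
  filter_upwards [Ioo_mem_nhdsLT (zero_lt_one (α := ℝ))] with s hs
  refine wirtinger_of_lt hab hv hv' h0 ha hb (mul_nonneg hs.1.le hc) ?_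
  rw [mul_assoc]
  nlinarith [hs.1, hs.2, Real.pi_pos]

theorem hasDerivAt_intervalIntegral_of_continuous {G G' : ℝ → ℝ → ℝ} (a b : ℝ)
    (hG : Continuous ↿G) (hG' : Continuous ↿G')
    (h : ∀ t y, HasDerivAt (fun s => G s y) (G' t y) t) (t : ℝ) :
    HasDerivAt (fun s => ∫ y in a..b, G s y) (∫ y in a..b, G' t y) t := by
  obtain ⟨M, hM⟩ := ((isCompact_closedBall t 1).prod (isCompact_uIcc
    (a := a) (b := b))).exists_bound_of_continuousOn
    hG'.continuousOn
  have hGs : ∀ s, Continuous (G s) := fun s => hG.comp (Continuous.prodMk_right s)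
  have hGs' : ∀ s, Continuous (G' s) := fun s => hG'.comp (Continuous.prodMk_right s)
  refine (intervalIntegral.hasDerivAt_integral_of_dominated_loc_of_deriv_le
    (F := G) (F' := G') (bound := fun _ => M) (Metric.ball_mem_nhds t one_pos)
    (Eventually.of_forall fun s => (hGs s).aestronglyMeasurable)
    ((hGs t).intervalIntegrable _ _) (hGs' t).aestronglyMeasurable ?_
    intervalIntegrable_const ?_).2
  · refine Eventually.of_forall fun y hy s hs => ?_
    exact hM (s, y) ⟨Metric.ball_subset_closedBall hs, Set.uIoc_subset_uIcc hy⟩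
  · exact Eventually.of_forall fun y _ s _ => h s y

theorem sq_intervalIntegral_mul_le {u w : ℝ → ℝ} {a b : ℝ} (hab : a ≤ b) (hu : Continuous u)
    (hw : Continuous w) :
    (∫ y in a..b, u y * w y) ^ 2 ≤ (∫ y in a..b, u y ^ 2) * ∫ y in a..b, w y ^ 2 := by
  have h : ∀ s : ℝ, 0 ≤ (∫ y in a..b, u y ^ 2) * (s * s) + (2 * ∫ y in a..b, u y * w y) * s +
      ∫ y in a..b, w y ^ 2 := fun s => by
    have h1 : 0 ≤ ∫ y in a..b, (s * u y + w y) ^ 2 :=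
      intervalIntegral.integral_nonneg hab fun y _ => sq_nonneg _
    have h2 : ∫ y in a..b, (s * u y + w y) ^ 2 = (∫ y in a..b, (s * s) * u y ^ 2) +
        (∫ y in a..b, (2 * s) * (u y * w y)) + ∫ y in a..b, w y ^ 2 := by
      rw [← intervalIntegral.integral_add, ← intervalIntegral.integral_add]
      · exact intervalIntegral.integral_congr fun y _ => by ring
      all_goals exact Continuous.intervalIntegrable (by fun_prop) _ _
    rw [intervalIntegral.integral_const_mul, intervalIntegral.integral_const_mul] at h2
    linarith
  have := discrim_le_zero h
  rw [discrim] at this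
  nlinarith

/-- A nonnegative `C²` function of `(x, y)`, `2π`-periodic in `y`, whose Laplacian is bounded below
by `-ρ(x)`; the partial derivatives are part of the data. -/
structure IsPeriodicSubsolution (v vx vxx vy vyy : ℝ → ℝ → ℝ) (ρ : ℝ → ℝ) : Prop where
  continuous : Continuous ↿v
  continuous_x : Continuous ↿vx
  continuous_xx : Continuous ↿vxx
  continuous_y : Continuous ↿vy
  continuous_yy : Continuous ↿vyy
  hasDerivAt_x : ∀ x y, HasDerivAt (fun s => v s y) (vx x y) x
  hasDerivAt_xx : ∀ x y, HasDerivAt (fun s => vx s y) (vxx x y) x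
  hasDerivAt_y : ∀ x y, HasDerivAt (v x) (vy x y) y
  hasDerivAt_yy : ∀ x y, HasDerivAt (vy x) (vyy x y) y
  periodic : ∀ x, Function.Periodic (v x) (2 * Real.pi)
  periodic_y : ∀ x, Function.Periodic (vy x) (2 * Real.pi)
  nonneg : ∀ x y, 0 ≤ v x y
  laplacian_ge : ∀ x y, -ρ x ≤ vxx x y + vyy x y

/-- The square mean over a period. -/
noncomputable def squareMean (v : ℝ → ℝ → ℝ) (x : ℝ) : ℝ :=
  ∫ y in (0 : ℝ)..2 * Real.pi, v x y ^ 2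

/-- The derivative of `squareMean`. -/
noncomputable def squareMeanDeriv (v vx : ℝ → ℝ → ℝ) (x : ℝ) : ℝ :=
  ∫ y in (0 : ℝ)..2 * Real.pi, 2 * (v x y * vx x y)

/-- The second derivative of `squareMean`. -/
noncomputable def squareMeanDeriv₂ (v vx vxx : ℝ → ℝ → ℝ) (x : ℝ) : ℝ :=
  ∫ y in (0 : ℝ)..2 * Real.pi, 2 * (vx x y ^ 2 + v x y * vxx x y)

/-- The measure of the set of positivity on a period. -/
noncomputable def positivityMeasure (v : ℝ → ℝ → ℝ) (x : ℝ) : ℝ :=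
  ∫ y in (0 : ℝ)..2 * Real.pi, {y | 0 < v x y}.indicator 1 y

theorem squareMean_nonneg (v : ℝ → ℝ → ℝ) (x : ℝ) : 0 ≤ squareMean v x :=
  intervalIntegral.integral_nonneg Real.two_pi_pos.le fun _ _ => sq_nonneg _

namespace IsPeriodicSubsolution

variable {v vx vxx vy vyy : ℝ → ℝ → ℝ} {ρ : ℝ → ℝ}

theorem continuous_section (h : IsPeriodicSubsolution v vx vxx vy vyy ρ) (x : ℝ) :
    Continuous (v x) ∧ Continuous (vx x) ∧ Continuous (vxx x) ∧ Continuous (vy x) ∧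
      Continuous (vyy x) :=
  ⟨h.continuous.comp (Continuous.prodMk_right x), h.continuous_x.comp (Continuous.prodMk_right x),
    h.continuous_xx.comp (Continuous.prodMk_right x),
    h.continuous_y.comp (Continuous.prodMk_right x),
    h.continuous_yy.comp (Continuous.prodMk_right x)⟩

theorem hasDerivAt_squareMean (h : IsPeriodicSubsolution v vx vxx vy vyy ρ) (x : ℝ) :
    HasDerivAt (squareMean v) (squareMeanDeriv v vx x) x := by
  refine hasDerivAt_intervalIntegral_of_continuous (G := fun x y => v x y ^ 2)
    (G' := fun x y => 2 * (v x y * vx x y)) _ _ (h.continuous.pow 2)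
    ((continuous_const (y := (2 : ℝ))).mul (h.continuous.mul h.continuous_x)) (fun t y => ?_) x
  refine ((h.hasDerivAt_x t y).fun_pow 2).congr_deriv ?_
  simp
  ring

theorem hasDerivAt_squareMeanDeriv (h : IsPeriodicSubsolution v vx vxx vy vyy ρ) (x : ℝ) :
    HasDerivAt (squareMeanDeriv v vx) (squareMeanDeriv₂ v vx vxx x) x := by
  refine hasDerivAt_intervalIntegral_of_continuous (G := fun x y => 2 * (v x y * vx x y))
    (G' := fun x y => 2 * (vx x y ^ 2 + v x y * vxx x y)) _ _
    ((continuous_const (y := (2 : ℝ))).mul (h.continuous.mul h.continuous_x))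
    ((continuous_const (y := (2 : ℝ))).mul
      ((h.continuous_x.pow 2).add (h.continuous.mul h.continuous_xx)))
    (fun t y => ?_) x
  refine (((h.hasDerivAt_x t y).fun_mul (h.hasDerivAt_xx t y)).const_mul 2).congr_deriv ?_
  ring

theorem integral_mul_yy (h : IsPeriodicSubsolution v vx vxx vy vyy ρ) (x : ℝ) :
    ∫ y in (0 : ℝ)..2 * Real.pi, v x y * vyy x y =
      -∫ y in (0 : ℝ)..2 * Real.pi, vy x y ^ 2 := by
  obtain ⟨c0, -, -, c3, c4⟩ := h.continuous_section x
  have := intervalIntegral.integral_mul_deriv_eq_deriv_mul (a := 0) (b := 2 * Real.pi)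
    (fun y _ => h.hasDerivAt_y x y) (fun y _ => h.hasDerivAt_yy x y)
    (c3.intervalIntegrable _ _) (c4.intervalIntegrable _ _)
  rw [this, (h.periodic x).eq, (h.periodic_y x).eq]
  simp [sq]

theorem squareMeanDeriv₂_ge (h : IsPeriodicSubsolution v vx vxx vy vyy ρ) (x : ℝ) :
    2 * (∫ y in (0 : ℝ)..2 * Real.pi, vx x y ^ 2) + 2 * (∫ y in (0 : ℝ)..2 * Real.pi, vy x y ^ 2)
      - 2 * ρ x * (∫ y in (0 : ℝ)..2 * Real.pi, v x y) ≤ squareMeanDeriv₂ v vx vxx x := by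
  obtain ⟨c0, c1, c2, c3, c4⟩ := h.continuous_section x
  have e : squareMeanDeriv₂ v vx vxx x - (2 * (∫ y in (0 : ℝ)..2 * Real.pi, vx x y ^ 2) +
      2 * (∫ y in (0 : ℝ)..2 * Real.pi, vy x y ^ 2)
      - 2 * ρ x * (∫ y in (0 : ℝ)..2 * Real.pi, v x y)) =
      ∫ y in (0 : ℝ)..2 * Real.pi, 2 * v x y * (vxx x y + vyy x y + ρ x) := by
    have e1 : squareMeanDeriv₂ v vx vxx x = 2 * (∫ y in (0 : ℝ)..2 * Real.pi, vx x y ^ 2) +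
        2 * ∫ y in (0 : ℝ)..2 * Real.pi, v x y * vxx x y := by
      rw [squareMeanDeriv₂, intervalIntegral.integral_const_mul, intervalIntegral.integral_add]
      · ring
      all_goals exact Continuous.intervalIntegrable (by fun_prop) _ _
    have e2 : ∫ y in (0 : ℝ)..2 * Real.pi, 2 * v x y * (vxx x y + vyy x y + ρ x) =
        (∫ y in (0 : ℝ)..2 * Real.pi, 2 * (v x y * vxx x y)) +
        (∫ y in (0 : ℝ)..2 * Real.pi, 2 * (v x y * vyy x y)) +
        ∫ y in (0 : ℝ)..2 * Real.pi, 2 * ρ x * v x y := by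
      rw [← intervalIntegral.integral_add, ← intervalIntegral.integral_add]
      · exact intervalIntegral.integral_congr fun y _ => by ring
      all_goals exact Continuous.intervalIntegrable (by fun_prop) _ _
    rw [e1, e2, intervalIntegral.integral_const_mul, intervalIntegral.integral_const_mul,
      intervalIntegral.integral_const_mul, h.integral_mul_yy]
    ring
  have : 0 ≤ ∫ y in (0 : ℝ)..2 * Real.pi, 2 * v x y * (vxx x y + vyy x y + ρ x) :=
    intervalIntegral.integral_nonneg Real.two_pi_pos.le fun y _ =>
      mul_nonneg (mul_nonneg zero_le_two (h.nonneg x y)) (by linarith [h.laplacian_ge x y])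
  linarith

theorem squareMeanDeriv₂_nonneg (h : IsPeriodicSubsolution v vx vxx vy vyy ρ) {x : ℝ}
    (hx : ρ x = 0) : 0 ≤ squareMeanDeriv₂ v vx vxx x := by
  have := h.squareMeanDeriv₂_ge x
  have h1 : 0 ≤ ∫ y in (0 : ℝ)..2 * Real.pi, vx x y ^ 2 :=
    intervalIntegral.integral_nonneg Real.two_pi_pos.le fun _ _ => sq_nonneg _
  have h2 : 0 ≤ ∫ y in (0 : ℝ)..2 * Real.pi, vy x y ^ 2 :=
    intervalIntegral.integral_nonneg Real.two_pi_pos.le fun _ _ => sq_nonneg _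
  rw [hx] at this
  linarith

theorem sq_mul_squareMean_le (h : IsPeriodicSubsolution v vx vxx vy vyy ρ) {x y₀ c : ℝ}
    (hy₀ : v x y₀ = 0) (hc : 0 ≤ c) (hc' : c * positivityMeasure v x ≤ Real.pi) :
    c ^ 2 * squareMean v x ≤ ∫ y in (0 : ℝ)..2 * Real.pi, vy x y ^ 2 := by
  have hp := h.periodic x
  have hpy := h.periodic_y x
  have p1 : Function.Periodic (fun y => v x y ^ 2) (2 * Real.pi) := fun y => by simp only [hp y]
  have p2 : Function.Periodic (fun y => vy x y ^ 2) (2 * Real.pi) := fun y => by simp only [hpy y]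
  have p3 : Function.Periodic ({y | 0 < v x y}.indicator (1 : ℝ → ℝ)) (2 * Real.pi) := fun y => by
    simp only [Set.indicator, Set.mem_ofPred_eq, hp y, Pi.one_apply]
  have q1 := p1.intervalIntegral_add_eq 0 y₀
  have q2 := p2.intervalIntegral_add_eq 0 y₀
  have q3 := p3.intervalIntegral_add_eq 0 y₀
  rw [zero_add] at q1 q2 q3
  rw [positivityMeasure, q3] at hc'
  rw [squareMean, q1, q2]
  exact wirtinger (by linarith [Real.pi_pos]) (h.hasDerivAt_y x) (h.continuous_section x).2.2.2.1
    (h.nonneg x) hy₀ (by rw [hp, hy₀]) hc hc'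

/-- Carleman's differential inequality. -/
theorem carleman (h : IsPeriodicSubsolution v vx vxx vy vyy ρ) {x y₀ c : ℝ} (hρ : 0 ≤ ρ x)
    (hy₀ : v x y₀ = 0) (hc : 0 ≤ c) (hc' : c * positivityMeasure v x ≤ Real.pi) :
    squareMeanDeriv v vx x ^ 2 / 2 + 2 * c ^ 2 * squareMean v x ^ 2
      - 2 * ρ x * √(2 * Real.pi) * √(squareMean v x) * squareMean v x ≤
      squareMean v x * squareMeanDeriv₂ v vx vxx x := by
  obtain ⟨c0, c1, -, -, -⟩ := h.continuous_section x
  have hI := squareMean_nonneg v x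
  have h1 := h.squareMeanDeriv₂_ge x
  have h2 := h.sq_mul_squareMean_le hy₀ hc hc'
  have h3 : squareMeanDeriv v vx x ^ 2 ≤
      4 * (squareMean v x * ∫ y in (0 : ℝ)..2 * Real.pi, vx x y ^ 2) := by
    have := sq_intervalIntegral_mul_le Real.two_pi_pos.le c0 c1
    rw [squareMeanDeriv, intervalIntegral.integral_const_mul, squareMean]
    linarith
  have h4 : (∫ y in (0 : ℝ)..2 * Real.pi, v x y) ≤ √(2 * Real.pi) * √(squareMean v x) := by
    have := sq_intervalIntegral_mul_le Real.two_pi_pos.le (continuous_const (y := (1 : ℝ))) c0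
    rw [← Real.sqrt_mul Real.two_pi_pos.le]
    apply Real.le_sqrt_of_sq_le
    simpa [squareMean] using this
  have h5 := mul_le_mul_of_nonneg_left h1 hI
  have h6 := mul_le_mul_of_nonneg_left h2 hI
  have h7 := mul_le_mul_of_nonneg_left h4 (mul_nonneg hρ hI)
  linarith

end IsPeriodicSubsolution

theorem monotoneOn_Ici_of_hasDerivAt_nonneg {u u' : ℝ → ℝ} {T : ℝ}
    (h : ∀ x, T ≤ x → HasDerivAt u (u' x) x) (h' : ∀ x, T ≤ x → 0 ≤ u' x) :
    MonotoneOn u (Set.Ici T) := by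
  refine monotoneOn_of_hasDerivWithinAt_nonneg (f' := u') (convex_Ici T)
    (fun x hx => (h x hx).continuousAt.continuousWithinAt) (fun x hx => ?_) (fun x hx => ?_)
  · exact (h x (interior_subset hx)).hasDerivWithinAt
  · exact h' x (interior_subset hx)

theorem deriv_nonneg_of_convex_of_bounded {u u' u'' : ℝ → ℝ} {M : ℝ}
    (hu : ∀ x, HasDerivAt u (u' x) x) (hu' : ∀ x, HasDerivAt u' (u'' x) x)
    (h'' : ∀ x, 0 ≤ u'' x) (h0 : ∀ x, 0 ≤ u x) (hM : ∀ x ≤ 0, u x ≤ M) (x : ℝ) : 0 ≤ u' x := by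
  by_contra! hx
  have hmono : Monotone u' := monotone_of_hasDerivAt_nonneg hu' h''
  set y := min x 0 - (|M| + 1) / (-u' x) with hy
  have hm : 0 < -u' x := by linarith
  have hq : 0 < (|M| + 1) / (-u' x) := by positivity
  have hyx : y < x := by linarith [min_le_left x 0]
  have hy0 : y ≤ 0 := by linarith [min_le_right x 0]
  obtain ⟨z, hz, hz'⟩ := exists_hasDerivAt_eq_slope u u' hyx
    (fun s _ => (hu s).continuousAt.continuousWithinAt) (fun s _ => hu s)
  have h1 : u' z ≤ u' x := hmono hz.2.le
  rw [hz', div_le_iff₀ (by linarith)] at h1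
  have h2 : -u' x * ((|M| + 1) / (-u' x)) = |M| + 1 := mul_div_cancel₀ _ hm.ne'
  have h3 : -u' x * ((|M| + 1) / (-u' x)) ≤ -u' x * (x - y) :=
    mul_le_mul_of_nonneg_left (by linarith [min_le_left x 0]) hm.le
  linarith [hM y hy0, h0 x, le_abs_self M]

theorem exists_exp_le_of_sq_add_sq_le {u u' u'' : ℝ → ℝ} {M T : ℝ}
    (hu : ∀ x, HasDerivAt u (u' x) x) (hu' : ∀ x, HasDerivAt u' (u'' x) x)
    (h'' : ∀ x, 0 ≤ u'' x) (h0 : ∀ x, 0 ≤ u x) (hM : ∀ x ≤ 0, u x ≤ M) (hpos : ∃ x, 0 < u x)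
    (hT : ∀ x, T ≤ x → u' x ^ 2 + u x ^ 2 ≤ 2 * u x * u'' x) :
    ∃ c > 0, ∀ᶠ x in atTop, c * Real.exp x ≤ u x := by
  have hu'0 := deriv_nonneg_of_convex_of_bounded hu hu' h'' h0 hM
  have hmono : Monotone u := monotone_of_hasDerivAt_nonneg hu hu'0
  obtain ⟨p, hp⟩ := hpos
  set X := max p T with hX
  have hup : ∀ x, X ≤ x → 0 < u x := fun x hx =>
    hp.trans_le (hmono ((le_max_left p T).trans hx))
  have hge : ∀ x, X ≤ x → u' x ≤ u'' x := fun x hx => by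
    have h1 := hT x ((le_max_right p T).trans hx)
    have h2 := hup x hx
    nlinarith [sq_nonneg (u' x - u x)]
  have hgt : ∀ x, X ≤ x → 0 < u'' x := fun x hx => by
    have h1 := hT x ((le_max_right p T).trans hx)
    have h2 := hup x hx
    by_contra! h3
    nlinarith [sq_nonneg (u' x)]
  have hpos' : 0 < u' (X + 1) := by
    obtain ⟨z, hz, hz'⟩ := exists_hasDerivAt_eq_slope u' u'' (lt_add_one X)
      (fun s _ => (hu' s).continuousAt.continuousWithinAt) (fun s _ => hu' s)
    have h1 := hgt z hz.1.le
    rw [hz', add_sub_cancel_left, div_one] at h1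
    linarith [hu'0 X]
  have hD : MonotoneOn (fun x => Real.exp (-x) * u' x) (Set.Ici X) :=
    monotoneOn_Ici_of_hasDerivAt_nonneg
      (u' := fun x => Real.exp (-x) * (u'' x - u' x))
      (fun x _ => (((hasDerivAt_neg x).exp).fun_mul (hu' x)).congr_deriv (by ring))
      (fun x hx => mul_nonneg (Real.exp_pos _).le (by linarith [hge x hx]))
  set c := Real.exp (-(X + 1)) * u' (X + 1) with hc
  have hc0 : 0 < c := by positivity
  have hu'c : ∀ x, X + 1 ≤ x → c * Real.exp x ≤ u' x := fun x hx => by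
    have h1 : c ≤ Real.exp (-x) * u' x :=
      hD (Set.mem_Ici.2 (by linarith)) (Set.mem_Ici.2 (by linarith)) hx
    have h2 := mul_le_mul_of_nonneg_right h1 (Real.exp_pos x).le
    have h3 : Real.exp (-x) * Real.exp x = 1 := by rw [← Real.exp_add]; simp
    rwa [mul_right_comm (Real.exp (-x)), h3, one_mul] at h2
  have hF : MonotoneOn (fun x => u x - c * Real.exp x) (Set.Ici (X + 1)) :=
    monotoneOn_Ici_of_hasDerivAt_nonneg
      (u' := fun x => u' x - c * Real.exp x)
      (fun x _ => (hu x).fun_sub ((Real.hasDerivAt_exp x).const_mul c))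
      (fun x hx => by linarith [hu'c x hx])
  refine ⟨c / 2, by positivity, ?_⟩
  filter_upwards [eventually_ge_atTop (X + 1),
    Real.tendsto_exp_atTop.eventually_ge_atTop (2 * Real.exp (X + 1))] with x hx hx2
  have h1 : u (X + 1) - c * Real.exp (X + 1) ≤ u x - c * Real.exp x :=
    hF Set.self_mem_Ici (Set.mem_Ici.2 hx) hx
  nlinarith [h0 (X + 1)]

theorem exists_forall_deriv_pos {K K' K'' : ℝ → ℝ} {T : ℝ}
    (hK : ∀ x, T ≤ x → HasDerivAt K (K' x) x) (hK' : ∀ x, T ≤ x → HasDerivAt K' (K'' x) x)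
    (h'' : ∀ x, T ≤ x → 0 ≤ K'' x) (hlim : Tendsto K atTop atTop) :
    ∃ t ≥ T, ∀ x, t ≤ x → 0 < K' x := by
  obtain ⟨s, hs, hsT⟩ := ((hlim.eventually_gt_atTop (K T)).and (eventually_gt_atTop T)).exists
  obtain ⟨z, hz, hz'⟩ := exists_hasDerivAt_eq_slope K K' hsT
    (fun x hx => (hK x hx.1).continuousAt.continuousWithinAt) (fun x hx => hK x hx.1.le)
  have hpos : 0 < K' z := hz' ▸ div_pos (by linarith) (by linarith)
  exact ⟨z, hz.1.le, fun x hx => hpos.trans_le <|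
    monotoneOn_Ici_of_hasDerivAt_nonneg hK' h'' hz.1.le (hz.1.le.trans hx) hx⟩

/-- Integrated form of the differential inequality `K'' ≥ q² K` in the variable `exp x`. -/
theorem exists_integral_le_log {K K' K'' q : ℝ → ℝ} {T κ : ℝ} (hκ0 : 0 < κ) (hκ1 : κ < 1)
    (hK : ∀ x, T ≤ x → HasDerivAt K (K' x) x) (hK' : ∀ x, T ≤ x → HasDerivAt K' (K'' x) x)
    (hpos : ∀ x, T ≤ x → 0 < K x) (hq : ∀ x, T ≤ x → 0 ≤ q x)
    (h'' : ∀ x, T ≤ x → q x ^ 2 * K x ≤ K'' x) (hlim : Tendsto K atTop atTop) :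
    ∃ C, ∃ t ≥ T, ∀ r, Real.exp t ≤ κ * r →
      (∫ s in Real.exp t..κ * r, q (Real.log s) / s) - C ≤ Real.log (K (Real.log r)) := by
  have h''0 : ∀ x, T ≤ x → 0 ≤ K'' x := fun x hx =>
    (mul_nonneg (sq_nonneg _) (hpos x hx).le).trans (h'' x hx)
  obtain ⟨t, htT, ht⟩ := exists_forall_deriv_pos hK hK' h''0 hlim
  have hKK : ∀ x, t ≤ x → 0 < K x * K' x := fun x hx =>
    mul_pos (hpos x (htT.trans hx)) (ht x hx)
  have hKKd : ∀ x, t ≤ x → HasDerivAt (fun x => K x * K' x) (K' x ^ 2 + K x * K'' x) x :=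
    fun x hx => ((hK x (htT.trans hx)).fun_mul (hK' x (htT.trans hx))).congr_deriv (by ring)
  have hKKge : ∀ x, t ≤ x → 2 * q x * (K x * K' x) ≤ K' x ^ 2 + K x * K'' x := fun x hx => by
    have h1 := mul_le_mul_of_nonneg_left (h'' x (htT.trans hx)) (hpos x (htT.trans hx)).le
    nlinarith [sq_nonneg (K' x - q x * K x)]
  have hKKm : MonotoneOn (fun x => K x * K' x) (Set.Ici t) :=
    monotoneOn_Ici_of_hasDerivAt_nonneg hKKd fun x hx =>
      (mul_nonneg (mul_nonneg zero_le_two (hq x (htT.trans hx))) (hKK x hx).le).trans (hKKge x hx)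
  set δ := -Real.log κ with hδ
  have hδ0 : 0 < δ := by linarith [Real.log_neg hκ0 hκ1]
  set L : ℝ → ℝ := fun s => Real.log (K (Real.log s) * K' (Real.log s)) / 2 with hL
  refine ⟨-(L (Real.exp t) + Real.log (2 * δ) / 2), t, htT, fun r hr => ?_⟩
  have hκr : 0 < κ * r := (Real.exp_pos t).trans_le hr
  have hr0 : 0 < r := pos_of_mul_pos_right hκr hκ0.le
  have htl : t ≤ Real.log (κ * r) := (Real.le_log_iff_exp_le hκr).2 hr
  have hlog : Real.log (κ * r) = Real.log r - δ := by
    rw [Real.log_mul hκ0.ne' hr0.ne', hδ]; ring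
  have hlogs : ∀ s, Real.exp t ≤ s → t ≤ Real.log s := fun s hs =>
    (Real.le_log_iff_exp_le ((Real.exp_pos t).trans_le hs)).2 hs
  have hLd : ∀ s, Real.exp t ≤ s → HasDerivAt L
      ((K' (Real.log s) ^ 2 + K (Real.log s) * K'' (Real.log s)) /
        (K (Real.log s) * K' (Real.log s)) / 2 / s) s := fun s hs => by
    have hs0 : s ≠ 0 := ((Real.exp_pos t).trans_le hs).ne'
    have h1 := (hKKd _ (hlogs s hs)).comp s (Real.hasDerivAt_log hs0)
    refine ((h1.log (hKK _ (hlogs s hs)).ne').div_const 2).congr_deriv ?_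
    simp only [Function.comp]
    field_simp
  have hLq : ∀ s, Real.exp t ≤ s → q (Real.log s) / s ≤
      ((K' (Real.log s) ^ 2 + K (Real.log s) * K'' (Real.log s)) /
        (K (Real.log s) * K' (Real.log s)) / 2 / s) := fun s hs => by
    have hs0 : 0 < s := (Real.exp_pos t).trans_le hs
    refine div_le_div_of_nonneg_right ?_ hs0.le
    rw [le_div_iff₀ two_pos, le_div_iff₀ (hKK _ (hlogs s hs))]
    linarith [hKKge _ (hlogs s hs)]
  have hLm : L (Real.exp t) ≤ L (κ * r) := by
    simp only [hL]
    have := Real.log_le_log (hKK _ (hlogs _ le_rfl))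
      (hKKm (hlogs _ le_rfl) htl (Real.log_le_log (Real.exp_pos t) hr))
    linarith
  have hintegral : (∫ s in Real.exp t..κ * r, q (Real.log s) / s) ≤ L (κ * r) - L (Real.exp t) := by
    by_cases hI : IntervalIntegrable (fun s => q (Real.log s) / s) volume (Real.exp t) (κ * r)
    · refine intervalIntegral.integral_le_sub_of_hasDeriv_right_of_le hr
        (fun s hs => (hLd s hs.1).continuousAt.continuousWithinAt)
        (fun s hs => (hLd s hs.1.le).hasDerivWithinAt)
        ((intervalIntegrable_iff_integrableOn_Icc_of_le hr).1 hI) (fun s hs => hLq s hs.1.le)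
    · rw [intervalIntegral.integral_undef hI]
      linarith
  have hlt : Real.log (κ * r) < Real.log r := by linarith
  obtain ⟨z, hz, hz'⟩ := exists_hasDerivAt_eq_slope (fun x => K x ^ 2)
    (fun x => 2 * (K x * K' x)) hlt
    (fun x hx => ((hK x (htT.trans (htl.trans hx.1))).continuousAt.pow 2).continuousWithinAt)
    (fun x hx => ((hK x (htT.trans (htl.trans hx.1.le))).fun_pow 2).congr_deriv (by simp; ring))
  have hzm : K (Real.log (κ * r)) * K' (Real.log (κ * r)) ≤ K z * K' z :=
    hKKm htl (htl.trans hz.1.le) hz.1.le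
  have hδ' : Real.log r - Real.log (κ * r) = δ := by linarith
  rw [hδ', eq_div_iff hδ0.ne'] at hz'
  have hfin : 2 * δ * (K (Real.log (κ * r)) * K' (Real.log (κ * r))) ≤ K (Real.log r) ^ 2 := by
    nlinarith [sq_nonneg (K (Real.log (κ * r)))]
  have hpp := hKK _ htl
  have := Real.log_le_log (by positivity) hfin
  rw [Real.log_mul (by positivity) hpp.ne', Real.log_pow] at this
  simp only [hL] at hintegral ⊢
  push_cast at this
  linarith

theorem hasDerivAt_comp_max_zero {h h' : ℝ → ℝ} (hh : ∀ x, HasDerivAt h (h' x) x) (h0 : h 0 = 0)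
    (h'0 : h' 0 = 0) (x : ℝ) : HasDerivAt (fun x => h (max x 0)) (h' (max x 0)) x := by
  rcases lt_trichotomy x 0 with hx | rfl | hx
  · rw [max_eq_right hx.le, h'0]
    refine (hasDerivAt_const x (h 0)).congr_of_eventuallyEq ?_
    filter_upwards [Iio_mem_nhds hx] with y hy
    rw [max_eq_right (le_of_lt hy)]
  · rw [max_self, h'0, hasDerivAt_iff_isLittleO_nhds_zero]
    have h1 := hasDerivAt_iff_isLittleO_nhds_zero.1 (hh 0)
    simp only [h0, h'0, zero_add, sub_zero, smul_zero, max_self] at h1 ⊢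
    have ht : Tendsto (fun x : ℝ => max x 0) (𝓝 0) (𝓝 0) := by
      have : Continuous fun x : ℝ => max x 0 := by fun_prop
      simpa using this.tendsto 0
    refine (h1.comp_tendsto ht).trans_isBigO (Asymptotics.isBigO_of_le _ fun y => ?_)
    simp only [Function.comp, Real.norm_eq_abs]
    exact abs_le_abs_of_nonneg (le_max_right _ _) (max_le (le_abs_self y) (abs_nonneg y)) |>.trans
      (abs_abs y).le
  · rw [max_eq_left hx.le]
    refine (hh x).congr_of_eventuallyEq ?_
    filter_upwards [Ioi_mem_nhds hx] with y hy
    rw [max_eq_left (le_of_lt hy)]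

/-- A convex `C²` regularization of the positive part. -/
noncomputable def softPos (x : ℝ) : ℝ := max x 0 - Real.arctan (max x 0)

/-- The derivative of `softPos`. -/
noncomputable def softPosDeriv (x : ℝ) : ℝ := max x 0 ^ 2 / (1 + max x 0 ^ 2)

/-- The second derivative of `softPos`. -/
noncomputable def softPosDeriv₂ (x : ℝ) : ℝ := 2 * max x 0 / (1 + max x 0 ^ 2) ^ 2

theorem hasDerivAt_softPos (x : ℝ) : HasDerivAt softPos (softPosDeriv x) x := by
  refine hasDerivAt_comp_max_zero (h := fun x => x - Real.arctan x)
    (h' := fun x => x ^ 2 / (1 + x ^ 2)) (fun y => ?_) (by simp) (by simp) x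
  refine ((hasDerivAt_id' y).fun_sub (Real.hasDerivAt_arctan y)).congr_deriv ?_
  have : 1 + y ^ 2 ≠ 0 := by positivity
  field_simp
  ring

theorem hasDerivAt_softPosDeriv (x : ℝ) : HasDerivAt softPosDeriv (softPosDeriv₂ x) x := by
  refine hasDerivAt_comp_max_zero (h := fun x => x ^ 2 / (1 + x ^ 2))
    (h' := fun x => 2 * x / (1 + x ^ 2) ^ 2) (fun y => ?_) (by simp) (by simp) x
  have : 1 + y ^ 2 ≠ 0 := by positivity
  refine ((hasDerivAt_pow 2 y).fun_div ((hasDerivAt_pow 2 y).const_add 1) this).congr_deriv ?_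
  simp
  ring

theorem continuous_softPos : Continuous softPos := by unfold softPos; fun_prop

theorem continuous_softPosDeriv : Continuous softPosDeriv :=
  Continuous.div (by fun_prop) (by fun_prop) fun x => by positivity

theorem continuous_softPosDeriv₂ : Continuous softPosDeriv₂ :=
  Continuous.div (by fun_prop) (by fun_prop) fun x => by positivity

theorem softPos_of_nonpos {x : ℝ} (hx : x ≤ 0) : softPos x = 0 := by simp [softPos, hx]

theorem softPosDeriv_of_nonpos {x : ℝ} (hx : x ≤ 0) : softPosDeriv x = 0 := by
  simp [softPosDeriv, hx]

theorem softPosDeriv₂_of_nonpos {x : ℝ} (hx : x ≤ 0) : softPosDeriv₂ x = 0 := by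
  simp [softPosDeriv₂, hx]

theorem softPosDeriv_le_one (x : ℝ) : softPosDeriv x ≤ 1 := by
  unfold softPosDeriv
  rw [div_le_one (by positivity)]
  linarith

theorem softPosDeriv₂_nonneg (x : ℝ) : 0 ≤ softPosDeriv₂ x := by
  have : 0 ≤ max x 0 := le_max_right x 0
  unfold softPosDeriv₂
  positivity

theorem softPos_le (x : ℝ) : softPos x ≤ max x 0 :=
  sub_le_self _ (Real.arctan_nonneg.2 (le_max_right x 0))

theorem sub_pi_le_softPos (x : ℝ) : x - Real.pi ≤ softPos x := by
  unfold softPos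
  linarith [le_max_left x 0, Real.arctan_lt_pi_div_two (max x 0), Real.pi_pos]

theorem softPos_pos {x : ℝ} (hx : 0 < x) : 0 < softPos x := by
  have hd : ∀ y, HasDerivAt (fun x => x - Real.arctan x) (y ^ 2 / (1 + y ^ 2)) y := fun y => by
    refine ((hasDerivAt_id' y).fun_sub (Real.hasDerivAt_arctan y)).congr_deriv ?_
    have : 1 + y ^ 2 ≠ 0 := by positivity
    field_simp
    ring
  obtain ⟨z, hz, hz'⟩ := exists_hasDerivAt_eq_slope _ _ hx
    (fun y _ => (hd y).continuousAt.continuousWithinAt) (fun y _ => hd y)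
  have h1 : 0 < z ^ 2 / (1 + z ^ 2) := by have := hz.1; positivity
  rw [hz'] at h1
  simp only [Real.arctan_zero, sub_zero] at h1
  rw [softPos, max_eq_left hx.le]
  exact (div_pos_iff_of_pos_right hx).1 h1

theorem softPos_nonneg (x : ℝ) : 0 ≤ softPos x := by
  rcases le_or_gt x 0 with hx | hx
  · exact (softPos_of_nonpos hx).ge
  · exact (softPos_pos hx).le

section Cutoff

variable {W : Set ℂ} {w h h' : ℂ → ℝ}

theorem indicator_eventuallyEq_zero (hw : ∀ s ∉ W, ∀ᶠ s' in 𝓝 s, s' ∈ W → w s' ≤ 0)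
    (hh : ∀ s, w s ≤ 0 → h s = 0) {s : ℂ} (hs : s ∉ W) : W.indicator h =ᶠ[𝓝 s] fun _ => 0 := by
  filter_upwards [hw s hs] with s' hs'
  by_cases h1 : s' ∈ W
  · rw [Set.indicator_of_mem h1, hh s' (hs' h1)]
  · rw [Set.indicator_of_notMem h1]

theorem continuous_indicator_of_cutoff (hW : IsOpen W)
    (hw : ∀ s ∉ W, ∀ᶠ s' in 𝓝 s, s' ∈ W → w s' ≤ 0) (hh : ∀ s, w s ≤ 0 → h s = 0)
    (hc : ContinuousOn h W) : Continuous (W.indicator h) := by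
  refine continuous_iff_continuousAt.2 fun s => ?_
  by_cases hs : s ∈ W
  · refine (hc.continuousAt (hW.mem_nhds hs)).congr ?_
    filter_upwards [hW.mem_nhds hs] with s' hs'
    rw [Set.indicator_of_mem hs']
  · exact continuousAt_const.congr (indicator_eventuallyEq_zero hw hh hs).symm

theorem hasDerivAt_indicator_of_cutoff (hW : IsOpen W)
    (hw : ∀ s ∉ W, ∀ᶠ s' in 𝓝 s, s' ∈ W → w s' ≤ 0) (hh : ∀ s, w s ≤ 0 → h s = 0)
    {γ : ℝ → ℂ} (hγ : Continuous γ) {t : ℝ}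
    (hd : γ t ∈ W → HasDerivAt (fun t => h (γ t)) (h' (γ t)) t) :
    HasDerivAt (fun t => W.indicator h (γ t)) (W.indicator h' (γ t)) t := by
  by_cases hs : γ t ∈ W
  · rw [Set.indicator_of_mem hs]
    refine (hd hs).congr_of_eventuallyEq ?_
    filter_upwards [hγ.continuousAt.preimage_mem_nhds (hW.mem_nhds hs)] with t' ht'
    exact Set.indicator_of_mem (s := W) ht' h
  · rw [Set.indicator_of_notMem hs]
    exact (hasDerivAt_const t (0 : ℝ)).congr_of_eventuallyEq
      (hγ.continuousAt.eventually (indicator_eventuallyEq_zero hw hh hs))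

end Cutoff

theorem hasDerivAt_log_norm {G : ℝ → ℂ} {G' : ℂ} {t : ℝ} (hG : HasDerivAt G G' t)
    (h0 : G t ≠ 0) : HasDerivAt (fun t => Real.log ‖G t‖) (G' / G t).re t := by
  have h1 : HasDerivAt (fun t => ‖G t‖ ^ 2) (2 * inner ℝ (G t) G') t := hG.norm_sq
  have h2 : ‖G t‖ ^ 2 ≠ 0 := by positivity
  have h3 := (h1.log h2).div_const 2
  refine (h3.congr_deriv ?_).congr_of_eventuallyEq (Eventually.of_forall fun s => ?_)
  · rw [Complex.div_re, Complex.inner, ← Complex.normSq_eq_norm_sq]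
    simp
    ring
  · simp [Real.log_pow]

/-- `log |F| - b - a exp(β Re s)`, the function whose positive part is regularized. -/
noncomputable def logExcess (F : ℂ → ℂ) (a b β : ℝ) (s : ℂ) : ℝ :=
  Real.log ‖F s‖ - b - a * Real.exp (β * s.re)

/-- The restriction of `h` to `W`, extended by zero, in Cartesian coordinates. -/
noncomputable def cutoff (W : Set ℂ) (h : ℂ → ℝ) (x y : ℝ) : ℝ :=
  W.indicator h (x + y * Complex.I)

theorem hasDerivAt_comp_horizontal {G : ℂ → ℂ} {G' : ℂ} {x y : ℝ}
    (h : HasDerivAt G G' (x + y * Complex.I)) :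
    HasDerivAt (fun t : ℝ => G (t + y * Complex.I)) G' x := by
  have h1 : HasDerivAt (fun t : ℝ => (t : ℂ) + y * Complex.I) 1 x :=
    (Complex.ofRealCLM.hasDerivAt (x := x)).add_const _
  exact (HasDerivAt.comp x h h1).congr_deriv (mul_one _)

theorem hasDerivAt_comp_vertical {G : ℂ → ℂ} {G' : ℂ} {x y : ℝ}
    (h : HasDerivAt G G' (x + y * Complex.I)) :
    HasDerivAt (fun t : ℝ => G (x + t * Complex.I)) (G' * Complex.I) y := by
  have h1 : HasDerivAt (fun t : ℝ => (x : ℂ) + t * Complex.I) (1 * Complex.I) y :=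
    ((Complex.ofRealCLM.hasDerivAt (x := y)).mul_const _).const_add _
  exact (HasDerivAt.comp y h h1).congr_deriv (by rw [one_mul])

theorem hasDerivAt_re_of_real {G : ℝ → ℂ} {G' : ℂ} {t : ℝ} (h : HasDerivAt G G' t) :
    HasDerivAt (fun t => (G t).re) G'.re t :=
  (Complex.reCLM.hasFDerivAt.comp_hasDerivAt t h)

theorem hasDerivAt_im_of_real {G : ℝ → ℂ} {G' : ℂ} {t : ℝ} (h : HasDerivAt G G' t) :
    HasDerivAt (fun t => (G t).im) G'.im t :=
  (Complex.imCLM.hasFDerivAt.comp_hasDerivAt t h)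

theorem isPeriodicSubsolution_cutoff {F : ℂ → ℂ} (hF : Differentiable ℂ F) {W : Set ℂ}
    (hW : IsOpen W) (hF0 : ∀ s ∈ W, F s ≠ 0)
    (hFper : Function.Periodic F (2 * Real.pi * Complex.I))
    (hWper : ∀ s, s + 2 * Real.pi * Complex.I ∈ W ↔ s ∈ W) {a b β : ℝ} (ha : 0 ≤ a)
    (hcut : ∀ s ∉ W, ∀ᶠ s' in 𝓝 s, s' ∈ W → logExcess F a b β s' ≤ 0) :
    ∃ vx vxx vy vyy, IsPeriodicSubsolution (cutoff W fun s => softPos (logExcess F a b β s))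
      vx vxx vy vyy (fun x => a * β ^ 2 * Real.exp (β * x)) := by
  set w := logExcess F a b β with hw
  set l : ℂ → ℂ := logDeriv F with hl
  have hlW : DifferentiableOn ℂ l W := by
    have := (hF.contDiff (n := 2)).differentiable_deriv_two
    exact this.differentiableOn.div hF.differentiableOn hF0
  have hl' : ∀ s ∈ W, HasDerivAt l (deriv l s) s := fun s hs =>
    (hlW.differentiableAt (hW.mem_nhds hs)).hasDerivAt
  have hl'c : ContinuousOn (deriv l) W := (hlW.deriv hW).continuousOn
  have hlc : ContinuousOn l W := hlW.continuousOn
  have hwc : ContinuousOn w W := by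
    refine ((ContinuousOn.log hF.continuous.norm.continuousOn fun s hs => ?_).sub
      continuousOn_const).sub (by fun_prop)
    exact norm_ne_zero_iff.2 (hF0 s hs)
  set wx : ℂ → ℝ := fun s => (l s).re - a * β * Real.exp (β * s.re) with hwx
  set wy : ℂ → ℝ := fun s => -(l s).im with hwy
  set wxx : ℂ → ℝ := fun s => (deriv l s).re - a * β ^ 2 * Real.exp (β * s.re) with hwxx
  set wyy : ℂ → ℝ := fun s => -(deriv l s).re with hwyy
  have hwxc : ContinuousOn wx W :=
    (Complex.continuous_re.comp_continuousOn hlc).sub (by fun_prop)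
  have hwyc : ContinuousOn wy W := (Complex.continuous_im.comp_continuousOn hlc).neg
  have hwxxc : ContinuousOn wxx W :=
    (Complex.continuous_re.comp_continuousOn hl'c).sub (by fun_prop)
  have hwyyc : ContinuousOn wyy W := (Complex.continuous_re.comp_continuousOn hl'c).neg
  have g0 := continuous_softPos.comp_continuousOn hwc
  have g1 := continuous_softPosDeriv.comp_continuousOn hwc
  have g2 := continuous_softPosDeriv₂.comp_continuousOn hwc
  have dexp : ∀ x y : ℝ, HasDerivAt
      (fun t : ℝ => Real.exp (β * ((t : ℂ) + y * Complex.I).re))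
      (β * Real.exp (β * ((x : ℂ) + y * Complex.I).re)) x := fun x y => by
    simp only [Complex.add_re, Complex.ofReal_re, Complex.mul_re, Complex.I_re, mul_zero,
      Complex.ofReal_im, Complex.I_im, mul_one, sub_self, add_zero]
    exact (((hasDerivAt_id' x).const_mul β).exp).congr_deriv (by ring)
  have dwx : ∀ x y : ℝ, (x : ℂ) + y * Complex.I ∈ W →
      HasDerivAt (fun t : ℝ => w (t + y * Complex.I)) (wx (x + y * Complex.I)) x :=
    fun x y hs => by
    have h1 := hasDerivAt_log_norm (hasDerivAt_comp_horizontal (hF _).hasDerivAt) (hF0 _ hs)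
    refine ((h1.sub_const b).fun_sub ((dexp x y).const_mul a)).congr_deriv ?_
    simp only [hwx, hl, logDeriv_apply]
    ring
  have dwxx : ∀ x y : ℝ, (x : ℂ) + y * Complex.I ∈ W →
      HasDerivAt (fun t : ℝ => wx (t + y * Complex.I)) (wxx (x + y * Complex.I)) x :=
    fun x y hs => by
    have h1 := hasDerivAt_re_of_real (hasDerivAt_comp_horizontal (hl' _ hs))
    refine (h1.fun_sub ((dexp x y).const_mul (a * β))).congr_deriv ?_
    simp only [hwxx]
    ring
  have dwy : ∀ x y : ℝ, (x : ℂ) + y * Complex.I ∈ W →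
      HasDerivAt (fun t : ℝ => w (x + t * Complex.I)) (wy (x + y * Complex.I)) y :=
    fun x y hs => by
    have h1 := hasDerivAt_log_norm (hasDerivAt_comp_vertical (hF _).hasDerivAt) (hF0 _ hs)
    have h2 := (h1.sub_const b).sub_const (a * Real.exp (β * x))
    refine (h2.congr_deriv ?_).congr_of_eventuallyEq (Eventually.of_forall fun t => ?_)
    · simp only [hwy, hl, logDeriv_apply, mul_div_right_comm, Complex.mul_I_re]
    · simp [hw, logExcess]
  have dwyy : ∀ x y : ℝ, (x : ℂ) + y * Complex.I ∈ W →
      HasDerivAt (fun t : ℝ => wy (x + t * Complex.I)) (wyy (x + y * Complex.I)) y :=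
    fun x y hs => by
    have h1 := hasDerivAt_im_of_real (hasDerivAt_comp_vertical (hl' _ hs))
    refine h1.fun_neg.congr_deriv ?_
    simp only [hwyy, Complex.mul_I_im]
  have z0 : ∀ s, w s ≤ 0 → softPos (w s) = 0 := fun s hs => softPos_of_nonpos hs
  have z1 : ∀ (u : ℂ → ℝ) s, w s ≤ 0 → softPosDeriv (w s) * u s = 0 := fun u s hs => by
    rw [softPosDeriv_of_nonpos hs, zero_mul]
  have z2 : ∀ (u₁ u₂ : ℂ → ℝ) s, w s ≤ 0 →
      softPosDeriv₂ (w s) * u₁ s ^ 2 + softPosDeriv (w s) * u₂ s = 0 := fun u₁ u₂ s hs => by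
    rw [softPosDeriv_of_nonpos hs, softPosDeriv₂_of_nonpos hs]; ring
  have hcoord : Continuous fun p : ℝ × ℝ => (p.1 : ℂ) + p.2 * Complex.I := by fun_prop
  have hhor : ∀ y : ℝ, Continuous fun t : ℝ => (t : ℂ) + y * Complex.I := fun y => by fun_prop
  have hver : ∀ x : ℝ, Continuous fun t : ℝ => (x : ℂ) + t * Complex.I := fun x => by fun_prop
  have hshift : ∀ x y : ℝ, (x : ℂ) + (y + 2 * Real.pi : ℝ) * Complex.I =
      x + y * Complex.I + 2 * Real.pi * Complex.I := fun x y => by push_cast; ring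
  have hlper : ∀ s, l (s + 2 * Real.pi * Complex.I) = l s := fun s => by
    simp only [hl, logDeriv_apply, hFper s]
    rw [← deriv_comp_add_const]
    simp only [hFper _]
  have hwper : ∀ s, w (s + 2 * Real.pi * Complex.I) = w s := fun s => by
    simp [hw, logExcess, hFper s]
  have hind : ∀ {h : ℂ → ℝ} {s : ℂ}, (∀ s, h (s + 2 * Real.pi * Complex.I) = h s) →
      W.indicator h (s + 2 * Real.pi * Complex.I) = W.indicator h s := fun {h s} hh => by
    by_cases hs : s ∈ W
    · rw [Set.indicator_of_mem hs, Set.indicator_of_mem ((hWper s).2 hs), hh]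
    · rw [Set.indicator_of_notMem hs, Set.indicator_of_notMem (mt (hWper s).1 hs)]
  refine ⟨cutoff W fun s => softPosDeriv (w s) * wx s,
    cutoff W fun s => softPosDeriv₂ (w s) * wx s ^ 2 + softPosDeriv (w s) * wxx s,
    cutoff W fun s => softPosDeriv (w s) * wy s,
    cutoff W fun s => softPosDeriv₂ (w s) * wy s ^ 2 + softPosDeriv (w s) * wyy s,
    ?_, ?_, ?_, ?_, ?_, ?_, ?_, ?_, ?_, ?_, ?_, ?_, ?_⟩
  · exact (continuous_indicator_of_cutoff hW hcut z0 g0).comp hcoord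
  · exact (continuous_indicator_of_cutoff hW hcut (z1 _) (g1.mul hwxc)).comp hcoord
  · exact (continuous_indicator_of_cutoff hW hcut (z2 _ _)
      ((g2.mul (hwxc.pow 2)).add (g1.mul hwxxc))).comp hcoord
  · exact (continuous_indicator_of_cutoff hW hcut (z1 _) (g1.mul hwyc)).comp hcoord
  · exact (continuous_indicator_of_cutoff hW hcut (z2 _ _)
      ((g2.mul (hwyc.pow 2)).add (g1.mul hwyyc))).comp hcoord
  · intro x y
    refine hasDerivAt_indicator_of_cutoff (h' := fun s => softPosDeriv (w s) * wx s)
      hW hcut z0 (hhor y) fun hs => ?_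
    exact (hasDerivAt_softPos _).comp x (dwx x y hs)
  · intro x y
    refine hasDerivAt_indicator_of_cutoff (h := fun s => softPosDeriv (w s) * wx s)
      (h' := fun s => softPosDeriv₂ (w s) * wx s ^ 2 + softPosDeriv (w s) * wxx s)
      hW hcut (z1 _) (hhor y) fun hs => ?_
    exact (((hasDerivAt_softPosDeriv _).comp x (dwx x y hs)).fun_mul (dwxx x y hs)).congr_deriv
      (by simp only [Function.comp]; ring)
  · intro x y
    refine hasDerivAt_indicator_of_cutoff (h' := fun s => softPosDeriv (w s) * wy s)
      hW hcut z0 (hver x) fun hs => ?_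
    exact (hasDerivAt_softPos _).comp y (dwy x y hs)
  · intro x y
    refine hasDerivAt_indicator_of_cutoff (h := fun s => softPosDeriv (w s) * wy s)
      (h' := fun s => softPosDeriv₂ (w s) * wy s ^ 2 + softPosDeriv (w s) * wyy s)
      hW hcut (z1 _) (hver x) fun hs => ?_
    exact (((hasDerivAt_softPosDeriv _).comp y (dwy x y hs)).fun_mul (dwyy x y hs)).congr_deriv
      (by simp only [Function.comp]; ring)
  · intro x y
    rw [cutoff, hshift]
    exact hind fun s => by rw [hwper]
  · intro x y
    rw [cutoff, hshift]
    exact hind fun s => by simp only [hwper, hwy, hlper]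
  · exact fun x y => Set.indicator_nonneg (fun s _ => softPos_nonneg _) _
  · intro x y
    have hρ : 0 ≤ a * β ^ 2 * Real.exp (β * x) := by positivity
    by_cases hs : (x : ℂ) + y * Complex.I ∈ W
    · simp only [cutoff, Set.indicator_of_mem hs]
      set s := (x : ℂ) + y * Complex.I with hsdef
      have hsx : s.re = x := by simp [hsdef]
      have h1 : wxx s + wyy s = -(a * β ^ 2 * Real.exp (β * x)) := by
        simp only [hwxx, hwyy, hsx]; ring
      have h2 := mul_le_mul_of_nonneg_right (softPosDeriv_le_one (w s)) hρ
      have h3 := mul_nonneg (softPosDeriv₂_nonneg (w s)) (add_nonneg (sq_nonneg (wx s))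
        (sq_nonneg (wy s)))
      have h4 : softPosDeriv (w s) * (wxx s + wyy s) =
        softPosDeriv (w s) * -(a * β ^ 2 * Real.exp (β * x)) := by rw [h1]
      linarith
    · simp only [cutoff, Set.indicator_of_notMem hs]
      linarith

theorem carleman_sqrt_deriv₂ {J I I' I'' q ρ σ A e β : ℝ} (hJ : 0 < J) (hJI : J * J = I)
    (hC : I' ^ 2 / 2 + 2 * q ^ 2 * I ^ 2 - 2 * ρ * σ * J * I ≤ I * I'')
    (hρ : ρ = β ^ 2 * e) (he : 0 ≤ e) (hA : 0 ≤ A) (hq : 1 / 2 ≤ q)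
    (hAσ : A * (1 / 4 - β ^ 2) = σ * β ^ 2) :
    q ^ 2 * (J - A * e) ≤ (I'' * (2 * J) - I' * (2 * (I' / (2 * J)))) / (2 * J) ^ 2
      - A * β * (β * e) := by
  have hI : 0 < I := hJI ▸ mul_pos hJ hJ
  have h1 : q ^ 2 * J - ρ * σ ≤ (I'' * (2 * J) - I' * (2 * (I' / (2 * J)))) / (2 * J) ^ 2 := by
    have : (I'' * (2 * J) - I' * (2 * (I' / (2 * J)))) / (2 * J) ^ 2 =
        (I * I'' - I' ^ 2 / 2) / (2 * J * I) := by
      subst hJI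
      field_simp
    rw [this, le_div_iff₀ (by positivity)]
    calc (q ^ 2 * J - ρ * σ) * (2 * J * I) = 2 * q ^ 2 * (J * J) * I - 2 * ρ * σ * J * I := by ring
      _ = 2 * q ^ 2 * I ^ 2 - 2 * ρ * σ * J * I := by rw [hJI]; ring
      _ ≤ _ := by linarith
  have h2 : 1 / 4 ≤ q ^ 2 := by nlinarith
  have h3 := mul_le_mul_of_nonneg_right h2 (mul_nonneg hA he)
  have h4 : A * (1 / 4 - β ^ 2) * e = σ * β ^ 2 * e := by rw [hAσ]
  subst hρ
  nlinarith

theorem component_properties {f : ℂ → ℂ} (hf : Continuous f) {R : ℝ} {U : Set ℂ}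
    (hU : U ∈ componentsAR f R) :
    IsOpen U ∧ U.Nonempty ∧ (∀ z ∈ U, R < ‖f z‖) ∧
      ∀ z ∉ U, R < ‖f z‖ → ∀ᶠ z' in 𝓝 z, z' ∉ U := by
  obtain ⟨p, hp, rfl⟩ := hU
  have hA : IsOpen {w : ℂ | R < ‖f w‖} := isOpen_lt continuous_const hf.norm
  refine ⟨hA.connectedComponentIn, ⟨p, mem_connectedComponentIn hp⟩,
    fun z hz => connectedComponentIn_subset {w : ℂ | R < ‖f w‖} p hz, fun z hz hzR => ?_⟩
  filter_upwards [hA.connectedComponentIn.mem_nhds (mem_connectedComponentIn hzR)] with z' hz' hz''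
  rw [connectedComponentIn_eq hz'', ← connectedComponentIn_eq hz'] at hz
  exact hz (mem_connectedComponentIn hzR)

theorem squareMean_le {v : ℝ → ℝ → ℝ} {x N : ℝ} (hc : Continuous (v x)) (h0 : ∀ y, 0 ≤ v x y)
    (hN : ∀ y, v x y ≤ N) : squareMean v x ≤ 2 * Real.pi * N ^ 2 := by
  have : squareMean v x ≤ ∫ _ in (0 : ℝ)..2 * Real.pi, N ^ 2 :=
    intervalIntegral.integral_mono_on Real.two_pi_pos.le
      ((hc.pow 2).intervalIntegrable _ _) intervalIntegrable_const
      fun y _ => pow_le_pow_left₀ (h0 y) (hN y) 2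
  simpa using this

theorem positivityMeasure_eq {v : ℝ → ℝ → ℝ} {x : ℝ} (hc : Continuous (v x)) :
    positivityMeasure v x = volume.real ({y | 0 < v x y} ∩ Set.Ioc 0 (2 * Real.pi)) := by
  have hm : MeasurableSet {y | 0 < v x y} := (isOpen_lt continuous_const hc).measurableSet
  rw [positivityMeasure, intervalIntegral.integral_of_le Real.two_pi_pos.le,
    integral_indicator_one hm, measureReal_restrict_apply hm]

theorem positivityMeasure_le_two_pi {v : ℝ → ℝ → ℝ} {x : ℝ} (hc : Continuous (v x)) :
    positivityMeasure v x ≤ 2 * Real.pi := by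
  rw [positivityMeasure_eq hc]
  calc _ ≤ volume.real (Set.Ioc 0 (2 * Real.pi)) :=
        measureReal_mono Set.inter_subset_right measure_Ioc_lt_top.ne
    _ = 2 * Real.pi := by simp [Real.pi_pos.le]

theorem volume_angles_lt_top (P : ℝ → Prop) :
    volume {t : ℝ | t ∈ Set.Icc 0 (2 * Real.pi) ∧ P t} < ⊤ :=
  (measure_mono fun _ ht => ht.1).trans_lt (measure_Icc_lt_top (a := (0 : ℝ)) (b := 2 * Real.pi))

theorem angularMeasure_le_two_pi (V : Set ℂ) (r : ℝ) : angularMeasure V r ≤ 2 * Real.pi := by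
  have h : volume.real {t : ℝ | t ∈ Set.Icc 0 (2 * Real.pi) ∧
      (r : ℂ) * Complex.exp (t * Complex.I) ∈ V} ≤ volume.real (Set.Icc 0 (2 * Real.pi)) :=
    measureReal_mono (fun _ ht => ht.1) measure_Icc_lt_top.ne
  rw [Real.volume_real_Icc_of_le Real.two_pi_pos.le, sub_zero] at h
  exact h

theorem positivityMeasure_le_angularMeasure {v : ℝ → ℝ → ℝ} {x : ℝ} {V : Set ℂ}
    (hc : Continuous (v x))
    (h : ∀ y, 0 < v x y → Complex.exp (x + y * Complex.I) ∈ V) :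
    positivityMeasure v x ≤ angularMeasure V (Real.exp x) := by
  rw [positivityMeasure_eq hc]
  refine measureReal_mono (fun y hy => ⟨Set.Ioc_subset_Icc_self hy.2, ?_⟩)
    (volume_angles_lt_top _).ne
  have := h y hy.1
  rwa [Complex.exp_add, ← Complex.ofReal_exp] at this

theorem IsPeriodicSubsolution.positivityMeasure_pos {v vx vxx vy vyy : ℝ → ℝ → ℝ} {ρ : ℝ → ℝ}
    (h : IsPeriodicSubsolution v vx vxx vy vyy ρ) {x y₀ : ℝ} (hy₀ : v x y₀ = 0)
    (hI : 0 < squareMean v x) : 0 < positivityMeasure v x := by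
  by_contra! hneg
  set D := ∫ y in (0 : ℝ)..2 * Real.pi, vy x y ^ 2 with hD
  have hD0 : 0 ≤ D := intervalIntegral.integral_nonneg Real.two_pi_pos.le fun _ _ => sq_nonneg _
  have hpos : 0 ≤ D / squareMean v x + 1 := by positivity
  have := h.sq_mul_squareMean_le (c := √(D / squareMean v x + 1)) hy₀ (Real.sqrt_nonneg _)
    ((mul_nonpos_of_nonneg_of_nonpos (Real.sqrt_nonneg _) hneg).trans Real.pi_pos.le)
  rw [Real.sq_sqrt hpos, add_mul, div_mul_cancel₀ _ hI.ne'] at this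
  linarith

theorem eventually_const_mul_exp_le {β c D : ℝ} (hβ : β < 1 / 2) (hc : 0 < c) :
    ∀ᶠ x in atTop, D * Real.exp (β * x) ^ 2 ≤ c * Real.exp x := by
  have ht : Tendsto (fun x : ℝ => Real.exp ((1 - 2 * β) * x)) atTop atTop :=
    Real.tendsto_exp_atTop.comp (tendsto_id.const_mul_atTop (by linarith))
  filter_upwards [ht.eventually_ge_atTop (D / c)] with x hx
  have h1 : Real.exp x = Real.exp ((1 - 2 * β) * x) * Real.exp (β * x) ^ 2 := by
    rw [← Real.exp_nat_mul, ← Real.exp_add]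
    congr 1
    push_cast
    ring
  rw [div_le_iff₀ hc] at hx
  rw [h1]
  nlinarith [sq_nonneg (Real.exp (β * x))]

theorem le_maxModulus {f : ℂ → ℂ} (hf : Continuous f) {z : ℂ} {r : ℝ} (hz : ‖z‖ = r) :
    ‖f z‖ ≤ maxModulus f r :=
  le_csSup ((isCompact_sphere 0 r).image hf.norm).bddAbove
    ⟨z, by simpa using hz, rfl⟩

theorem norm_exp_coord (x y : ℝ) : ‖Complex.exp (x + y * Complex.I)‖ = Real.exp x := by
  simp [Complex.norm_exp]

/-- The pull-back of `softPos (log |f| - b - a |z|^β)` on `U` under the exponential map. -/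
noncomputable def tractFunction (f : ℂ → ℂ) (U : Set ℂ) (a b β : ℝ) : ℝ → ℝ → ℝ :=
  cutoff (Complex.exp ⁻¹' U) fun s => softPos (logExcess (fun s => f (Complex.exp s)) a b β s)

theorem tractFunction_of_mem {f : ℂ → ℂ} {U : Set ℂ} {a b β x y : ℝ}
    (h : Complex.exp (x + y * Complex.I) ∈ U) :
    tractFunction f U a b β x y =
      softPos (Real.log ‖f (Complex.exp (x + y * Complex.I))‖ - b - a * Real.exp (β * x)) := by
  rw [tractFunction, cutoff, Set.indicator_of_mem (by exact h)]
  simp [logExcess]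

theorem tractFunction_of_notMem {f : ℂ → ℂ} {U : Set ℂ} {a b β x y : ℝ}
    (h : Complex.exp (x + y * Complex.I) ∉ U) : tractFunction f U a b β x y = 0 := by
  rw [tractFunction, cutoff, Set.indicator_of_notMem (by exact h)]

theorem tractFunction_le {f : ℂ → ℂ} {U : Set ℂ} {a b β x y m : ℝ} (ha : 0 ≤ a)
    (h0 : Complex.exp (x + y * Complex.I) ∈ U → 0 < ‖f (Complex.exp (x + y * Complex.I))‖)
    (hm : ‖f (Complex.exp (x + y * Complex.I))‖ ≤ m) :
    tractFunction f U a b β x y ≤ max (Real.log m - b) 0 := by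
  by_cases h : Complex.exp (x + y * Complex.I) ∈ U
  · rw [tractFunction_of_mem h]
    refine (softPos_le _).trans (max_le_max ?_ le_rfl)
    have h1 := Real.log_le_log (h0 h) hm
    have h2 := mul_nonneg ha (Real.exp_pos (β * x)).le
    linarith
  · rw [tractFunction_of_notMem h]
    exact le_max_right _ _

theorem mem_of_tractFunction_pos {f : ℂ → ℂ} {U : Set ℂ} {b β x y : ℝ} (hb : 0 ≤ b)
    (h0 : Complex.exp (x + y * Complex.I) ∈ U → 0 < ‖f (Complex.exp (x + y * Complex.I))‖)
    (h : 0 < tractFunction f U 1 b β x y) :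
    Complex.exp (x + y * Complex.I) ∈ {z ∈ U | Real.exp (‖z‖ ^ β) ≤ ‖f z‖} := by
  by_cases hU : Complex.exp (x + y * Complex.I) ∈ U
  · refine ⟨hU, ?_⟩
    rw [tractFunction_of_mem hU] at h
    have h1 : 0 < Real.log ‖f (Complex.exp (x + y * Complex.I))‖ - b - 1 * Real.exp (β * x) := by
      by_contra! hneg
      exact h.ne' (softPos_of_nonpos hneg)
    rw [norm_exp_coord, ← Real.exp_mul, mul_comm x, ← Real.le_log_iff_exp_le (h0 hU)]
    linarith
  · exact absurd (tractFunction_of_notMem hU) h.ne'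

theorem tractFunction_le_add {f : ℂ → ℂ} {U : Set ℂ} {b B β x y : ℝ} (hbB : b ≤ B) (hβ : 0 ≤ β)
    (hx : 0 ≤ x) : tractFunction f U 0 b β x y ≤
      tractFunction f U 1 B β x y + (B - b + 1 + Real.pi) * Real.exp (β * x) := by
  have he : 1 ≤ Real.exp (β * x) := Real.one_le_exp (mul_nonneg hβ hx)
  have hpi := Real.pi_pos
  by_cases h : Complex.exp (x + y * Complex.I) ∈ U
  · rw [tractFunction_of_mem h, tractFunction_of_mem h]
    set L := Real.log ‖f (Complex.exp (x + y * Complex.I))‖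
    have h1 := sub_pi_le_softPos (L - B - 1 * Real.exp (β * x))
    have h2 := softPos_nonneg (L - B - 1 * Real.exp (β * x))
    have h3 : 0 ≤ (B - b + Real.pi) * (Real.exp (β * x) - 1) :=
      mul_nonneg (by linarith) (by linarith)
    refine (softPos_le _).trans (max_le ?_ ?_) <;> nlinarith
  · rw [tractFunction_of_notMem h, tractFunction_of_notMem h, zero_add]
    exact mul_nonneg (by linarith) (by linarith)

theorem exists_isPeriodicSubsolution_tractFunction {f : ℂ → ℂ} (hf : Differentiable ℂ f) {R : ℝ}
    (hR : 0 < R) {U : Set ℂ} (hU : U ∈ componentsAR f R) {a b : ℝ} (β : ℝ) (ha : 0 ≤ a)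
    (hb : Real.log R < b) :
    ∃ vx vxx vy vyy, IsPeriodicSubsolution (tractFunction f U a b β)
      vx vxx vy vyy (fun x => a * β ^ 2 * Real.exp (β * x)) := by
  obtain ⟨hUo, -, hUR, hUc⟩ := component_properties hf.continuous hU
  have hper : ∀ s : ℂ, Complex.exp (s + 2 * Real.pi * Complex.I) = Complex.exp s :=
    Complex.exp_periodic
  have hFc : Continuous fun s => ‖f (Complex.exp s)‖ :=
    (hf.continuous.comp Complex.continuous_exp).norm
  refine isPeriodicSubsolution_cutoff (F := fun s => f (Complex.exp s))
    (hf.comp Complex.differentiable_exp)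
    (hUo.preimage Complex.continuous_exp) (fun s hs => ?_) (fun s => by simp only [hper])
    (fun s => by simp only [Set.mem_preimage, hper]) ha fun s hs => ?_
  · exact norm_pos_iff.1 (hR.trans (hUR _ hs))
  · by_cases hsR : R < ‖f (Complex.exp s)‖
    · filter_upwards [Complex.continuous_exp.continuousAt.eventually (hUc _ hs hsR)] with s' h1 h2
      exact absurd h2 h1
    · have hlt : ‖f (Complex.exp s)‖ < Real.exp b :=
        (not_lt.1 hsR).trans_lt ((Real.log_lt_iff_lt_exp hR).1 hb)
      filter_upwards [hFc.continuousAt.eventually_lt_const hlt] with s' h1 h2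
      have h3 := (Real.log_lt_iff_lt_exp (hR.trans (hUR _ h2))).2 h1
      have h4 := mul_nonneg ha (Real.exp_pos (β * s'.re)).le
      simp only [logExcess]
      linarith

theorem eventually_exists_tractFunction_eq_zero {f : ℂ → ℂ} {U : Set ℂ}
    (hcirc : ∀ᶠ r in atTop, ¬ Metric.sphere (0 : ℂ) r ⊆ U) (β : ℝ) :
    ∀ᶠ x in atTop, ∃ y, ∀ a b, tractFunction f U a b β x y = 0 := by
  filter_upwards [Real.tendsto_exp_atTop.eventually hcirc] with x hx
  obtain ⟨z, hz, hzU⟩ := Set.not_subset.1 hx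
  have hz' : ‖z‖ = Real.exp x := by simpa using hz
  refine ⟨z.arg, fun a b => tractFunction_of_notMem ?_⟩
  rwa [Complex.exp_add, ← Complex.ofReal_exp, ← hz', Complex.norm_mul_exp_arg_mul_I]

/-- The square mean of `tractFunction` without the `|z|^β` correction grows at least like
`exp x`. -/
theorem exists_exp_le_squareMean_tractFunction {f : ℂ → ℂ} (hf : Differentiable ℂ f) {R : ℝ}
    (hR : 0 < R) {U : Set ℂ} (hU : U ∈ componentsAR f R)
    (hcirc : ∀ᶠ r in atTop, ¬ Metric.sphere (0 : ℂ) r ⊆ U) (β : ℝ) :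
    ∃ b, Real.log R < b ∧ ∃ c > 0, ∀ᶠ x in atTop,
      c * Real.exp x ≤ squareMean (tractFunction f U 0 b β) x := by
  obtain ⟨hUo, ⟨p, hp⟩, hUR, -⟩ := component_properties hf.continuous hU
  obtain ⟨z, hz, hz0⟩ : ∃ z ∈ U, z ≠ 0 := by
    have := (dense_compl_singleton (0 : ℂ)).inter_open_nonempty U hUo ⟨p, hp⟩
    exact this
  obtain ⟨b, hb, hbz⟩ := exists_between (Real.log_lt_log hR (hUR z hz))
  refine ⟨b, hb, ?_⟩
  obtain ⟨vx, vxx, vy, vyy, h⟩ :=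
    exists_isPeriodicSubsolution_tractFunction hf hR hU β le_rfl hb
  obtain ⟨T, hT⟩ := eventually_atTop.1 (eventually_exists_tractFunction_eq_zero (f := f) hcirc β)
  obtain ⟨m, hm⟩ := (isCompact_closedBall (0 : ℂ) 1).exists_bound_of_continuousOn
    hf.continuous.continuousOn
  refine exists_exp_le_of_sq_add_sq_le (T := T)
    (M := 2 * Real.pi * max (Real.log m - b) 0 ^ 2) h.hasDerivAt_squareMean
    h.hasDerivAt_squareMeanDeriv (fun x => h.squareMeanDeriv₂_nonneg (by ring))
    (squareMean_nonneg _) (fun x hx => ?_) ?_ (fun x hx => ?_)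
  · refine squareMean_le (h.continuous_section x).1 (h.nonneg x) fun y =>
      tractFunction_le le_rfl (fun hs => hR.trans (hUR _ hs)) (hm _ ?_)
    rw [mem_closedBall_zero_iff, norm_exp_coord]
    exact Real.exp_le_one_iff.2 hx
  · have hexp : Complex.exp ((Complex.log z).re + (Complex.log z).im * Complex.I) = z := by
      rw [Complex.re_add_im, Complex.exp_log hz0]
    refine ⟨(Complex.log z).re, ?_⟩
    have hp : Function.Periodic (fun y => tractFunction f U 0 b β (Complex.log z).re y ^ 2)
        (2 * Real.pi) := fun y => by simp only [h.periodic _ y]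
    have he := hp.intervalIntegral_add_eq 0 (Complex.log z).im
    rw [zero_add] at he
    rw [squareMean, he]
    refine intervalIntegral.integral_pos (by linarith [Real.pi_pos])
      ((h.continuous_section _).1.pow 2).continuousOn (fun _ _ => sq_nonneg _)
      ⟨(Complex.log z).im, ⟨le_rfl, by linarith [Real.pi_pos]⟩, ?_⟩
    have : 0 < tractFunction f U 0 b β (Complex.log z).re (Complex.log z).im := by
      rw [tractFunction_of_mem (by rwa [hexp]), hexp]
      exact softPos_pos (by linarith)
    positivity
  · obtain ⟨y₀, hy₀⟩ := hT x hx
    have := h.carleman (x := x) (c := 1 / 2) (by simp) (hy₀ 0 b) (by norm_num)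
      (by linarith [positivityMeasure_le_two_pi (h.continuous_section x).1])
    simp only [zero_mul, mul_zero, sub_zero] at this
    linarith

theorem eventually_sq_le_squareMean_tractFunction {f : ℂ → ℂ} (hf : Differentiable ℂ f) {R : ℝ}
    (hR : 0 < R) {U : Set ℂ} (hU : U ∈ componentsAR f R)
    (hcirc : ∀ᶠ r in atTop, ¬ Metric.sphere (0 : ℂ) r ⊆ U) {β : ℝ} (hβ0 : 0 ≤ β)
    (hβ : β < 1 / 2) :
    ∃ B, 0 ≤ B ∧ Real.log R < B ∧ ∀ A : ℝ, ∀ᶠ x in atTop,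
      (A * Real.exp (β * x)) ^ 2 ≤ squareMean (tractFunction f U 1 B β) x := by
  obtain ⟨b, hb, c, hc, hgrow⟩ := exists_exp_le_squareMean_tractFunction hf hR hU hcirc β
  have hbB : b ≤ max b 0 := le_max_left b 0
  refine ⟨max b 0, le_max_right b 0, hb.trans_le hbB, fun A => ?_⟩
  set B := max b 0
  set D := B - b + 1 + Real.pi with hD
  obtain ⟨_, _, _, _, h₀⟩ := exists_isPeriodicSubsolution_tractFunction hf hR hU β le_rfl hb
  obtain ⟨_, _, _, _, h₁⟩ := exists_isPeriodicSubsolution_tractFunction hf hR hU β zero_le_one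
    (hb.trans_le hbB)
  filter_upwards [hgrow, eventually_ge_atTop 0,
    eventually_const_mul_exp_le (D := 2 * A ^ 2 + 4 * Real.pi * D ^ 2) hβ hc] with x hx hx0 hx1
  have c0 := (h₀.continuous_section x).1
  have c1 := (h₁.continuous_section x).1
  set e := Real.exp (β * x)
  have hle : squareMean (tractFunction f U 0 b β) x ≤
      ∫ y in (0 : ℝ)..2 * Real.pi, (2 * tractFunction f U 1 B β x y ^ 2 + 2 * (D * e) ^ 2) := by
    refine intervalIntegral.integral_mono_on Real.two_pi_pos.le
      ((c0.pow 2).intervalIntegrable _ _)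
      (Continuous.intervalIntegrable (by fun_prop) _ _) fun y _ => ?_
    have h1 := tractFunction_le_add (f := f) (U := U) (y := y) hbB hβ0 hx0
    have h2 := pow_le_pow_left₀ (h₀.nonneg x y) h1 2
    nlinarith [sq_nonneg (tractFunction f U 1 B β x y - D * e)]
  rw [intervalIntegral.integral_add (Continuous.intervalIntegrable (by fun_prop) _ _)
    intervalIntegrable_const, intervalIntegral.integral_const_mul,
    intervalIntegral.integral_const, smul_eq_mul, sub_zero] at hle
  change _ ≤ 2 * squareMean (tractFunction f U 1 B β) x + _ at hle
  nlinarith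

theorem tsuji_refined
    (f : ℂ → ℂ) (hf : Differentiable ℂ f) (R : ℝ) (hR : 0 < R)
    (U : Set ℂ) (hU : U ∈ componentsAR f R)
    (hcirc : ∀ᶠ r in atTop, ¬ Metric.sphere (0 : ℂ) r ⊆ U)
    (β : ℝ) (hβ0 : 0 < β) (hβ : β < 1 / 2)
    (V : Set ℂ)
    (hV : V = {z ∈ U | Real.exp (‖z‖ ^ β) ≤ ‖f z‖})
    (κ : ℝ) (hκ : κ ∈ Set.Ioo (0 : ℝ) 1) :
    ∃ C r₀ : ℝ, (∀ t, r₀ ≤ t → 0 < angularMeasure V t) ∧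
      ∀ r, r₀ / κ ≤ r →
        Real.pi * (∫ t in r₀..(κ * r), 1 / (t * angularMeasure V t)) - C ≤
          Real.log (Real.log (maxModulus f r)) := by
  obtain ⟨hκ0, hκ1⟩ := hκ
  obtain ⟨-, -, hUR, -⟩ := component_properties hf.continuous hU
  have hU0 : ∀ z ∈ U, 0 < ‖f z‖ := fun z hz => hR.trans (hUR z hz)
  obtain ⟨B, hB0, hRB, hgrow⟩ :=
    eventually_sq_le_squareMean_tractFunction hf hR hU hcirc hβ0.le hβ
  obtain ⟨vx, vxx, vy, vyy, h⟩ :=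
    exists_isPeriodicSubsolution_tractFunction hf hR hU β zero_le_one hRB
  set v := tractFunction f U 1 B β with hv
  have hβ2 : 0 < 1 / 4 - β ^ 2 := by nlinarith
  set A := √(2 * Real.pi) * β ^ 2 / (1 / 4 - β ^ 2) with hA
  have hA0 : 0 ≤ A := by positivity
  have hAσ : A * (1 / 4 - β ^ 2) = √(2 * Real.pi) * β ^ 2 := div_mul_cancel₀ _ hβ2.ne'
  obtain ⟨T, hT⟩ := eventually_atTop.1 ((hgrow (A + 1)).and
    (eventually_exists_tractFunction_eq_zero (f := f) hcirc β))
  have hIpos : ∀ x, T ≤ x → 0 < squareMean v x := fun x hx =>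
    lt_of_lt_of_le (by positivity) (hT x hx).1
  have hψle : ∀ x, positivityMeasure v x ≤ angularMeasure V (Real.exp x) := fun x =>
    positivityMeasure_le_angularMeasure (h.continuous_section x).1 fun y hy =>
      hV ▸ mem_of_tractFunction_pos hB0 (hU0 _) hy
  have hψ : ∀ x, T ≤ x → 0 < angularMeasure V (Real.exp x) := fun x hx => by
    obtain ⟨y₀, hy₀⟩ := (hT x hx).2
    exact (h.positivityMeasure_pos (hy₀ 1 B) (hIpos x hx)).trans_le (hψle x)
  set K : ℝ → ℝ := fun x => √(squareMean v x) - A * Real.exp (β * x) with hKdef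
  set q : ℝ → ℝ := fun x => Real.pi / angularMeasure V (Real.exp x) with hqdef
  have hexp : ∀ x, HasDerivAt (fun x => Real.exp (β * x)) (β * Real.exp (β * x)) x := fun x =>
    (((hasDerivAt_id' x).const_mul β).exp).congr_deriv (by ring)
  have hKge : ∀ x, T ≤ x → Real.exp (β * x) ≤ K x := fun x hx => by
    have := Real.le_sqrt_of_sq_le (hT x hx).1
    simp only [hKdef]
    linarith
  have hJd : ∀ x, T ≤ x → HasDerivAt (fun x => √(squareMean v x))
      (squareMeanDeriv v vx x / (2 * √(squareMean v x))) x := fun x hx =>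
    (h.hasDerivAt_squareMean x).sqrt (hIpos x hx).ne'
  obtain ⟨C, t, htT, ht⟩ := exists_integral_le_log (K := K) (q := q) (T := T)
    (K' := fun x => squareMeanDeriv v vx x / (2 * √(squareMean v x)) -
      A * β * Real.exp (β * x))
    (K'' := fun x => (squareMeanDeriv₂ v vx vxx x * (2 * √(squareMean v x)) -
      squareMeanDeriv v vx x * (2 * (squareMeanDeriv v vx x / (2 * √(squareMean v x))))) /
      (2 * √(squareMean v x)) ^ 2 - A * β * (β * Real.exp (β * x))) hκ0 hκ1
    (fun x hx => ((hJd x hx).fun_sub ((hexp x).const_mul A)).congr_deriv (by ring))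
    (fun x hx => ((h.hasDerivAt_squareMeanDeriv x).fun_div ((hJd x hx).const_mul 2)
      (by have := Real.sqrt_pos.2 (hIpos x hx); positivity)).fun_sub
      ((hexp x).const_mul (A * β)))
    (fun x hx => (Real.exp_pos _).trans_le (hKge x hx))
    (fun x hx => div_nonneg Real.pi_pos.le (hψ x hx).le)
    (fun x hx => by
      obtain ⟨y₀, hy₀⟩ := (hT x hx).2
      have hq0 : 0 ≤ q x := div_nonneg Real.pi_pos.le (hψ x hx).le
      have hq1 : q x * positivityMeasure v x ≤ Real.pi := by
        refine (mul_le_mul_of_nonneg_left (hψle x) hq0).trans_eq ?_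
        exact div_mul_cancel₀ _ (hψ x hx).ne'
      have hq2 : 1 / 2 ≤ q x := by
        rw [hqdef, div_le_div_iff₀ two_pos (hψ x hx)]
        linarith [angularMeasure_le_two_pi V (Real.exp x)]
      exact carleman_sqrt_deriv₂ (Real.sqrt_pos.2 (hIpos x hx))
        (Real.mul_self_sqrt (hIpos x hx).le)
        (h.carleman (by positivity) (hy₀ 1 B) hq0 hq1) (by ring) (Real.exp_pos _).le hA0 hq2 hAσ)
    (tendsto_atTop_mono' _ ((eventually_ge_atTop T).mono hKge)
      (Real.tendsto_exp_atTop.comp (tendsto_id.const_mul_atTop hβ0)))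
  refine ⟨C + Real.log √(2 * Real.pi), Real.exp t, fun s hs => ?_, fun r hr => ?_⟩
  · have hs0 : 0 < s := (Real.exp_pos t).trans_le hs
    have := hψ (Real.log s) (htT.trans ((Real.le_log_iff_exp_le hs0).2 hs))
    rwa [Real.exp_log hs0] at this
  · rw [div_le_iff₀' hκ0] at hr
    have hr0 : 0 < r := pos_of_mul_pos_right ((Real.exp_pos t).trans_le hr) hκ0.le
    have htr : T ≤ Real.log r := by
      refine htT.trans ((Real.le_log_iff_exp_le hr0).2 (hr.trans ?_))
      nlinarith
    have hintegral : (∫ s in Real.exp t..κ * r, q (Real.log s) / s) =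
        Real.pi * ∫ s in Real.exp t..κ * r, 1 / (s * angularMeasure V s) := by
      rw [← intervalIntegral.integral_const_mul]
      refine intervalIntegral.integral_congr fun s hs => ?_
      rw [Set.uIcc_of_le hr] at hs
      simp only [hqdef, Real.exp_log ((Real.exp_pos t).trans_le hs.1)]
      rw [div_div, mul_one_div, mul_comm]
    have hmain := ht r hr
    rw [hintegral] at hmain
    set N := max (Real.log (maxModulus f r) - B) 0 with hN
    have hI : squareMean v (Real.log r) ≤ 2 * Real.pi * N ^ 2 :=
      squareMean_le (h.continuous_section _).1 (h.nonneg _) fun y =>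
        tractFunction_le zero_le_one (hU0 _)
          (le_maxModulus hf.continuous (by rw [norm_exp_coord, Real.exp_log hr0]))
    have hN0 : 0 ≤ N := le_max_right _ _
    have hNpos : 0 < N := by
      rcases hN0.eq_or_lt with h0 | h0
      · rw [← h0] at hI
        linarith [hIpos _ htr]
      · exact h0
    have hNM : N ≤ Real.log (maxModulus f r) := by
      rcases lt_max_iff.1 hNpos with h1 | h1
      · rw [hN, max_eq_left h1.le]
        linarith
      · exact absurd h1 (lt_irrefl 0)
    have hKN : K (Real.log r) ≤ √(2 * Real.pi) * Real.log (maxModulus f r) := by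
      have h1 := Real.sqrt_le_sqrt hI
      rw [Real.sqrt_mul Real.two_pi_pos.le, Real.sqrt_sq hN0] at h1
      have h2 := mul_le_mul_of_nonneg_left hNM (Real.sqrt_nonneg (2 * Real.pi))
      have h3 := mul_nonneg hA0 (Real.exp_pos (β * Real.log r)).le
      simp only [hKdef]
      linarith
    have hlog := Real.log_le_log ((Real.exp_pos _).trans_le (hKge _ htr)) hKN
    rw [Real.log_mul (Real.sqrt_pos.2 Real.two_pi_pos).ne' (hNpos.trans_le hNM).ne'] at hlog
    linarith
end

section
/- Let f be an entire function, R > 0, and let U be a connected component of A_R = {z ∈ ℂ : |f(z)| > R} such that for all sufficiently large r the circle {z : |z| = r} is not contained in U. Let 0 < β < 1/2, put v(z) = log|f(z)| − |z|^β, V = {z ∈ U : v(z) ≥ 0}, V_r = {θ ∈ [0,2π] : r e^{iθ} ∈ V}, and m(r) = (1/(2π)) ∫_{V_r} v(r e^{iθ})^2 dθ. Then there exist positive constants c and r_0 such that m(r) ≥ c·r for all r ≥ r_0. -/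
open MeasureTheory Filter Topology

/-- The function `v(z) = log|f(z)| - |z|^β`. -/
noncomputable def vAux (f : ℂ → ℂ) (β : ℝ) (z : ℂ) : ℝ :=
  Real.log ‖f z‖ - ‖z‖ ^ β

/-- `m(r) = (1/(2π)) ∫_{V_r} v(r e^{iθ})² dθ`, where
`V_r = {θ ∈ [0,2π] : r e^{iθ} ∈ V}`. -/
noncomputable def mAux (f : ℂ → ℂ) (β : ℝ) (V : Set ℂ) (r : ℝ) : ℝ :=
  (1 / (2 * Real.pi)) *
    ∫ θ in {θ : ℝ | θ ∈ Set.Icc 0 (2 * Real.pi) ∧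
        (r : ℂ) * Complex.exp (θ * Complex.I) ∈ V},
      (vAux f β ((r : ℂ) * Complex.exp (θ * Complex.I))) ^ 2

theorem hasDerivAt_intervalIntegral_of_continuous_s4 {a b : ℝ} {k k' : ℝ → ℝ → ℝ}
    (hk : Continuous (Function.uncurry k)) (hk' : Continuous (Function.uncurry k'))
    (hd : ∀ t θ, HasDerivAt (fun s => k s θ) (k' t θ) t) (t : ℝ) :
    HasDerivAt (fun s => ∫ θ in a..b, k s θ) (∫ θ in a..b, k' t θ) t := by
  obtain ⟨C, hC⟩ := ((isCompact_closedBall t 1).prod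
    (isCompact_uIcc (a := a) (b := b))).exists_bound_of_continuousOn hk'.continuousOn
  refine (intervalIntegral.hasDerivAt_integral_of_dominated_loc_of_deriv_le
    (bound := fun _ => C) (Metric.closedBall_mem_nhds t one_pos) ?_ ?_ ?_ ?_ ?_ ?_).2
  · exact Eventually.of_forall fun s =>
      (hk.comp (Continuous.prodMk_right s)).aestronglyMeasurable
  · exact (hk.comp (Continuous.prodMk_right t)).intervalIntegrable _ _
  · exact (hk'.comp (Continuous.prodMk_right t)).aestronglyMeasurable
  · exact Eventually.of_forall fun θ hθ s hs => hC (s, θ) ⟨hs, Set.uIoc_subset_uIcc hθ⟩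
  · exact intervalIntegrable_const
  · exact Eventually.of_forall fun θ _ s _ => hd s θ

theorem Function.Periodic.of_hasDerivAt {g g' : ℝ → ℝ} {c : ℝ} (hper : Function.Periodic g c)
    (hg : ∀ x, HasDerivAt g (g' x) x) : Function.Periodic g' c := fun x =>
  ((hg (x + c)).comp_add_const x c).unique
    ((hg x).congr_of_eventuallyEq (Eventually.of_forall hper))

/-- A Wirtinger inequality with a constant `k ^ 2` below the optimal one. -/
theorem sq_mul_integral_sq_le {g g' : ℝ → ℝ} (hg : ∀ x, HasDerivAt g (g' x) x)
    (hg' : Continuous g') {a : ℝ} (ha : g a = 0) (hb : g (a + 2 * Real.pi) = 0)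
    {k : ℝ} (hk0 : 0 < k) (hk : k < 1 / 2) :
    k ^ 2 * ∫ x in a..(a + 2 * Real.pi), g x ^ 2 ≤ ∫ x in a..(a + 2 * Real.pi), g' x ^ 2 := by
  have hpi := Real.pi_pos
  have hgc : Continuous g := continuous_iff_continuousAt.2 fun x => (hg x).continuousAt
  have hab : a ≤ a + 2 * Real.pi := by linarith
  set φ : ℝ → ℝ := fun x => k * (x - a - Real.pi) with hφ
  have hcos : ∀ x ∈ Set.uIcc a (a + 2 * Real.pi), Real.cos (φ x) ≠ 0 := by
    intro x hx
    rw [Set.uIcc_of_le hab] at hx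
    refine (Real.cos_pos_of_mem_Ioo ⟨?_, ?_⟩).ne' <;> simp only [hφ] <;> nlinarith [hx.1, hx.2]
  have hφd : ∀ x, HasDerivAt φ k x := fun x => by
    simpa using (((hasDerivAt_id x).sub_const a).sub_const Real.pi).const_mul k
  have hφc : Continuous φ := by fun_prop
  have htan : ContinuousOn (fun x => Real.tan (φ x)) (Set.uIcc a (a + 2 * Real.pi)) := by
    intro x hx
    exact ((Real.continuousAt_tan.2 (hcos x hx)).comp hφc.continuousAt).continuousWithinAt
  set D : ℝ → ℝ := fun x => 2 * k * g x * g' x * Real.tan (φ x)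
    + k ^ 2 * g x ^ 2 * (1 + Real.tan (φ x) ^ 2) with hD
  have hDc : ContinuousOn D (Set.uIcc a (a + 2 * Real.pi)) := by
    have h1 := hgc.continuousOn (s := Set.uIcc a (a + 2 * Real.pi))
    have h2 := hg'.continuousOn (s := Set.uIcc a (a + 2 * Real.pi))
    simp only [hD]
    fun_prop
  have hderiv : ∀ x ∈ Set.uIcc a (a + 2 * Real.pi),
      HasDerivAt (fun y => k * g y ^ 2 * Real.tan (φ y)) (D x) x := by
    intro x hx
    have h1 := ((hg x).pow 2).const_mul k
    have h2 := (Real.hasDerivAt_tan (hcos x hx)).comp x (hφd x)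
    refine (h1.mul h2).congr_deriv ?_
    simp only [hD, Function.comp, one_div, ← Real.inv_one_add_tan_sq (hcos x hx), inv_inv]
    simp
    ring
  have hint := intervalIntegral.integral_eq_sub_of_hasDerivAt hderiv hDc.intervalIntegrable
  simp only [ha, hb] at hint
  have hI : 0 ≤ ∫ x in a..(a + 2 * Real.pi), (g' x ^ 2 - k ^ 2 * g x ^ 2 + D x) := by
    refine intervalIntegral.integral_nonneg hab fun x _ => ?_
    have : g' x ^ 2 - k ^ 2 * g x ^ 2 + D x = (g' x + k * g x * Real.tan (φ x)) ^ 2 := by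
      simp only [hD]; ring
    rw [this]; positivity
  rw [intervalIntegral.integral_add (Continuous.intervalIntegrable (by fun_prop) _ _)
    hDc.intervalIntegrable, intervalIntegral.integral_sub
    (Continuous.intervalIntegrable (by fun_prop) _ _)
    (Continuous.intervalIntegrable (by fun_prop) _ _),
    intervalIntegral.integral_const_mul, hint] at hI
  linarith

/-- Wirtinger's inequality for a `2π`-periodic function with a zero. -/
theorem integral_sq_le_of_periodic {g g' : ℝ → ℝ} (hg : ∀ x, HasDerivAt g (g' x) x)
    (hg' : Continuous g') (hper : Function.Periodic g (2 * Real.pi)) {a : ℝ} (ha : g a = 0) :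
    1 / 4 * ∫ x in 0..2 * Real.pi, g x ^ 2 ≤ ∫ x in 0..2 * Real.pi, g' x ^ 2 := by
  have hper' := hper.of_hasDerivAt hg
  have h1 := (hper.comp (· ^ 2)).intervalIntegral_add_eq 0 a
  have h2 := (hper'.comp (· ^ 2)).intervalIntegral_add_eq 0 a
  simp only [Function.comp, zero_add] at h1 h2
  rw [h1, h2]
  have hlim : Tendsto (fun k : ℝ => k ^ 2 * ∫ x in a..(a + 2 * Real.pi), g x ^ 2) (𝓝[<] (1 / 2))
      (𝓝 ((1 / 2) ^ 2 * ∫ x in a..(a + 2 * Real.pi), g x ^ 2)) :=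
    (Continuous.tendsto (by fun_prop) _).mono_left nhdsWithin_le_nhds
  have := le_of_tendsto hlim (b := ∫ x in a..(a + 2 * Real.pi), g' x ^ 2) (by
    filter_upwards [Ioo_mem_nhdsLT (show (0 : ℝ) < 1 / 2 by norm_num)] with k hk
    exact sq_mul_integral_sq_le hg hg' ha ((hper a).trans ha) hk.1 hk.2)
  norm_num at this ⊢
  exact this

/-- Exponential growth of the solutions of Carleman's differential inequality. -/
theorem exists_mul_exp_le_of_carleman {m m₁ m₂ : ℝ → ℝ}
    (hm : ∀ t, HasDerivAt m (m₁ t) t) (hm₁ : ∀ t, HasDerivAt m₁ (m₂ t) t)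
    (hm₂ : ∀ t, 0 ≤ m₂ t) {C : ℝ} (hC : ∀ t ≤ 0, m t ≤ C) {T t₀ : ℝ} (ht₀ : 0 < m t₀)
    (hT : ∀ t ≥ T, ∃ A, 2 * A + m t / 2 ≤ m₂ t ∧ m₁ t ^ 2 ≤ 4 * m t * A) :
    ∃ c t₁ : ℝ, 0 < c ∧ ∀ t ≥ t₁, c * Real.exp t ≤ m t := by
  have hmono₁ : Monotone m₁ := monotone_of_hasDerivAt_nonneg hm₁ hm₂
  have hpos₁ : ∀ t, 0 ≤ m₁ t := by
    intro a
    by_contra! ha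
    have hanti : AntitoneOn (fun t => m t - m₁ a * t) (Set.Iic a) := by
      refine antitoneOn_of_hasDerivWithinAt_nonpos (f' := fun t => m₁ t - m₁ a) (convex_Iic a)
        (fun t _ => ((hm t).continuousAt.sub (by fun_prop)).continuousWithinAt) (fun t _ => ?_)
        (fun t ht => ?_)
      · exact (((hm t).sub ((hasDerivAt_id t).const_mul (m₁ a))).congr_deriv
          (by simp)).hasDerivWithinAt
      · rw [interior_Iic] at ht
        linarith [hmono₁ (le_of_lt ht)]
    set s := min (min a 0) ((C + 1 - m a + m₁ a * a) / m₁ a)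
    have hsa : s ≤ a := (min_le_left _ _).trans (min_le_left _ _)
    have h1 := hanti hsa (le_refl a) hsa
    have h2 := hC s ((min_le_left _ _).trans (min_le_right _ _))
    have h3 : C + 1 - m a + m₁ a * a ≤ m₁ a * s := by
      have := mul_le_mul_of_nonpos_left
        (min_le_right (min a 0) ((C + 1 - m a + m₁ a * a) / m₁ a)) ha.le
      rwa [mul_div_cancel₀ _ ha.ne] at this
    simp only at h1
    linarith
  have hmono : Monotone m := monotone_of_hasDerivAt_nonneg hm hpos₁
  set a := max T t₀
  have hmp : ∀ t ≥ a, 0 < m t := fun t ht =>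
    ht₀.trans_le (hmono ((le_max_right _ _).trans ht))
  have hφ : ∀ t ≥ a, HasDerivAt (fun s => √(m s)) (m₁ t / (2 * √(m t))) t := fun t ht =>
    (hm t).sqrt (hmp t ht).ne'
  set y : ℝ → ℝ := fun t => m₁ t / (2 * √(m t)) + √(m t) / 2 with hy
  have hyd : ∀ t ≥ a, ∃ y', HasDerivAt y y' t ∧ y t / 2 ≤ y' := by
    intro t ht
    have hs : 0 < √(m t) := Real.sqrt_pos.2 (hmp t ht)
    have hss : √(m t) ^ 2 = m t := Real.sq_sqrt (hmp t ht).le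
    refine ⟨_, ((hm₁ t).div ((hφ t ht).const_mul 2) (by positivity)).add
      ((hφ t ht).div_const 2), ?_⟩
    obtain ⟨A, hA, hA'⟩ := hT t ((le_max_left _ _).trans ht)
    rw [← hss] at hA hA'
    simp only [hy]
    generalize √(m t) = s at *
    have hA'' : m₁ t ^ 2 / (2 * s ^ 2) ≤ 2 * A := by
      rw [div_le_iff₀ (by positivity)]; linarith
    rw [← sub_nonneg]
    have : 0 ≤ (m₂ t - m₁ t ^ 2 / (2 * s ^ 2) - s ^ 2 / 2) / (2 * s) :=
      div_nonneg (by linarith) (by positivity)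
    convert this using 1
    field_simp
    ring
  choose! y' hy' hyy' using hyd
  have hmonoy : MonotoneOn (fun t => y t * Real.exp (-t / 2)) (Set.Ici a) := by
    have hd : ∀ t ≥ a, HasDerivAt (fun t => y t * Real.exp (-t / 2))
        (y' t * Real.exp (-t / 2) + y t * (Real.exp (-t / 2) * (-1 / 2))) t := fun t ht =>
      (hy' t ht).mul ((((hasDerivAt_id t).neg).div_const 2).exp)
    refine monotoneOn_of_hasDerivWithinAt_nonneg (convex_Ici a)
      (fun t ht => (hd t ht).continuousAt.continuousWithinAt)
      (fun t ht => (hd t (interior_subset ht)).hasDerivWithinAt) (fun t ht => ?_)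
    have := hyy' t (interior_subset ht)
    nlinarith [Real.exp_pos (-t / 2)]
  set k := y a * Real.exp (-a / 2) with hk
  have hkpos : 0 < k := by
    have : 0 < √(m a) := Real.sqrt_pos.2 (hmp a le_rfl)
    have := hpos₁ a
    simp only [hk, hy]
    positivity
  have hmonoφ : MonotoneOn (fun t => √(m t) * Real.exp (t / 2) - k * Real.exp t) (Set.Ici a) := by
    have hd : ∀ t ≥ a, HasDerivAt (fun t => √(m t) * Real.exp (t / 2) - k * Real.exp t)
        (m₁ t / (2 * √(m t)) * Real.exp (t / 2) + √(m t) * (Real.exp (t / 2) * (1 / 2))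
          - k * Real.exp t) t := fun t ht =>
      ((hφ t ht).mul (((hasDerivAt_id t).div_const 2).exp)).sub
        ((Real.hasDerivAt_exp t).const_mul k)
    refine monotoneOn_of_hasDerivWithinAt_nonneg (convex_Ici a)
      (fun t ht => (hd t ht).continuousAt.continuousWithinAt)
      (fun t ht => (hd t (interior_subset ht)).hasDerivWithinAt) (fun t ht => ?_)
    have h1 : k ≤ y t * Real.exp (-t / 2) :=
      hmonoy Set.self_mem_Ici (interior_subset ht) (interior_subset ht)
    have h2 : Real.exp (-t / 2) * Real.exp t = Real.exp (t / 2) := by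
      rw [← Real.exp_add]; congr 1; ring
    have h3 := mul_le_mul_of_nonneg_right h1 (Real.exp_pos t).le
    rw [mul_assoc (y t), h2] at h3
    simp only [hy] at h3
    linarith
  refine ⟨(k / 2) ^ 2, a + 1, by positivity, fun t ht => ?_⟩
  have hta : a ≤ t := by linarith
  have h1 := hmonoφ Set.self_mem_Ici hta hta
  have h2 : Real.exp a * 2 ≤ Real.exp t := by
    calc Real.exp a * 2 ≤ Real.exp a * Real.exp 1 := by
          gcongr; linarith [Real.add_one_le_exp 1]
      _ = Real.exp (a + 1) := (Real.exp_add _ _).symm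
      _ ≤ Real.exp t := Real.exp_le_exp.2 ht
  have h3 : Real.exp t = Real.exp (t / 2) ^ 2 := by
    rw [← Real.exp_nat_mul]; congr 1; push_cast; ring
  have h4 : k / 2 * Real.exp (t / 2) ≤ √(m t) := by
    refine le_of_mul_le_mul_right ?_ (Real.exp_pos (t / 2))
    have : 0 ≤ √(m a) * Real.exp (a / 2) := by positivity
    simp only at h1
    rw [h3] at h1 h2
    nlinarith
  calc (k / 2) ^ 2 * Real.exp t = (k / 2 * Real.exp (t / 2)) ^ 2 := by rw [h3]; ring
    _ ≤ √(m t) ^ 2 := by gcongr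
    _ = m t := Real.sq_sqrt (hmp t hta).le

/-- Growth of the quadratic means of a nonnegative subharmonic function, in logarithmic
coordinates, that has a zero on all large circles. -/
theorem exists_mul_exp_le_integral_sq {g gt gs gtt gss : ℝ → ℝ → ℝ}
    (hg : Continuous (Function.uncurry g)) (hgt : Continuous (Function.uncurry gt))
    (hgs : Continuous (Function.uncurry gs)) (hgtt : Continuous (Function.uncurry gtt))
    (hgss : Continuous (Function.uncurry gss))
    (dgt : ∀ t s, HasDerivAt (fun t => g t s) (gt t s) t)
    (dgs : ∀ t s, HasDerivAt (fun s => g t s) (gs t s) s)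
    (dgtt : ∀ t s, HasDerivAt (fun t => gt t s) (gtt t s) t)
    (dgss : ∀ t s, HasDerivAt (fun s => gs t s) (gss t s) s)
    (hnonneg : ∀ t s, 0 ≤ g t s) (hsub : ∀ t s, 0 ≤ gtt t s + gss t s)
    (hper : ∀ t, Function.Periodic (g t) (2 * Real.pi))
    {C : ℝ} (hC : ∀ t ≤ 0, ∀ s, g t s ≤ C)
    {T : ℝ} (hT : ∀ t ≥ T, ∃ s, g t s = 0) {t₀ s₀ : ℝ} (hpos : 0 < g t₀ s₀) :
    ∃ c t₁ : ℝ, 0 < c ∧ ∀ t ≥ t₁, c * Real.exp t ≤ ∫ s in 0..2 * Real.pi, g t s ^ 2 := by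
  have hpi := Real.two_pi_pos
  have slice : ∀ {k : ℝ → ℝ → ℝ}, Continuous (Function.uncurry k) → ∀ t, Continuous (k t) :=
    fun hk t => hk.comp (Continuous.prodMk_right t)
  have hm : ∀ t, HasDerivAt (fun t => ∫ s in 0..2 * Real.pi, g t s ^ 2)
      (∫ s in 0..2 * Real.pi, 2 * (g t s * gt t s)) t := by
    refine hasDerivAt_intervalIntegral_of_continuous_s4 (k := fun t s => g t s ^ 2)
      (k' := fun t s => 2 * (g t s * gt t s)) (hg.pow 2)
      (continuous_const.mul (hg.mul hgt)) fun t s => ?_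
    refine ((dgt t s).pow 2).congr_deriv ?_
    simp; ring
  have hm₁ : ∀ t, HasDerivAt (fun t => ∫ s in 0..2 * Real.pi, 2 * (g t s * gt t s))
      (∫ s in 0..2 * Real.pi, 2 * (gt t s * gt t s + g t s * gtt t s)) t := by
    refine hasDerivAt_intervalIntegral_of_continuous_s4 (k := fun t s => 2 * (g t s * gt t s))
      (k' := fun t s => 2 * (gt t s * gt t s + g t s * gtt t s))
      (continuous_const.mul (hg.mul hgt))
      (continuous_const.mul ((hgt.mul hgt).add (hg.mul hgtt))) fun t s => ?_
    exact ((dgt t s).mul (dgtt t s)).const_mul 2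
  have hparts : ∀ t, ∫ s in 0..2 * Real.pi, (gs t s * gs t s + g t s * gss t s) = 0 := by
    intro t
    have := slice hg t
    have := slice hgs t
    have := slice hgss t
    rw [intervalIntegral.integral_eq_sub_of_hasDerivAt
      (fun s _ => (dgs t s).mul (dgss t s)) (Continuous.intervalIntegrable (by fun_prop) _ _)]
    have h1 := hper t 0
    have h2 := (hper t).of_hasDerivAt (dgs t) 0
    rw [zero_add] at h1 h2
    simp [h1, h2]
  have hm₂ : ∀ t, 2 * (∫ s in 0..2 * Real.pi, gt t s ^ 2) + 2 * ∫ s in 0..2 * Real.pi, gs t s ^ 2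
      ≤ ∫ s in 0..2 * Real.pi, 2 * (gt t s * gt t s + g t s * gtt t s) := by
    intro t
    have := slice hg t
    have := slice hgt t
    have := slice hgs t
    have := slice hgtt t
    have := slice hgss t
    have hle : ∫ s in 0..2 * Real.pi,
        (2 * gt t s ^ 2 + 2 * gs t s ^ 2 - 2 * (gs t s * gs t s + g t s * gss t s)) ≤
        ∫ s in 0..2 * Real.pi, 2 * (gt t s * gt t s + g t s * gtt t s) := by
      refine intervalIntegral.integral_mono_on hpi.le
        (Continuous.intervalIntegrable (by fun_prop) _ _)
        (Continuous.intervalIntegrable (by fun_prop) _ _) fun s _ => ?_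
      nlinarith [mul_nonneg (hnonneg t s) (hsub t s)]
    rw [intervalIntegral.integral_sub (Continuous.intervalIntegrable (by fun_prop) _ _)
      (Continuous.intervalIntegrable (by fun_prop) _ _),
      intervalIntegral.integral_add (Continuous.intervalIntegrable (by fun_prop) _ _)
      (Continuous.intervalIntegrable (by fun_prop) _ _)] at hle
    simp only [intervalIntegral.integral_const_mul] at hle ⊢
    rw [hparts t] at hle
    linarith
  have hsq : ∀ k : ℝ → ℝ, 0 ≤ ∫ s in 0..2 * Real.pi, k s ^ 2 := fun k =>
    intervalIntegral.integral_nonneg hpi.le fun s _ => sq_nonneg _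
  have hcs : ∀ t, (∫ s in 0..2 * Real.pi, 2 * (g t s * gt t s)) ^ 2 ≤
      4 * (∫ s in 0..2 * Real.pi, g t s ^ 2) * ∫ s in 0..2 * Real.pi, gt t s ^ 2 := by
    intro t
    have := slice hg t
    have := slice hgt t
    have hquad : ∀ x : ℝ, 0 ≤ (∫ s in 0..2 * Real.pi, g t s ^ 2) * (x * x)
        + (∫ s in 0..2 * Real.pi, 2 * (g t s * gt t s)) * x
        + ∫ s in 0..2 * Real.pi, gt t s ^ 2 := by
      intro x
      refine (hsq fun s => x * g t s + gt t s).trans_eq ?_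
      rw [← intervalIntegral.integral_mul_const, ← intervalIntegral.integral_mul_const,
        ← intervalIntegral.integral_add (Continuous.intervalIntegrable (by fun_prop) _ _)
        (Continuous.intervalIntegrable (by fun_prop) _ _),
        ← intervalIntegral.integral_add (Continuous.intervalIntegrable (by fun_prop) _ _)
        (Continuous.intervalIntegrable (by fun_prop) _ _)]
      congr 1
      ext s
      ring
    have := discrim_le_zero hquad
    rw [discrim] at this
    linarith
  refine exists_mul_exp_le_of_carleman (C := 2 * Real.pi * C ^ 2) (T := T) (t₀ := t₀) hm hm₁
    (fun t => ?_) (fun t ht => ?_) ?_ fun t ht => ⟨_, ?_, hcs t⟩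
  · linarith [hm₂ t, hsq (gt t), hsq (gs t)]
  · have := slice hg t
    have hle : ∫ s in 0..2 * Real.pi, g t s ^ 2 ≤ ∫ s in 0..2 * Real.pi, C ^ 2 := by
      refine intervalIntegral.integral_mono_on hpi.le
        (Continuous.intervalIntegrable (by fun_prop) _ _)
        (Continuous.intervalIntegrable (by fun_prop) _ _) fun s _ => ?_
      exact pow_le_pow_left₀ (hnonneg t s) (hC t ht s) 2
    simpa using hle
  · have := slice hg t₀
    obtain ⟨s₁, hs₁, hs₁'⟩ := (hper t₀).exists_mem_Ico₀ hpi s₀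
    refine intervalIntegral.integral_pos hpi (Continuous.continuousOn (by fun_prop))
      (fun s _ => sq_nonneg _) ⟨s₁, Set.Ico_subset_Icc_self hs₁, ?_⟩
    rw [← hs₁']
    positivity
  · obtain ⟨a, ha⟩ := hT t ht
    have := integral_sq_le_of_periodic (dgs t) (slice hgs t) (hper t) ha
    linarith [hm₂ t]

/-- There is a convex `C²` function that vanishes exactly on the nonpositive reals and grows at
most linearly. -/
theorem exists_convex_cutoff : ∃ χ χ₁ χ₂ : ℝ → ℝ,
    (∀ x, HasDerivAt χ (χ₁ x) x) ∧ (∀ x, HasDerivAt χ₁ (χ₂ x) x) ∧ Continuous χ₂ ∧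
    (∀ x, 0 ≤ χ₂ x) ∧ (∀ x ≤ 0, χ x = 0 ∧ χ₁ x = 0 ∧ χ₂ x = 0) ∧
    (∀ x, 0 < x → 0 < χ x) ∧ ∀ x, 0 ≤ χ x ∧ χ x ≤ max x 0 := by
  open Polynomial in
  refine ⟨fun x => x * expNegInvGlue x, fun x => (1 + X : ℝ[X]).eval x⁻¹ * expNegInvGlue x,
    fun x => (X ^ 3 : ℝ[X]).eval x⁻¹ * expNegInvGlue x, fun x => ?_, fun x => ?_,
    expNegInvGlue.continuous_polynomial_eval_inv_mul _, fun x => ?_, fun x hx => ?_,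
    fun x hx => mul_pos hx (expNegInvGlue.pos_of_pos hx), fun x => ?_⟩
  · have h := (hasDerivAt_id x).mul (expNegInvGlue.hasDerivAt_polynomial_eval_inv_mul 1 x)
    simp only [Polynomial.eval_one, one_mul] at h
    refine h.congr_deriv ?_
    rcases eq_or_ne x 0 with rfl | hx
    · simp
    · simp
      field_simp
  · refine (expNegInvGlue.hasDerivAt_polynomial_eval_inv_mul _ x).congr_deriv ?_
    simp only [Polynomial.eval_mul, Polynomial.eval_pow, Polynomial.eval_X, Polynomial.eval_sub,
      Polynomial.eval_add, Polynomial.eval_one, Polynomial.derivative_add,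
      Polynomial.derivative_one, Polynomial.derivative_X, Polynomial.eval_zero]
    ring
  · rcases le_or_gt x 0 with hx | hx
    · simp [expNegInvGlue.zero_of_nonpos hx]
    · have := expNegInvGlue.nonneg x
      simp only [Polynomial.eval_pow, Polynomial.eval_X]
      positivity
  · simp [expNegInvGlue.zero_of_nonpos hx]
  · rcases le_or_gt x 0 with hx | hx
    · simp [expNegInvGlue.zero_of_nonpos hx]
    · have h0 := expNegInvGlue.nonneg x
      have h1 : expNegInvGlue x ≤ 1 := by
        simp only [expNegInvGlue, not_le.2 hx, if_false]
        exact Real.exp_le_one_iff.2 (by simpa using hx.le)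
      rw [max_eq_left hx.le]
      exact ⟨by positivity, mul_le_of_le_one_right hx.le h1⟩

/-- A function that is continuous on `Ω` and vanishes on a set `Z` which, together with `Ωᶜ`,
covers a neighbourhood of every point outside `Ω`, extends continuously by zero. -/
theorem continuous_indicator_of_zero {Ω Z : Set ℂ}
    (hΩ : ∀ w, Ω ∈ 𝓝 w ∨ ∀ᶠ w' in 𝓝 w, w' ∉ Ω ∨ w' ∈ Z) {N : ℂ → ℝ}
    (hN : ∀ w ∈ Ω, ContinuousAt N w) (hZ : ∀ w ∈ Z, N w = 0) :
    Continuous (Ω.indicator N) := by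
  refine continuous_iff_continuousAt.2 fun w => ?_
  rcases hΩ w with h | h
  · refine (hN w (mem_of_mem_nhds h)).congr ?_
    filter_upwards [h] with w' hw' using (Set.indicator_of_mem hw' N).symm
  · refine (continuousAt_const (y := (0 : ℝ))).congr ?_
    filter_upwards [h] with w' hw'
    rcases hw' with hw' | hw'
    · exact (Set.indicator_of_notMem hw' N).symm
    · by_cases hm : w' ∈ Ω <;> simp [hm, hZ w' hw']

/-- The extension by zero of `continuous_indicator_of_zero` is differentiable along curves. -/
theorem hasDerivAt_indicator_of_zero {Ω Z : Set ℂ}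
    (hΩ : ∀ w, Ω ∈ 𝓝 w ∨ ∀ᶠ w' in 𝓝 w, w' ∉ Ω ∨ w' ∈ Z) {N N' : ℂ → ℝ} {γ : ℝ → ℂ} {t : ℝ}
    (hγ : ContinuousAt γ t) (hN : γ t ∈ Ω → HasDerivAt (fun s => N (γ s)) (N' (γ t)) t)
    (hZ : ∀ w ∈ Z, N w = 0) (hZ' : ∀ w ∈ Z, N' w = 0) :
    HasDerivAt (fun s => Ω.indicator N (γ s)) (Ω.indicator N' (γ t)) t := by
  have hzero : ∀ {M : ℂ → ℝ}, (∀ w ∈ Z, M w = 0) → ∀ w, w ∉ Ω ∨ w ∈ Z → Ω.indicator M w = 0 := by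
    intro M hM w hw
    rcases hw with hw | hw
    · exact Set.indicator_of_notMem hw M
    · by_cases hm : w ∈ Ω <;> simp [hm, hM w hw]
  rcases hΩ (γ t) with h | h
  · have hm := mem_of_mem_nhds h
    rw [Set.indicator_of_mem hm]
    refine (hN hm).congr_of_eventuallyEq ?_
    filter_upwards [hγ.eventually h] with s hs using Set.indicator_of_mem hs N
  · rw [hzero hZ' _ h.self_of_nhds]
    refine (hasDerivAt_const t (0 : ℝ)).congr_of_eventuallyEq ?_
    filter_upwards [hγ.eventually h] with s hs using hzero hZ _ hs

theorem hasDerivAt_log_norm_comp {h : ℂ → ℂ} {h' v : ℂ} {γ : ℝ → ℂ} {t : ℝ}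
    (hh : HasDerivAt h h' (γ t)) (hγ : HasDerivAt γ v t) (h0 : h (γ t) ≠ 0) :
    HasDerivAt (fun s => Real.log ‖h (γ s)‖) (h' / h (γ t) * v).re t := by
  have h1 := (hh.comp t hγ).norm_sq.log (by simpa using h0)
  have h2 := h1.div_const 2
  have h3 : (fun s => Real.log ‖h (γ s)‖) = fun s => Real.log (‖(h ∘ γ) s‖ ^ 2) / 2 := by
    ext s
    simp [Real.log_pow]
  rw [h3]
  refine h2.congr_deriv ?_
  have h4 : ‖h (γ t)‖ ^ 2 ≠ 0 := by simpa using h0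
  have h5 : h' / h (γ t) * v = (h' * v) * (starRingEnd ℂ) (h (γ t)) /
      ((‖h (γ t)‖ ^ 2 : ℝ) : ℂ) := by
    have := Complex.mul_conj' (h (γ t))
    push_cast
    rw [← this]
    have : (starRingEnd ℂ) (h (γ t)) ≠ 0 := by simpa using h0
    field_simp
  rw [h5, Complex.div_ofReal_re, Function.comp, Complex.inner]
  field_simp

/-- The first and second derivatives in the direction `v` of `χ (log ‖h‖ - b)`. -/
theorem hasDerivAt_comp_log_norm {h : ℂ → ℂ} (hh : Differentiable ℂ h) {χ χ₁ χ₂ : ℝ → ℝ}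
    (hχ : ∀ x, HasDerivAt χ (χ₁ x) x) (hχ₁ : ∀ x, HasDerivAt χ₁ (χ₂ x) x) (b : ℝ)
    {v : ℂ} {γ : ℝ → ℂ} {t : ℝ} (hγ : HasDerivAt γ v t) (h0 : h (γ t) ≠ 0) :
    HasDerivAt (fun s => χ (Real.log ‖h (γ s)‖ - b))
      (χ₁ (Real.log ‖h (γ t)‖ - b) * (logDeriv h (γ t) * v).re) t ∧
    HasDerivAt (fun s => χ₁ (Real.log ‖h (γ s)‖ - b) * (logDeriv h (γ s) * v).re)
      (χ₂ (Real.log ‖h (γ t)‖ - b) * (logDeriv h (γ t) * v).re ^ 2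
        + χ₁ (Real.log ‖h (γ t)‖ - b) * (deriv (logDeriv h) (γ t) * v * v).re) t := by
  have hF := (hasDerivAt_log_norm_comp (hh (γ t)).hasDerivAt hγ h0).sub_const b
  have hL : HasDerivAt (logDeriv h) (deriv (logDeriv h) (γ t)) (γ t) := by
    refine DifferentiableAt.hasDerivAt ?_
    exact (hh.deriv (γ t)).div (hh (γ t)) h0
  have hre : HasDerivAt (fun s => (logDeriv h (γ s) * v).re)
      (deriv (logDeriv h) (γ t) * v * v).re t :=
    Complex.reCLM.hasFDerivAt.comp_hasDerivAt t ((hL.comp t hγ).mul_const v)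
  refine ⟨(hχ _).comp t hF, ((((hχ₁ _).comp t hF).mul hre)).congr_deriv ?_⟩
  simp only [logDeriv_apply, Function.comp]
  ring

/-- Every point has a neighbourhood inside the component `U`, or one on which the points of `U`
lie below a given higher level. -/
theorem component_mem_nhds_or {f : ℂ → ℂ} (hf : Continuous f) {R ρ : ℝ} (hρ : R < ρ)
    {U : Set ℂ} (hU : U ∈ componentsAR f R) (z : ℂ) :
    U ∈ 𝓝 z ∨ ∀ᶠ z' in 𝓝 z, z' ∉ U ∨ ‖f z'‖ ≤ ρ := by
  obtain ⟨z₀, -, rfl⟩ := hU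
  have hopen : IsOpen {w : ℂ | R < ‖f w‖} := isOpen_lt continuous_const hf.norm
  rcases lt_or_ge ‖f z‖ ρ with h | h
  · right
    filter_upwards [(isOpen_lt hf.norm continuous_const).mem_nhds h] with z' hz' using
      Or.inr (le_of_lt hz')
  by_cases hz : z ∈ connectedComponentIn {w : ℂ | R < ‖f w‖} z₀
  · exact Or.inl (hopen.connectedComponentIn.mem_nhds hz)
  · right
    have hmem : z ∈ {w : ℂ | R < ‖f w‖} := hρ.trans_le h
    filter_upwards [hopen.connectedComponentIn.mem_nhds (mem_connectedComponentIn hmem)] with z' hz'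
    refine Or.inl fun hz'' => hz ?_
    rw [connectedComponentIn_eq hz'', ← connectedComponentIn_eq hz']
    exact mem_connectedComponentIn hmem

/-- The component `U` supports a nonnegative continuous function, dominated by a translate of
`log ‖f‖`, whose quadratic means over circles grow at least linearly in the radius. -/
theorem exists_minorant_with_growth {f : ℂ → ℂ} (hf : Differentiable ℂ f) {R : ℝ} (hR : 0 < R)
    {U : Set ℂ} (hU : U ∈ componentsAR f R)
    (hcirc : ∀ᶠ r in atTop, ¬ Metric.sphere (0 : ℂ) r ⊆ U) :
    ∃ (g : ℂ → ℝ) (b c r₁ : ℝ), Continuous g ∧ (∀ z, 0 ≤ g z) ∧ (∀ z ∉ U, g z = 0) ∧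
      (∀ z, g z ≤ max (Real.log ‖f z‖ - b) 0) ∧ 0 < c ∧ 0 < r₁ ∧
      ∀ r ≥ r₁, c * r ≤ ∫ θ in 0..2 * Real.pi, g (r * Complex.exp (θ * Complex.I)) ^ 2 := by
  have hopen : IsOpen {w : ℂ | R < ‖f w‖} := isOpen_lt continuous_const hf.continuous.norm
  have hUsub : ∀ z ∈ U, R < ‖f z‖ := by
    obtain ⟨z₀, -, rfl⟩ := hU
    exact fun z hz => connectedComponentIn_subset {w : ℂ | R < ‖f w‖} _ hz
  obtain ⟨z₁, hz₁U, hz₁⟩ : ∃ z ∈ U, z ≠ 0 := by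
    obtain ⟨z₀, hz₀, rfl⟩ := hU
    exact (dense_compl_singleton (0 : ℂ)).inter_open_nonempty _ hopen.connectedComponentIn
      ⟨z₀, mem_connectedComponentIn hz₀⟩
  obtain ⟨ρ, hRρ, hρ⟩ := exists_between (hUsub z₁ hz₁U)
  have hρ0 : 0 < ρ := hR.trans hRρ
  obtain ⟨χ, χ₁, χ₂, hχ, hχ₁, hχ₂c, hχ₂, hχ0, hχpos, hχle⟩ := exists_convex_cutoff
  have hχc : Continuous χ := continuous_iff_continuousAt.2 fun x => (hχ x).continuousAt
  have hχ₁c : Continuous χ₁ := continuous_iff_continuousAt.2 fun x => (hχ₁ x).continuousAt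
  set b := Real.log ρ
  set h : ℂ → ℂ := fun w => f (Complex.exp w)
  have hh : Differentiable ℂ h := hf.comp Complex.differentiable_exp
  set Ω : Set ℂ := Complex.exp ⁻¹' U
  have hΩ0 : ∀ w ∈ Ω, h w ≠ 0 := fun w hw => norm_pos_iff.1 (hR.trans (hUsub _ hw))
  set Z : Set ℂ := {w | Real.log ‖h w‖ - b ≤ 0}
  have hUdich : ∀ z, U ∈ 𝓝 z ∨ ∀ᶠ z' in 𝓝 z, z' ∉ U ∨ z' ∈ {z | Real.log ‖f z‖ - b ≤ 0} := by
    intro z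
    refine (component_mem_nhds_or hf.continuous hRρ hU z).imp id (fun hev => ?_)
    filter_upwards [hev] with z' hz'
    by_cases hm : z' ∈ U
    · refine Or.inr (sub_nonpos.2 (Real.log_le_log (hR.trans (hUsub z' hm)) ?_))
      exact hz'.resolve_left (not_not.2 hm)
    · exact Or.inl hm
  have hΩ : ∀ w, Ω ∈ 𝓝 w ∨ ∀ᶠ w' in 𝓝 w, w' ∉ Ω ∨ w' ∈ Z := fun w =>
    (hUdich (Complex.exp w)).imp (fun hU => Complex.continuous_exp.continuousAt hU)
      (fun hev => Complex.continuous_exp.continuousAt.eventually hev)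
  set N : ℂ → ℝ := fun w => χ (Real.log ‖h w‖ - b)
  set N₁ : ℂ → ℂ → ℝ := fun v w => χ₁ (Real.log ‖h w‖ - b) * (logDeriv h w * v).re with hN₁
  set N₂ : ℂ → ℂ → ℝ := fun v w => χ₂ (Real.log ‖h w‖ - b) * (logDeriv h w * v).re ^ 2
    + χ₁ (Real.log ‖h w‖ - b) * (deriv (logDeriv h) w * v * v).re with hN₂
  have hZ : ∀ w ∈ Z, N w = 0 := fun w hw => (hχ0 _ hw).1
  have hZ₁ : ∀ v, ∀ w ∈ Z, N₁ v w = 0 := fun v w hw => by simp [hN₁, (hχ0 _ hw).2.1]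
  have hZ₂ : ∀ v, ∀ w ∈ Z, N₂ v w = 0 := fun v w hw => by
    simp [hN₂, (hχ0 _ hw).2.1, (hχ0 _ hw).2.2]
  have hFc : ∀ w ∈ Ω, ContinuousAt (fun w => Real.log ‖h w‖ - b) w := fun w hw =>
    (hh.continuous.norm.continuousAt.log (norm_ne_zero_iff.2 (hΩ0 w hw))).sub continuousAt_const
  have hLan : ∀ w ∈ Ω, AnalyticAt ℂ (logDeriv h) w := fun w hw =>
    (hh.analyticAt w).deriv.div (hh.analyticAt w) (hΩ0 w hw)
  have hNc : Continuous (Ω.indicator N) := continuous_indicator_of_zero hΩ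
    (fun w hw => hχc.continuousAt.comp (hFc w hw)) hZ
  have hN₁c : ∀ v, Continuous (Ω.indicator (N₁ v)) := fun v => continuous_indicator_of_zero hΩ
    (fun w hw => (hχ₁c.continuousAt.comp (hFc w hw)).mul
      (Complex.continuous_re.continuousAt.comp
        ((hLan w hw).continuousAt.mul continuousAt_const))) (hZ₁ v)
  have hN₂c : ∀ v, Continuous (Ω.indicator (N₂ v)) := fun v => continuous_indicator_of_zero hΩ
    (fun w hw => ((hχ₂c.continuousAt.comp (hFc w hw)).mul
      ((Complex.continuous_re.continuousAt.comp
        ((hLan w hw).continuousAt.mul continuousAt_const)).pow 2)).add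
      ((hχ₁c.continuousAt.comp (hFc w hw)).mul
      (Complex.continuous_re.continuousAt.comp
        (((hLan w hw).deriv.continuousAt.mul continuousAt_const).mul continuousAt_const)))) (hZ₂ v)
  have hd : ∀ {γ : ℝ → ℂ} {v : ℂ} {t : ℝ}, HasDerivAt γ v t →
      HasDerivAt (fun s => Ω.indicator N (γ s)) (Ω.indicator (N₁ v) (γ t)) t := fun {γ v t} hγ =>
    hasDerivAt_indicator_of_zero hΩ hγ.continuousAt
      (fun hm => (hasDerivAt_comp_log_norm hh hχ hχ₁ b hγ (hΩ0 _ hm)).1) hZ (hZ₁ v)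
  have hd₁ : ∀ {γ : ℝ → ℂ} {v : ℂ} {t : ℝ}, HasDerivAt γ v t →
      HasDerivAt (fun s => Ω.indicator (N₁ v) (γ s)) (Ω.indicator (N₂ v) (γ t)) t :=
    fun {γ v t} hγ => hasDerivAt_indicator_of_zero hΩ hγ.continuousAt
      (fun hm => (hasDerivAt_comp_log_norm hh hχ hχ₁ b hγ (hΩ0 _ hm)).2) (hZ₁ v) (hZ₂ v)
  have hγt : ∀ t s : ℝ, HasDerivAt (fun t : ℝ => (t + s * Complex.I : ℂ)) 1 t := fun t s =>
    (Complex.ofRealCLM.hasDerivAt (x := t)).add_const _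
  have hγs : ∀ t s : ℝ, HasDerivAt (fun s : ℝ => (t + s * Complex.I : ℂ)) Complex.I s :=
    fun t s => by
    simpa using ((Complex.ofRealCLM.hasDerivAt (x := s)).mul_const Complex.I).const_add (t : ℂ)
  have hcoord : Continuous fun p : ℝ × ℝ => (p.1 + p.2 * Complex.I : ℂ) := by fun_prop
  set g : ℂ → ℝ := U.indicator fun z => χ (Real.log ‖f z‖ - b) with hg
  have hgN : ∀ w, Ω.indicator N w = g (Complex.exp w) := fun w => rfl
  have hg0 : ∀ z, 0 ≤ g z := fun z => Set.indicator_nonneg (fun z _ => (hχle _).1) z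
  have hgle : ∀ z, g z ≤ max (Real.log ‖f z‖ - b) 0 := fun z =>
    Set.indicator_le' (fun z _ => (hχle _).2) (fun z _ => le_max_right _ _) z
  obtain ⟨T, hT⟩ := eventually_atTop.1 hcirc
  obtain ⟨B, hB⟩ := (isCompact_closedBall (0 : ℂ) 1).exists_bound_of_continuousOn
    hf.continuous.continuousOn
  have hexp : ∀ t s : ℝ, Complex.exp (t + s * Complex.I) =
      (Real.exp t : ℂ) * Complex.exp (s * Complex.I) := fun t s => by
    rw [Complex.exp_add, Complex.ofReal_exp]
  have hgrow : ∃ c t₁ : ℝ, 0 < c ∧ ∀ t ≥ t₁, c * Real.exp t ≤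
      ∫ s in 0..2 * Real.pi, Ω.indicator N (t + s * Complex.I) ^ 2 := by
    refine exists_mul_exp_le_integral_sq
      (g := fun t s => Ω.indicator N (t + s * Complex.I))
      (gt := fun t s => Ω.indicator (N₁ 1) (t + s * Complex.I))
      (gs := fun t s => Ω.indicator (N₁ Complex.I) (t + s * Complex.I))
      (gtt := fun t s => Ω.indicator (N₂ 1) (t + s * Complex.I))
      (gss := fun t s => Ω.indicator (N₂ Complex.I) (t + s * Complex.I))
      (C := max (B - b) 0) (T := T) (t₀ := Real.log ‖z₁‖) (s₀ := Complex.arg z₁)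
      (hNc.comp hcoord) ((hN₁c 1).comp hcoord) ((hN₁c Complex.I).comp hcoord)
      ((hN₂c 1).comp hcoord) ((hN₂c Complex.I).comp hcoord)
      (fun t s => hd (hγt t s)) (fun t s => hd (hγs t s))
      (fun t s => hd₁ (hγt t s)) (fun t s => hd₁ (hγs t s))
      (fun t s => hg0 _) (fun t s => ?_) (fun t s => ?_) (fun t ht s => ?_) (fun t ht => ?_) ?_
    · by_cases hm : (t + s * Complex.I : ℂ) ∈ Ω
      · simp only [Set.indicator_of_mem hm, hN₂, mul_assoc, Complex.I_mul_I, mul_one, mul_neg,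
          Complex.neg_re]
        have := hχ₂ (Real.log ‖h (t + s * Complex.I)‖ - b)
        nlinarith [mul_nonneg this (sq_nonneg (logDeriv h (t + s * Complex.I)).re),
          mul_nonneg this (sq_nonneg (logDeriv h (t + s * Complex.I) * Complex.I).re)]
      · simp [Set.indicator_of_notMem hm]
    · simp only [hgN]
      congr 1
      rw [← Complex.exp_periodic (t + s * Complex.I)]
      congr 1
      push_cast
      ring
    · rw [hgN]
      refine (hgle _).trans (max_le_max_right _ (sub_le_sub_right ?_ _))
      refine (Real.log_le_self (norm_nonneg _)).trans (hB _ ?_)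
      simpa [Complex.norm_exp] using ht
    · obtain ⟨z, hz, hzU⟩ := Set.not_subset.1 (hT (Real.exp t)
        (ht.le.trans (by linarith [Real.add_one_le_exp t])))
      rw [mem_sphere_zero_iff_norm] at hz
      refine ⟨Complex.arg z, ?_⟩
      rw [hgN, hexp, ← hz, Complex.norm_mul_exp_arg_mul_I]
      exact Set.indicator_of_notMem hzU _
    · rw [hgN, hexp, Real.exp_log (norm_pos_iff.2 hz₁), Complex.norm_mul_exp_arg_mul_I, hg,
        Set.indicator_of_mem hz₁U]
      exact hχpos _ (sub_pos.2 (Real.log_lt_log hρ0 hρ))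
  obtain ⟨c, t₁, hc, hmain⟩ := hgrow
  refine ⟨g, b, c, Real.exp t₁, continuous_indicator_of_zero hUdich
    (fun z hz => hχc.continuousAt.comp ?_) (fun z hz => (hχ0 _ hz).1), hg0,
    fun z hz => Set.indicator_of_notMem hz _, hgle, hc, Real.exp_pos _, fun r hr => ?_⟩
  · exact (hf.continuous.norm.continuousAt.log (hR.trans (hUsub z hz)).ne').sub
      continuousAt_const
  · have hr0 : 0 < r := (Real.exp_pos _).trans_le hr
    have := hmain (Real.log r) ((Real.le_log_iff_exp_le hr0).2 hr)
    simpa only [hgN, hexp, Real.exp_log hr0] using this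

theorem mAux_lower_bound
    (f : ℂ → ℂ) (hf : Differentiable ℂ f) (R : ℝ) (hR : 0 < R)
    (U : Set ℂ) (hU : U ∈ componentsAR f R)
    (hcirc : ∀ᶠ r in atTop, ¬ Metric.sphere (0 : ℂ) r ⊆ U)
    (β : ℝ) (hβ0 : 0 < β) (hβ : β < 1 / 2)
    (V : Set ℂ) (hV : V = {z ∈ U | 0 ≤ vAux f β z}) :
    ∃ c r₀ : ℝ, 0 < c ∧ 0 < r₀ ∧ ∀ r, r₀ ≤ r → c * r ≤ mAux f β V r := by
  obtain ⟨g, b, c, r₁, hgc, hg0, hgU, hgle, hc, hr₁, hgrow⟩ :=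
    exists_minorant_with_growth hf hR hU hcirc
  have hpi := Real.two_pi_pos
  have hVm : MeasurableSet V := by
    have hopen : IsOpen {w : ℂ | R < ‖f w‖} := isOpen_lt continuous_const hf.continuous.norm
    have hUm : MeasurableSet U := by
      obtain ⟨z₀, -, rfl⟩ := hU
      exact hopen.connectedComponentIn.measurableSet
    have hvm : Measurable (vAux f β) :=
      (Real.measurable_log.comp hf.continuous.norm.measurable).sub
        (measurable_norm.pow_const β)
    rw [hV]
    exact hUm.inter (measurableSet_le measurable_const hvm)
  have hlim : Tendsto (fun r : ℝ => (r ^ β + |b|) ^ 2 / r) atTop (𝓝 0) := by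
    have h1 : Tendsto (fun r : ℝ => r ^ (-(1 / 2 - β)) + |b| * r ^ (-(1 / 2 : ℝ))) atTop (𝓝 0) := by
      simpa using (tendsto_rpow_neg_atTop (show 0 < 1 / 2 - β by linarith)).add
        ((tendsto_rpow_neg_atTop (show (0 : ℝ) < 1 / 2 by norm_num)).const_mul |b|)
    have h2 := h1.pow 2
    simp only [ne_eq, OfNat.ofNat_ne_zero, not_false_eq_true, zero_pow] at h2
    refine h2.congr' ?_
    filter_upwards [eventually_gt_atTop 0] with r hr
    have h3 : r ^ (-(1 / 2 - β)) = r ^ β * r ^ (-(1 / 2 : ℝ)) := by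
      rw [← Real.rpow_add hr]; congr 1; ring
    have h4 : (r ^ (-(1 / 2 : ℝ))) ^ 2 = r⁻¹ := by
      rw [← Real.rpow_natCast, ← Real.rpow_mul hr.le, ← Real.rpow_neg_one]; norm_num
    rw [h3, ← add_mul, mul_pow, h4, div_eq_mul_inv]
  obtain ⟨r₂, hr₂⟩ := eventually_atTop.1
    (hlim.eventually (gt_mem_nhds (show 0 < c / (8 * Real.pi) by positivity)))
  refine ⟨1 / (2 * Real.pi) * (c / 4), max r₁ r₂, by positivity, lt_max_of_lt_left hr₁,
    fun r hr => ?_⟩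
  have hr0 : 0 < r := hr₁.trans_le ((le_max_left _ _).trans hr)
  have hG := hgrow r ((le_max_left _ _).trans hr)
  have hD := hr₂ r ((le_max_right _ _).trans hr)
  rw [div_lt_iff₀ hr0] at hD
  rw [mAux, mul_assoc]
  refine mul_le_mul_of_nonneg_left ?_ (by positivity)
  set ζ : ℝ → ℂ := fun θ => (r : ℂ) * Complex.exp (θ * Complex.I) with hζ
  have hζc : Continuous ζ := by fun_prop
  have hζn : ∀ θ, ‖ζ θ‖ = r := fun θ => by
    simp [hζ, Complex.norm_exp_ofReal_mul_I, abs_of_pos hr0]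
  set D := r ^ β + |b| with hDdef
  have hD0 : 0 ≤ D := by positivity
  set E : Set ℝ := {θ : ℝ | θ ∈ Set.Icc 0 (2 * Real.pi) ∧ ζ θ ∈ V}
  have hEm : MeasurableSet E := measurableSet_Icc.inter (hζc.measurable hVm)
  have hvm : Measurable fun θ => vAux f β (ζ θ) :=
    ((Real.measurable_log.comp hf.continuous.norm.measurable).sub
        (measurable_norm.pow_const β)).comp hζc.measurable
  obtain ⟨B, hB⟩ := (isCompact_closedBall (0 : ℂ) r).exists_bound_of_continuousOn
    hf.continuous.continuousOn
  have hEfin : volume E < ⊤ :=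
    (measure_mono (fun θ hθ => hθ.1)).trans_lt (measure_Icc_lt_top (a := 0) (b := 2 * Real.pi))
  have hint : IntegrableOn (fun θ => vAux f β (ζ θ) ^ 2) E := by
    refine Measure.integrableOn_of_bounded (M := B ^ 2) hEfin.ne
      (hvm.pow_const 2).aestronglyMeasurable ?_
    refine (ae_restrict_iff' hEm).2 (Eventually.of_forall fun θ hθ => ?_)
    have h0 : 0 ≤ vAux f β (ζ θ) := by
      have := hθ.2
      rw [hV] at this
      exact this.2
    rw [Real.norm_of_nonneg (by positivity)]
    refine pow_le_pow_left₀ h0 ?_ 2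
    have h1 : Real.log ‖f (ζ θ)‖ ≤ B :=
      (Real.log_le_self (norm_nonneg _)).trans (hB _ (by simp [hζn]))
    have h2 : 0 ≤ ‖ζ θ‖ ^ β := by positivity
    rw [vAux]
    linarith
  have hpt : ∀ θ ∈ Set.Icc 0 (2 * Real.pi), g (ζ θ) ^ 2 ≤
      2 * E.indicator (fun θ => vAux f β (ζ θ) ^ 2) θ + 2 * D ^ 2 := by
    intro θ hθ
    have hgv : g (ζ θ) ≤ max (vAux f β (ζ θ) + D) 0 := by
      refine (hgle _).trans (max_le_max_right _ ?_)
      rw [vAux, hζn, hDdef]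
      linarith [neg_abs_le b]
    by_cases hθE : θ ∈ E
    · rw [Set.indicator_of_mem hθE]
      have h0 : 0 ≤ vAux f β (ζ θ) := by
        have := hθE.2
        rw [hV] at this
        exact this.2
      rw [max_eq_left (by positivity)] at hgv
      have := pow_le_pow_left₀ (hg0 _) hgv 2
      nlinarith [sq_nonneg (vAux f β (ζ θ) - D)]
    · rw [Set.indicator_of_notMem hθE]
      have hgD : g (ζ θ) ≤ D := by
        by_cases hU' : ζ θ ∈ U
        · have hneg : vAux f β (ζ θ) < 0 := by
            by_contra! h0
            exact hθE ⟨hθ, by rw [hV]; exact ⟨hU', h0⟩⟩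
          exact hgv.trans (max_le (by linarith) hD0)
        · rw [hgU _ hU']
          exact hD0
      nlinarith [pow_le_pow_left₀ (hg0 _) hgD 2]
  have hIcc : E ∩ Set.Icc 0 (2 * Real.pi) = E := Set.inter_eq_left.2 fun θ hθ => hθ.1
  have hindint : IntegrableOn (E.indicator fun θ => vAux f β (ζ θ) ^ 2)
      (Set.Icc 0 (2 * Real.pi)) := (hint.integrable_indicator hEm).integrableOn
  have hle : ∫ θ in Set.Icc 0 (2 * Real.pi), g (ζ θ) ^ 2 ≤
      ∫ θ in Set.Icc 0 (2 * Real.pi),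
        (2 * E.indicator (fun θ => vAux f β (ζ θ) ^ 2) θ + 2 * D ^ 2) := by
    refine setIntegral_mono_on ?_ ?_ measurableSet_Icc hpt
    · exact ((hgc.comp hζc).pow 2).continuousOn.integrableOn_Icc
    · exact (hindint.const_mul 2).add (integrableOn_const measure_Icc_lt_top.ne)
  rw [integral_add (hindint.const_mul 2) (integrableOn_const measure_Icc_lt_top.ne),
    integral_const_mul, setIntegral_indicator hEm, Set.inter_comm, hIcc, setIntegral_const] at hle
  rw [intervalIntegral.integral_of_le hpi.le, ← integral_Icc_eq_integral_Ioc] at hG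
  simp only [Real.volume_real_Icc, sub_zero, max_eq_left hpi.le, smul_eq_mul] at hle
  have hD' : 2 * Real.pi * (2 * D ^ 2) ≤ c * r / 2 := by
    have := mul_le_mul_of_nonneg_left hD.le (show 0 ≤ 4 * Real.pi by positivity)
    have h8 : 4 * Real.pi * (c / (8 * Real.pi) * r) = c * r / 2 := by
      field_simp
      ring
    linarith
  linarith
end

section
/- Let f be an entire function, R > 0, and let U be a connected component of A_R = {z ∈ ℂ : |f(z)| > R} such that for all sufficiently large r the circle {z : |z| = r} is not contained in U. Let 0 < β < 1/2, put v(z) = log|f(z)| − |z|^β, V = {z ∈ U : v(z) ≥ 0}, V_r = {θ ∈ [0,2π] : r e^{iθ} ∈ V}, and m(r) = (1/(2π)) ∫_{V_r} v(r e^{iθ})^2 dθ. Then there exists r_0 > 0 such that m is a convex function of log r for r ≥ r_0, i.e. the function t ↦ m(e^t) is convex on [log r_0, ∞). -/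
open MeasureTheory Filter Topology

/-- The right derivative of the positive part of a function with value `s` and derivative `d`. -/
noncomputable def posPartSlope (s d : ℝ) : ℝ :=
  if 0 < s then d else if s = 0 then max d 0 else 0

lemma posPartSlope_mul_self (s d : ℝ) : posPartSlope s d * d = posPartSlope s d ^ 2 := by
  unfold posPartSlope
  split_ifs
  · ring
  · rcases le_total d 0 with h | h <;> simp [h, sq]
  · simp

lemma max_mul_posPartSlope (s d : ℝ) : max s 0 * posPartSlope s d = max s 0 * d := by
  unfold posPartSlope
  split_ifs with h h'
  · rfl
  · simp [h']
  · simp [not_lt.1 h]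

lemma abs_posPartSlope_le (s d : ℝ) : |posPartSlope s d| ≤ |d| := by
  unfold posPartSlope
  split_ifs
  · rfl
  · rcases le_total d 0 with h | h <;> simp [h]
  · simp

lemma Measurable.posPartSlope {α : Type*} [MeasurableSpace α] {s d : α → ℝ}
    (hs : Measurable s) (hd : Measurable d) : Measurable fun x => posPartSlope (s x) (d x) :=
  Measurable.ite (measurableSet_lt measurable_const hs) hd
    (Measurable.ite (measurableSet_eq_fun hs measurable_const) (hd.max measurable_const)
      measurable_const)

lemma HasDerivAt.posPart_right {w : ℝ → ℝ} {d x : ℝ} (hw : HasDerivAt w d x) :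
    HasDerivWithinAt (fun y => max (w y) 0) (posPartSlope (w x) d) (Set.Ioi x) x := by
  unfold posPartSlope
  split_ifs with h h'
  · refine hw.hasDerivWithinAt.congr_of_eventuallyEq ?_ (max_eq_left h.le)
    filter_upwards [nhdsWithin_le_nhds (hw.continuousAt.eventually (lt_mem_nhds h))] with y hy
    exact max_eq_left hy.le
  · rw [hasDerivWithinAt_iff_tendsto_slope' Set.self_notMem_Ioi]
    have := (hasDerivWithinAt_iff_tendsto_slope' Set.self_notMem_Ioi).1
      (hw.hasDerivWithinAt (s := Set.Ioi x))
    refine (this.max (tendsto_const_nhds (x := (0 : ℝ)))).congr' ?_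
    filter_upwards [self_mem_nhdsWithin] with y hy
    have hy' : 0 < y - x := sub_pos.2 hy
    simp only [slope_def_field, h', sub_zero, max_self]
    rw [max_div_div_right hy'.le (w y) 0 |>.symm, zero_div]
  · have h0 : w x < 0 := lt_of_le_of_ne (not_lt.1 h) h'
    refine (hasDerivWithinAt_const x _ (0 : ℝ)).congr_of_eventuallyEq ?_ (max_eq_right h0.le)
    filter_upwards [nhdsWithin_le_nhds (hw.continuousAt.eventually (gt_mem_nhds h0))] with y hy
    exact max_eq_right hy.le

/-- Wirtinger's inequality for functions vanishing at both ends of an interval, in terms of right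
derivatives. -/
lemma mul_integral_sq_le_integral_sq_of_right_deriv {q D : ℝ → ℝ} {α L k B : ℝ} (hL : 0 ≤ L)
    (hk : 0 ≤ k) (hkL : k * L < Real.pi) (hq : ContinuousOn q (Set.Icc α (α + L)))
    (hD : ∀ x ∈ Set.Ioo α (α + L), HasDerivWithinAt q (D x) (Set.Ioi x) x)
    (hDm : Measurable D) (hDB : ∀ x ∈ Set.Icc α (α + L), |D x| ≤ B)
    (h0 : q α = 0) (h1 : q (α + L) = 0) :
    k ^ 2 * ∫ x in α..(α + L), q x ^ 2 ≤ ∫ x in α..(α + L), D x ^ 2 := by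
  have hle : α ≤ α + L := by linarith
  have hIoc : Set.uIoc α (α + L) ⊆ Set.Icc α (α + L) := by
    rw [Set.uIoc_of_le hle]; exact Set.Ioc_subset_Icc_self
  set m : ℝ := α + L / 2 with hm
  have hcos : ∀ x ∈ Set.Icc α (α + L), Real.cos (k * (x - m)) ≠ 0 := by
    intro x hx
    refine (Real.cos_pos_of_mem_Ioo ⟨?_, ?_⟩).ne'
    · nlinarith [hx.1, hx.2]
    · nlinarith [hx.1, hx.2]
  have htan : ∀ x ∈ Set.Icc α (α + L),
      HasDerivAt (fun y => k * Real.tan (k * (y - m)))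
        (k ^ 2 * (1 + Real.tan (k * (x - m)) ^ 2)) x := by
    intro x hx
    have := ((Real.hasDerivAt_tan (hcos x hx)).comp x
      (((hasDerivAt_id x).sub_const m).const_mul k)).const_mul k
    refine this.congr_deriv ?_
    rw [Real.tan_eq_sin_div_cos]
    have h := hcos x hx
    field_simp
    rw [Real.cos_sq_add_sin_sq, mul_one]
  have htanc : ContinuousOn (fun y => k * Real.tan (k * (y - m))) (Set.Icc α (α + L)) :=
    fun x hx => (htan x hx).continuousAt.continuousWithinAt
  have hDi : IntervalIntegrable (fun x => D x ^ 2) volume α (α + L) := by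
    refine (intervalIntegrable_const (c := B ^ 2)).mono_fun
      (hDm.pow_const 2).aestronglyMeasurable ?_
    filter_upwards [ae_restrict_mem measurableSet_uIoc] with x hx
    have := hDB x (hIoc hx)
    rw [Real.norm_eq_abs, Real.norm_eq_abs, abs_pow, abs_of_nonneg (sq_nonneg B)]
    gcongr
  have hD1 : IntervalIntegrable D volume α (α + L) := by
    refine (intervalIntegrable_const (c := B)).mono_fun hDm.aestronglyMeasurable ?_
    filter_upwards [ae_restrict_mem measurableSet_uIoc] with x hx
    exact (hDB x (hIoc hx)).trans (le_abs_self B)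
  have hqi : IntervalIntegrable (fun x => q x ^ 2) volume α (α + L) :=
    ((hq.pow 2).mono (by rw [Set.uIcc_of_le hle])).intervalIntegrable
  let E' : ℝ → ℝ := fun x => k ^ 2 * (1 + Real.tan (k * (x - m)) ^ 2) * q x ^ 2 +
    D x * (2 * (k * Real.tan (k * (x - m))) * q x)
  have hE'i : IntervalIntegrable E' volume α (α + L) := by
    refine IntervalIntegrable.add ?_ ?_
    · refine ContinuousOn.intervalIntegrable ?_
      rw [Set.uIcc_of_le hle]
      have : ContinuousOn (fun x => (k ^ 2 + (k * Real.tan (k * (x - m))) ^ 2) * q x ^ 2)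
          (Set.Icc α (α + L)) := (continuousOn_const.add (htanc.pow 2)).mul (hq.pow 2)
      refine this.congr fun x _ => ?_
      simp only
      ring
    · refine hD1.mul_continuousOn ?_
      rw [Set.uIcc_of_le hle]
      exact (continuousOn_const.mul htanc).mul hq
  have hFTC : ∫ x in α..(α + L), E' x = 0 := by
    have := intervalIntegral.integral_eq_sub_of_hasDeriv_right_of_le hle
      (f := fun x => k * Real.tan (k * (x - m)) * q x ^ 2) (f' := E')
      (htanc.mul (hq.pow 2)) (fun x hx => by
        have := ((htan x (Set.Ioo_subset_Icc_self hx)).hasDerivWithinAt (s := Set.Ioi x)).mul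
          ((hD x hx).pow 2)
        refine this.congr_deriv ?_
        simp only [E', Pi.pow_apply]
        push_cast
        ring) hE'i
    rw [this, h0, h1]
    ring
  have hpos : 0 ≤ ∫ x in α..(α + L), (D x ^ 2 - k ^ 2 * q x ^ 2 + E' x) := by
    refine intervalIntegral.integral_nonneg hle fun x _ => ?_
    have : D x ^ 2 - k ^ 2 * q x ^ 2 + E' x = (D x + k * Real.tan (k * (x - m)) * q x) ^ 2 := by
      simp only [E']; ring
    rw [this]
    positivity
  rw [intervalIntegral.integral_add (hDi.sub (hqi.const_mul _)) hE'i,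
    intervalIntegral.integral_sub hDi (hqi.const_mul _), hFTC,
    intervalIntegral.integral_const_mul] at hpos
  linarith

/-- Integrating right derivatives in the first variable and exchanging the integrals. -/
lemma integral_integral_right_deriv {H G : ℝ × ℝ → ℝ} {s t c d B : ℝ} (hst : s ≤ t) (hcd : c ≤ d)
    (hG : Measurable G) (hGB : ∀ p ∈ Set.Icc s t ×ˢ Set.Icc c d, |G p| ≤ B)
    (hH : ContinuousOn H (Set.Icc s t ×ˢ Set.Icc c d))
    (hderiv : ∀ x ∈ Set.Icc s t, ∀ y ∈ Set.Icc c d,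
      HasDerivWithinAt (fun x' => H (x', y)) (G (x, y)) (Set.Ioi x) x) :
    IntervalIntegrable (fun x => ∫ y in c..d, G (x, y)) volume s t ∧
    ∫ x in s..t, ∫ y in c..d, G (x, y) =
      (∫ y in c..d, H (t, y)) - ∫ y in c..d, H (s, y) := by
  have hGint : Integrable G ((volume.restrict (Set.Ioc s t)).prod (volume.restrict (Set.Ioc c d))) := by
    rw [Measure.prod_restrict]
    refine Integrable.mono' (g := fun _ => B) (integrableOn_const (by
      rw [Measure.prod_prod]; simp [ENNReal.mul_eq_top])) hG.aestronglyMeasurable ?_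
    filter_upwards [ae_restrict_mem (measurableSet_Ioc.prod measurableSet_Ioc)] with p hp
    exact hGB p ⟨Set.Ioc_subset_Icc_self hp.1, Set.Ioc_subset_Icc_self hp.2⟩
  have hslice : ∀ y ∈ Set.Icc c d, ∫ x in s..t, G (x, y) = H (t, y) - H (s, y) := by
    intro y hy
    refine intervalIntegral.integral_eq_sub_of_hasDeriv_right_of_le hst
      (f := fun x => H (x, y)) (hH.comp (by fun_prop) fun x hx => ⟨hx, hy⟩)
      (fun x hx => hderiv x (Set.Ioo_subset_Icc_self hx) y hy) ?_
    refine (intervalIntegrable_const (c := B)).mono_fun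
      (hG.comp measurable_prodMk_right).aestronglyMeasurable ?_
    filter_upwards [ae_restrict_mem measurableSet_uIoc] with x hx
    rw [Set.uIoc_of_le hst] at hx
    exact (hGB (x, y) ⟨Set.Ioc_subset_Icc_self hx, hy⟩).trans (le_abs_self B)
  have hHi : ∀ x ∈ Set.Icc s t, IntervalIntegrable (fun y => H (x, y)) volume c d := by
    intro x hx
    refine ContinuousOn.intervalIntegrable ?_
    rw [Set.uIcc_of_le hcd]
    exact hH.comp (by fun_prop) fun y hy => ⟨hx, hy⟩
  constructor
  · rw [intervalIntegrable_iff_integrableOn_Ioc_of_le hst]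
    simp only [intervalIntegral.integral_of_le hcd]
    exact hGint.integral_prod_left
  · rw [← intervalIntegral.integral_sub (hHi t ⟨hst, le_rfl⟩) (hHi s ⟨le_rfl, hst⟩)]
    rw [← intervalIntegral.integral_congr (fun y hy => hslice y (by
      rwa [Set.uIcc_of_le hcd] at hy))]
    simp only [intervalIntegral.integral_of_le hcd, intervalIntegral.integral_of_le hst]
    exact integral_integral_swap (f := fun x y => G (x, y)) hGint

/-- A function `l` on the plane, `2π`-periodic in the second variable and harmonic on the open set
`Ω`, together with its derivatives, and bounded by `c` on the boundary of `Ω`. -/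
structure HarmonicStrip (Ω : Set (ℝ × ℝ)) (l lx ly lxx : ℝ × ℝ → ℝ) (c : ℝ) : Prop where
  isOpen : IsOpen Ω
  cont : Continuous l
  cont_x : Continuous lx
  cont_y : Continuous ly
  cont_xx : Continuous lxx
  deriv_x : ∀ p ∈ Ω, HasDerivAt (fun x => l (x, p.2)) (lx p) p.1
  deriv_y : ∀ p ∈ Ω, HasDerivAt (fun y => l (p.1, y)) (ly p) p.2
  deriv_xx : ∀ p ∈ Ω, HasDerivAt (fun x => lx (x, p.2)) (lxx p) p.1
  deriv_yy : ∀ p ∈ Ω, HasDerivAt (fun y => ly (p.1, y)) (-lxx p) p.2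
  boundary : ∀ p ∈ closure Ω, p ∉ Ω → l p ≤ c
  periodic_mem : ∀ x y, (x, y + 2 * Real.pi) ∈ Ω ↔ (x, y) ∈ Ω
  periodic : ∀ x y, l (x, y + 2 * Real.pi) = l (x, y)
  periodic_y : ∀ x y, ly (x, y + 2 * Real.pi) = ly (x, y)

/-- The positive part of `l - a` on `Ω`, extended by zero. -/
noncomputable def excess (Ω : Set (ℝ × ℝ)) (l : ℝ × ℝ → ℝ) (a : ℝ → ℝ) : ℝ × ℝ → ℝ :=
  Ω.indicator fun p => max (l p - a p.1) 0

/-- The right derivative of `excess Ω l a` in a direction in which `l - a` has derivative `d`. -/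
noncomputable def excessSlope (Ω : Set (ℝ × ℝ)) (l : ℝ × ℝ → ℝ) (a : ℝ → ℝ) (d : ℝ × ℝ → ℝ) :
    ℝ × ℝ → ℝ :=
  Ω.indicator fun p => posPartSlope (l p - a p.1) (d p)

section excess

variable {Ω : Set (ℝ × ℝ)} {l : ℝ × ℝ → ℝ} {a : ℝ → ℝ} {d : ℝ × ℝ → ℝ}

lemma excess_nonneg (p : ℝ × ℝ) : 0 ≤ excess Ω l a p :=
  Set.indicator_nonneg (fun _ _ => le_max_right _ _) p

lemma abs_excess_le (p : ℝ × ℝ) : |excess Ω l a p| ≤ |l p - a p.1| := by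
  by_cases h : p ∈ Ω
  · rw [abs_of_nonneg (excess_nonneg p), excess, Set.indicator_of_mem h]
    exact max_le (le_abs_self _) (abs_nonneg _)
  · rw [excess, Set.indicator_of_notMem h]; simp

lemma excessSlope_mul (p : ℝ × ℝ) :
    excessSlope Ω l a d p * d p = excessSlope Ω l a d p ^ 2 := by
  by_cases h : p ∈ Ω
  · simp only [excessSlope, Set.indicator_of_mem h]
    exact posPartSlope_mul_self _ _
  · simp [excessSlope, Set.indicator_of_notMem h]

lemma excess_mul_excessSlope (p : ℝ × ℝ) :
    excess Ω l a p * excessSlope Ω l a d p = excess Ω l a p * d p := by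
  by_cases h : p ∈ Ω
  · simp only [excess, excessSlope, Set.indicator_of_mem h]
    exact max_mul_posPartSlope _ _
  · simp [excess, Set.indicator_of_notMem h]

lemma abs_excessSlope_le (p : ℝ × ℝ) : |excessSlope Ω l a d p| ≤ |d p| := by
  by_cases h : p ∈ Ω
  · simp only [excessSlope, Set.indicator_of_mem h]
    exact abs_posPartSlope_le _ _
  · simp [excessSlope, Set.indicator_of_notMem h]

lemma measurable_excess (hΩ : IsOpen Ω) (hl : Continuous l) (ha : Continuous a) :
    Measurable (excess Ω l a) :=
  Measurable.indicator (by fun_prop) hΩ.measurableSet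

lemma measurable_excessSlope (hΩ : IsOpen Ω) (hl : Continuous l) (ha : Continuous a)
    (hd : Continuous d) : Measurable (excessSlope Ω l a d) :=
  Measurable.indicator (Measurable.posPartSlope (by fun_prop) (by fun_prop)) hΩ.measurableSet

end excess

namespace HarmonicStrip

variable {Ω : Set (ℝ × ℝ)} {l lx ly lxx : ℝ × ℝ → ℝ} {c : ℝ} {a a' a'' : ℝ → ℝ}

lemma excess_eventually_eq_zero (h : HarmonicStrip Ω l lx ly lxx c) (ha : Continuous a)
    {p : ℝ × ℝ} (hp : p ∉ Ω) (hc : c < a p.1) : ∀ᶠ p' in 𝓝 p, excess Ω l a p' = 0 := by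
  by_cases hcl : p ∈ closure Ω
  · have hlt : l p < a p.1 := (h.boundary p hcl hp).trans_lt hc
    have : ∀ᶠ p' in 𝓝 p, l p' < a p'.1 :=
      h.cont.continuousAt.eventually_lt (by fun_prop) hlt
    filter_upwards [this] with p' hp'
    have hmax : max (l p' - a p'.1) 0 = 0 := max_eq_right (by linarith)
    by_cases hm : p' ∈ Ω
    · rw [excess, Set.indicator_of_mem hm, hmax]
    · rw [excess, Set.indicator_of_notMem hm]
  · filter_upwards [isClosed_closure.isOpen_compl.mem_nhds hcl] with p' hp'
    exact Set.indicator_of_notMem (fun hm => hp' (subset_closure hm)) _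

lemma continuousAt_excess (h : HarmonicStrip Ω l lx ly lxx c) (ha : Continuous a)
    {p : ℝ × ℝ} (hc : c < a p.1) : ContinuousAt (excess Ω l a) p := by
  by_cases hp : p ∈ Ω
  · have hcont : ContinuousAt (fun p : ℝ × ℝ => max (l p - a p.1) 0) p := by
      have := h.cont
      fun_prop
    refine hcont.congr ?_
    filter_upwards [h.isOpen.mem_nhds hp] with p' hp'
    rw [excess, Set.indicator_of_mem hp']
  · refine continuousAt_const.congr (f := fun _ => (0 : ℝ)) ?_
    filter_upwards [h.excess_eventually_eq_zero ha hp hc] with p' hp'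
    exact hp'.symm

lemma excess_right_deriv (h : HarmonicStrip Ω l lx ly lxx c) (ha : Continuous a)
    {γ : ℝ → ℝ × ℝ} (hγ : Continuous γ) {s : ℝ} (hc : c < a (γ s).1) {d : ℝ × ℝ → ℝ}
    (hd : γ s ∈ Ω → HasDerivAt (fun s => l (γ s) - a (γ s).1) (d (γ s)) s) :
    HasDerivWithinAt (fun s => excess Ω l a (γ s)) (excessSlope Ω l a d (γ s)) (Set.Ioi s) s := by
  by_cases hp : γ s ∈ Ω
  · rw [excessSlope, Set.indicator_of_mem hp]
    refine (hd hp).posPart_right.congr_of_eventuallyEq ?_ (by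
      rw [excess, Set.indicator_of_mem hp])
    filter_upwards [nhdsWithin_le_nhds (hγ.continuousAt.eventually (h.isOpen.mem_nhds hp))]
      with s' hs'
    rw [excess, Set.indicator_of_mem hs']
  · rw [excessSlope, Set.indicator_of_notMem hp]
    refine (hasDerivWithinAt_const s _ (0 : ℝ)).congr_of_eventuallyEq ?_ (by
      rw [excess, Set.indicator_of_notMem hp])
    exact nhdsWithin_le_nhds
      (hγ.continuousAt.eventually (h.excess_eventually_eq_zero ha hp hc))

lemma excess_mul_right_deriv (h : HarmonicStrip Ω l lx ly lxx c) (ha : Continuous a)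
    {γ : ℝ → ℝ × ℝ} (hγ : Continuous γ) {s : ℝ} (hc : c < a (γ s).1) {d e : ℝ × ℝ → ℝ}
    (hd : γ s ∈ Ω → HasDerivAt (fun s => l (γ s) - a (γ s).1) (d (γ s)) s)
    (he : γ s ∈ Ω → HasDerivAt (fun s => d (γ s)) (e (γ s)) s) :
    HasDerivWithinAt (fun s => excess Ω l a (γ s) * d (γ s))
      (excessSlope Ω l a d (γ s) ^ 2 + excess Ω l a (γ s) * e (γ s)) (Set.Ioi s) s := by
  rw [← excessSlope_mul]
  by_cases hp : γ s ∈ Ω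
  · exact (h.excess_right_deriv ha hγ hc hd).mul (he hp).hasDerivWithinAt
  · rw [excessSlope, excess, Set.indicator_of_notMem hp, Set.indicator_of_notMem hp]
    refine ((hasDerivWithinAt_const s _ (0 : ℝ)).congr_deriv (by ring)).congr_of_eventuallyEq ?_
      (by rw [Set.indicator_of_notMem hp, zero_mul])
    filter_upwards [nhdsWithin_le_nhds
      (hγ.continuousAt.eventually (h.excess_eventually_eq_zero ha hp hc))] with s' hs'
    change excess Ω l a (γ s') * d (γ s') = 0
    rw [hs', zero_mul]

lemma deriv_sub_x (h : HarmonicStrip Ω l lx ly lxx c) (ha' : ∀ t, HasDerivAt a (a' t) t)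
    {p : ℝ × ℝ} (hp : p ∈ Ω) :
    HasDerivAt (fun x => l (x, p.2) - a x) (lx p - a' p.1) p.1 :=
  (h.deriv_x p hp).sub (ha' p.1)

lemma deriv_sub_xx (h : HarmonicStrip Ω l lx ly lxx c) (ha'' : ∀ t, HasDerivAt a' (a'' t) t)
    {p : ℝ × ℝ} (hp : p ∈ Ω) :
    HasDerivAt (fun x => lx (x, p.2) - a' x) (lxx p - a'' p.1) p.1 :=
  (h.deriv_xx p hp).sub (ha'' p.1)

lemma deriv_sub_y (h : HarmonicStrip Ω l lx ly lxx c) {p : ℝ × ℝ} (hp : p ∈ Ω) :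
    HasDerivAt (fun y => l (p.1, y) - a p.1) (ly p) p.2 :=
  (h.deriv_y p hp).sub_const _

lemma excess_periodic (h : HarmonicStrip Ω l lx ly lxx c) (x : ℝ) :
    Function.Periodic (fun y => excess Ω l a (x, y)) (2 * Real.pi) := by
  intro y
  by_cases hp : (x, y) ∈ Ω
  · simp only [excess]
    rw [Set.indicator_of_mem hp, Set.indicator_of_mem ((h.periodic_mem x y).2 hp), h.periodic]
  · simp only [excess]
    rw [Set.indicator_of_notMem hp,
      Set.indicator_of_notMem (fun hm => hp ((h.periodic_mem x y).1 hm))]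

lemma excessSlope_periodic (h : HarmonicStrip Ω l lx ly lxx c) (x : ℝ) :
    Function.Periodic (fun y => excessSlope Ω l a ly (x, y)) (2 * Real.pi) := by
  intro y
  by_cases hp : (x, y) ∈ Ω
  · simp only [excessSlope]
    rw [Set.indicator_of_mem hp, Set.indicator_of_mem ((h.periodic_mem x y).2 hp), h.periodic,
      h.periodic_y]
  · simp only [excessSlope]
    rw [Set.indicator_of_notMem hp,
      Set.indicator_of_notMem (fun hm => hp ((h.periodic_mem x y).1 hm))]

/-- The integral over a period of the squared excess. -/
noncomputable def energy (Ω : Set (ℝ × ℝ)) (l : ℝ × ℝ → ℝ) (a : ℝ → ℝ) (t : ℝ) : ℝ :=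
  ∫ y in (0 : ℝ)..(2 * Real.pi), excess Ω l a (t, y) ^ 2

/-- The derivative of `energy`. -/
noncomputable def energyDeriv (Ω : Set (ℝ × ℝ)) (l lx : ℝ × ℝ → ℝ) (a a' : ℝ → ℝ) (t : ℝ) : ℝ :=
  2 * ∫ y in (0 : ℝ)..(2 * Real.pi), excess Ω l a (t, y) * (lx (t, y) - a' t)

/-- The right derivative of `energyDeriv`. -/
noncomputable def energyDeriv₂ (Ω : Set (ℝ × ℝ)) (l lx ly : ℝ × ℝ → ℝ) (a a' a'' : ℝ → ℝ)
    (t : ℝ) : ℝ :=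
  2 * ∫ y in (0 : ℝ)..(2 * Real.pi),
    (excessSlope Ω l a (fun p => lx p - a' p.1) (t, y) ^ 2 +
      excessSlope Ω l a ly (t, y) ^ 2 - excess Ω l a (t, y) * a'' t)

lemma continuous_slice_excess (h : HarmonicStrip Ω l lx ly lxx c) (ha : Continuous a) {t : ℝ}
    (hc : c < a t) : Continuous fun y => excess Ω l a (t, y) :=
  continuous_iff_continuousAt.2 fun y =>
    ContinuousAt.comp (f := fun y : ℝ => (t, y)) (h.continuousAt_excess ha hc) (by fun_prop)

lemma exists_bound {b : ℝ × ℝ → ℝ} (hb : Continuous b) {s t y z : ℝ} :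
    ∃ B, ∀ p ∈ Set.Icc s t ×ˢ Set.Icc y z, b p ≤ B := by
  obtain ⟨B, hB⟩ := ((isCompact_Icc (a := s) (b := t)).prod
    (isCompact_Icc (a := y) (b := z))).bddAbove_image hb.continuousOn
  exact ⟨B, fun p hp => hB ⟨p, hp, rfl⟩⟩

lemma integral_energyDeriv (h : HarmonicStrip Ω l lx ly lxx c)
    (ha : ∀ t, HasDerivAt a (a' t) t) (ha' : Continuous a') {s t : ℝ} (hst : s ≤ t)
    (hc : ∀ x ∈ Set.Icc s t, c < a x) :
    IntervalIntegrable (energyDeriv Ω l lx a a') volume s t ∧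
    ∫ x in s..t, energyDeriv Ω l lx a a' x = energy Ω l a t - energy Ω l a s := by
  have hac : Continuous a := continuous_iff_continuousAt.2 fun t => (ha t).continuousAt
  have hl := h.cont
  have hlx := h.cont_x
  obtain ⟨B, hB⟩ := exists_bound (b := fun p => 2 * (|l p - a p.1| * |lx p - a' p.1|))
    (by fun_prop) (s := s) (t := t) (y := 0) (z := 2 * Real.pi)
  have key := integral_integral_right_deriv (H := fun p => excess Ω l a p ^ 2)
    (G := fun p => 2 * (excess Ω l a p * (lx p - a' p.1))) (B := B) hst Real.two_pi_pos.le
    (by have := measurable_excess h.isOpen h.cont hac; fun_prop)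
    (fun p hp => le_trans (by
      rw [abs_mul, abs_mul, abs_two]
      have := abs_excess_le (Ω := Ω) (l := l) (a := a) p
      gcongr) (hB p hp))
    (fun p hp => ((h.continuousAt_excess hac (hc p.1 hp.1)).pow 2).continuousWithinAt)
    (fun x hx y hy => by
      have := (h.excess_right_deriv hac (γ := fun x => (x, y)) (by fun_prop) (s := x)
        (hc x hx) (d := fun p => lx p - a' p.1) (fun hp => h.deriv_sub_x ha hp)).pow 2
      refine this.congr_deriv ?_
      have := excess_mul_excessSlope (Ω := Ω) (l := l) (a := a)
        (d := fun p => lx p - a' p.1) (x, y)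
      push_cast
      linear_combination 2 * this)
  simp only [intervalIntegral.integral_const_mul] at key
  refine ⟨key.1, ?_⟩
  simp only [energyDeriv, energy, intervalIntegral.integral_const_mul]
  exact key.2

lemma intervalIntegrable_excessSlope_sq (h : HarmonicStrip Ω l lx ly lxx c) (ha : Continuous a)
    {d : ℝ × ℝ → ℝ} (hd : Continuous d) (t : ℝ) (y z : ℝ) :
    IntervalIntegrable (fun y => excessSlope Ω l a d (t, y) ^ 2) volume y z := by
  have hm := measurable_excessSlope h.isOpen h.cont ha hd
  refine ((by fun_prop : Continuous fun y : ℝ => d (t, y) ^ 2).intervalIntegrable y z).mono_fun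
    (by fun_prop : Measurable _).aestronglyMeasurable (Eventually.of_forall fun x => ?_)
  simp only
  rw [Real.norm_eq_abs, Real.norm_eq_abs, abs_pow, abs_pow]
  have := abs_excessSlope_le (Ω := Ω) (l := l) (a := a) (d := d) (t, x)
  gcongr

lemma integral_excessSlope_sq (h : HarmonicStrip Ω l lx ly lxx c) (ha : Continuous a) {t : ℝ}
    (hc : c < a t) :
    ∫ y in (0 : ℝ)..(2 * Real.pi), excessSlope Ω l a ly (t, y) ^ 2 =
      ∫ y in (0 : ℝ)..(2 * Real.pi), excess Ω l a (t, y) * lxx (t, y) := by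
  have hq := h.continuous_slice_excess ha hc
  have hly := h.cont_y
  have hlxx := h.cont_xx
  have hi1 := h.intervalIntegrable_excessSlope_sq ha h.cont_y t 0 (2 * Real.pi)
  have hi2 : IntervalIntegrable (fun y => excess Ω l a (t, y) * -lxx (t, y)) volume
      0 (2 * Real.pi) := (by fun_prop : Continuous _).intervalIntegrable _ _
  have := intervalIntegral.integral_eq_sub_of_hasDeriv_right_of_le Real.two_pi_pos.le
    (f := fun y => excess Ω l a (t, y) * ly (t, y))
    (f' := fun y => excessSlope Ω l a ly (t, y) ^ 2 + excess Ω l a (t, y) * -lxx (t, y))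
    (by fun_prop) (fun y _ => h.excess_mul_right_deriv ha (γ := fun y => (t, y)) (by fun_prop)
      hc (d := ly) (e := fun p => -lxx p) (fun hp => h.deriv_sub_y hp) (fun hp => h.deriv_yy _ hp))
    (hi1.add hi2)
  rw [intervalIntegral.integral_add hi1 hi2] at this
  have hp := h.excess_periodic (a := a) t 0
  have hp' := h.periodic_y t 0
  simp only [zero_add] at hp hp'
  simp only [mul_neg, intervalIntegral.integral_neg, hp, hp', sub_self] at this
  linarith

lemma integral_energyDeriv₂ (h : HarmonicStrip Ω l lx ly lxx c)
    (ha : ∀ t, HasDerivAt a (a' t) t) (ha' : ∀ t, HasDerivAt a' (a'' t) t)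
    (ha'' : Continuous a'') {s t : ℝ} (hst : s ≤ t) (hc : ∀ x ∈ Set.Icc s t, c < a x) :
    IntervalIntegrable (energyDeriv₂ Ω l lx ly a a' a'') volume s t ∧
    ∫ x in s..t, energyDeriv₂ Ω l lx ly a a' a'' x =
      energyDeriv Ω l lx a a' t - energyDeriv Ω l lx a a' s := by
  have hac : Continuous a := continuous_iff_continuousAt.2 fun t => (ha t).continuousAt
  have hac' : Continuous a' := continuous_iff_continuousAt.2 fun t => (ha' t).continuousAt
  have hl := h.cont
  have hlx := h.cont_x
  have hlxx := h.cont_xx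
  have hd : Continuous fun p : ℝ × ℝ => lx p - a' p.1 := by fun_prop
  obtain ⟨B, hB⟩ := exists_bound
    (b := fun p => |lx p - a' p.1| ^ 2 + |l p - a p.1| * |lxx p - a'' p.1|)
    (by fun_prop) (s := s) (t := t) (y := 0) (z := 2 * Real.pi)
  have key := integral_integral_right_deriv
    (H := fun p => excess Ω l a p * (lx p - a' p.1))
    (G := fun p => excessSlope Ω l a (fun p => lx p - a' p.1) p ^ 2 +
      excess Ω l a p * (lxx p - a'' p.1)) (B := B) hst Real.two_pi_pos.le
    (by
      have := measurable_excess h.isOpen h.cont hac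
      have := measurable_excessSlope h.isOpen h.cont hac hd
      fun_prop)
    (fun p hp => le_trans (by
      refine (abs_add_le _ _).trans ?_
      rw [abs_pow, abs_mul]
      have := abs_excess_le (Ω := Ω) (l := l) (a := a) p
      have := abs_excessSlope_le (Ω := Ω) (l := l) (a := a) (d := fun p => lx p - a' p.1) p
      gcongr) (hB p hp))
    (fun p hp => ((h.continuousAt_excess hac (hc p.1 hp.1)).mul
      hd.continuousAt).continuousWithinAt)
    (fun x hx y hy => h.excess_mul_right_deriv hac (γ := fun x => (x, y)) (by fun_prop) (s := x)
        (hc x hx) (d := fun p => lx p - a' p.1) (e := fun p => lxx p - a'' p.1)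
        (fun hp => h.deriv_sub_x ha hp) (fun hp => h.deriv_sub_xx ha' hp))
  have heq : ∀ x ∈ Set.Icc s t, energyDeriv₂ Ω l lx ly a a' a'' x =
      2 * ∫ y in (0 : ℝ)..(2 * Real.pi), (excessSlope Ω l a (fun p => lx p - a' p.1) (x, y) ^ 2 +
        excess Ω l a (x, y) * (lxx (x, y) - a'' x)) := by
    intro x hx
    have hq := h.continuous_slice_excess hac (hc x hx)
    have hi1 := h.intervalIntegrable_excessSlope_sq hac hd x 0 (2 * Real.pi)
    have hi2 := h.intervalIntegrable_excessSlope_sq hac h.cont_y x 0 (2 * Real.pi)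
    have hi3 : IntervalIntegrable (fun y => excess Ω l a (x, y) * a'' x) volume
      0 (2 * Real.pi) := (by fun_prop : Continuous _).intervalIntegrable _ _
    have hi4 : IntervalIntegrable (fun y => excess Ω l a (x, y) * lxx (x, y)) volume
      0 (2 * Real.pi) := (by fun_prop : Continuous _).intervalIntegrable _ _
    simp only [energyDeriv₂, mul_sub]
    rw [intervalIntegral.integral_sub (hi1.add hi2) hi3, intervalIntegral.integral_add hi1 hi2,
      intervalIntegral.integral_add hi1 (hi4.sub hi3), intervalIntegral.integral_sub hi4 hi3,
      h.integral_excessSlope_sq hac (hc x hx)]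
    ring
  constructor
  · refine (key.1.const_mul 2).congr fun x hx => ?_
    rw [Set.uIoc_of_le hst] at hx
    exact (heq x (Set.Ioc_subset_Icc_self hx)).symm
  · rw [intervalIntegral.integral_congr (fun x hx => heq x (by rwa [Set.uIcc_of_le hst] at hx)),
      intervalIntegral.integral_const_mul, key.2]
    simp only [energyDeriv]
    ring

lemma mul_energy_le (h : HarmonicStrip Ω l lx ly lxx c) (ha : Continuous a) {t k : ℝ}
    (hc : c < a t) (hk : 0 ≤ k) (hk2 : k < 1 / 2) {y₀ : ℝ} (hy₀ : (t, y₀) ∉ Ω) :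
    k ^ 2 * energy Ω l a t ≤
      ∫ y in (0 : ℝ)..(2 * Real.pi), excessSlope Ω l a ly (t, y) ^ 2 := by
  have hm := measurable_excessSlope h.isOpen h.cont ha h.cont_y
  have hly := h.cont_y
  obtain ⟨B, hB⟩ := exists_bound (b := fun p => |ly p|) (by fun_prop) (s := t) (t := t)
    (y := y₀) (z := y₀ + 2 * Real.pi)
  have h0 : excess Ω l a (t, y₀) = 0 := Set.indicator_of_notMem hy₀ _
  have key := mul_integral_sq_le_integral_sq_of_right_deriv
    (q := fun y => excess Ω l a (t, y)) (D := fun y => excessSlope Ω l a ly (t, y))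
    (α := y₀) (L := 2 * Real.pi) (k := k) (B := B) Real.two_pi_pos.le hk
    (by nlinarith [Real.pi_pos]) (h.continuous_slice_excess ha hc).continuousOn
    (fun y _ => h.excess_right_deriv ha (γ := fun y => (t, y)) (by fun_prop) hc
      (fun hp => h.deriv_sub_y hp))
    (by fun_prop) (fun y hy => (abs_excessSlope_le _).trans (hB _ ⟨⟨le_rfl, le_rfl⟩, hy⟩))
    h0 ((h.excess_periodic t y₀).trans h0)
  have e1 := ((h.excess_periodic (a := a) t).comp (· ^ 2)).intervalIntegral_add_eq y₀ 0
  have e2 := ((h.excessSlope_periodic (a := a) t).comp (· ^ 2)).intervalIntegral_add_eq y₀ 0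
  simp only [Function.comp_def, zero_add] at e1 e2
  rw [energy, ← e1, ← e2]
  exact key

lemma convexOn_energy (h : HarmonicStrip Ω l lx ly lxx c)
    (ha : ∀ t, HasDerivAt a (a' t) t) (ha' : ∀ t, HasDerivAt a' (a'' t) t)
    (ha'' : Continuous a'') {t₁ : ℝ} (hc : ∀ x, t₁ ≤ x → c < a x)
    (hpos : ∀ x, t₁ ≤ x → 0 ≤ energyDeriv₂ Ω l lx ly a a' a'' x) :
    ConvexOn ℝ (Set.Ici t₁) (energy Ω l a) := by
  have hac' : Continuous a' := continuous_iff_continuousAt.2 fun t => (ha' t).continuousAt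
  have hmono : ∀ s t, t₁ ≤ s → s ≤ t →
      energyDeriv Ω l lx a a' s ≤ energyDeriv Ω l lx a a' t := by
    intro s t hs hst
    have h2 := (h.integral_energyDeriv₂ ha ha' ha'' hst fun x hx => hc x (hs.trans hx.1)).2
    have := intervalIntegral.integral_nonneg hst
      (fun x hx => hpos x (hs.trans hx.1)) (μ := volume)
    linarith
  refine convexOn_of_slope_mono_adjacent (convex_Ici t₁) ?_
  intro x y z hx _ hxy hyz
  have hx : t₁ ≤ x := hx
  obtain ⟨i1, e1⟩ := h.integral_energyDeriv ha hac' hxy.le fun s hs => hc s (hx.trans hs.1)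
  obtain ⟨i2, e2⟩ := h.integral_energyDeriv ha hac' hyz.le
    fun s hs => hc s (hx.trans (hxy.le.trans hs.1))
  have b1 := intervalIntegral.integral_mono_on hxy.le i1 intervalIntegrable_const
    (fun s hs => hmono s y (hx.trans hs.1) hs.2)
  have b2 := intervalIntegral.integral_mono_on hyz.le intervalIntegrable_const i2
    (fun s hs => hmono y s (hx.trans hxy.le) hs.1)
  rw [intervalIntegral.integral_const, smul_eq_mul] at b1 b2
  have hxy' : 0 < y - x := sub_pos.2 hxy
  have hyz' : 0 < z - y := sub_pos.2 hyz
  calc _ ≤ energyDeriv Ω l lx a a' y := by rw [div_le_iff₀ hxy']; linarith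
    _ ≤ _ := by rw [le_div_iff₀ hyz']; linarith

lemma energyDeriv₂_ge (h : HarmonicStrip Ω l lx ly lxx c) (ha : Continuous a)
    (ha' : Continuous a') {t k : ℝ} (hc : c < a t) (hk : 0 ≤ k) (hk2 : k < 1 / 2)
    {y₀ : ℝ} (hy₀ : (t, y₀) ∉ Ω) :
    2 * (∫ y in (0 : ℝ)..(2 * Real.pi),
        excessSlope Ω l a (fun p => lx p - a' p.1) (t, y) ^ 2) +
      2 * k ^ 2 * energy Ω l a t - 2 * a'' t * ∫ y in (0 : ℝ)..(2 * Real.pi), excess Ω l a (t, y) ≤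
      energyDeriv₂ Ω l lx ly a a' a'' t := by
  have hlx := h.cont_x
  have hi1 := h.intervalIntegrable_excessSlope_sq ha
    (d := fun p => lx p - a' p.1) (by fun_prop) t 0 (2 * Real.pi)
  have hi2 := h.intervalIntegrable_excessSlope_sq ha h.cont_y t 0 (2 * Real.pi)
  have hi3 : IntervalIntegrable (fun y => excess Ω l a (t, y) * a'' t) volume 0 (2 * Real.pi) :=
    ((h.continuous_slice_excess ha hc).mul_const _).intervalIntegrable _ _
  rw [energyDeriv₂, intervalIntegral.integral_sub (hi1.add hi2) hi3,
    intervalIntegral.integral_add hi1 hi2, intervalIntegral.integral_mul_const]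
  linarith [h.mul_energy_le ha hc hk hk2 hy₀]

lemma energy_nonneg (t : ℝ) : 0 ≤ energy Ω l a t :=
  intervalIntegral.integral_nonneg Real.two_pi_pos.le fun _ _ => sq_nonneg _

lemma energy_pos (h : HarmonicStrip Ω l lx ly lxx c) (ha : Continuous a) {t y₀ : ℝ}
    (hc : c < a t) (hp : (t, y₀) ∈ Ω) (hl : a t < l (t, y₀)) : 0 < energy Ω l a t := by
  have e := ((h.excess_periodic (a := a) t).comp (· ^ 2)).intervalIntegral_add_eq y₀ 0
  simp only [Function.comp_def, zero_add] at e
  rw [energy, ← e]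
  refine intervalIntegral.integral_pos (by linarith [Real.two_pi_pos])
    ((h.continuous_slice_excess ha hc).pow 2).continuousOn (fun _ _ => sq_nonneg _)
    ⟨y₀, ⟨le_rfl, by linarith [Real.two_pi_pos]⟩, ?_⟩
  have : 0 < excess Ω l a (t, y₀) := by
    rw [excess, Set.indicator_of_mem hp]
    exact lt_max_of_lt_left (sub_pos.2 hl)
  positivity

lemma energyDeriv_monotone_of_const (h : HarmonicStrip Ω l lx ly lxx c) {C : ℝ} (hC : c < C) :
    Monotone (energyDeriv Ω l lx (fun _ => C) fun _ => 0) := by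
  intro s t hst
  have e := (h.integral_energyDeriv₂ (a'' := fun _ => 0) (fun t => hasDerivAt_const t C)
    (fun t => hasDerivAt_const t 0) continuous_const hst (fun _ _ => hC)).2
  have : 0 ≤ ∫ x in s..t, energyDeriv₂ Ω l lx ly (fun _ => C) (fun _ => 0) (fun _ => 0) x := by
    refine intervalIntegral.integral_nonneg hst fun x _ => ?_
    refine mul_nonneg zero_le_two (intervalIntegral.integral_nonneg Real.two_pi_pos.le ?_)
    intro y _
    simp only [mul_zero, sub_zero]
    positivity
  linarith

lemma energyDeriv_nonneg_of_const (h : HarmonicStrip Ω l lx ly lxx c) {C : ℝ} (hC : c < C)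
    {s B : ℝ} (hB : ∀ t ≤ s, energy Ω l (fun _ => C) t ≤ B) :
    0 ≤ energyDeriv Ω l lx (fun _ => C) (fun _ => 0) s := by
  by_contra! hneg
  set n := energyDeriv Ω l lx (fun _ => C) (fun _ => 0) s
  have hB0 : 0 ≤ B := (energy_nonneg s).trans (hB s le_rfl)
  obtain ⟨t, hts, hBt⟩ : ∃ t ≤ s, B < -n * (s - t) := by
    refine ⟨s - (B + 1) / (-n), ?_, ?_⟩
    · have : 0 ≤ (B + 1) / (-n) := div_nonneg (by linarith) (by linarith)
      linarith
    · rw [sub_sub_cancel, mul_div_cancel₀ _ (by linarith)]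
      linarith
  obtain ⟨i, e⟩ := h.integral_energyDeriv (fun t => hasDerivAt_const t C) continuous_const hts
    (fun _ _ => hC)
  have b := intervalIntegral.integral_mono_on hts i intervalIntegrable_const
    (fun x hx => h.energyDeriv_monotone_of_const hC hx.2)
  rw [intervalIntegral.integral_const, smul_eq_mul, e] at b
  have := hB t hts
  have := energy_nonneg (Ω := Ω) (l := l) (a := fun _ => C) s
  nlinarith

lemma continuous_energyDeriv_of_const (h : HarmonicStrip Ω l lx ly lxx c) {C : ℝ} (hC : c < C) :
    Continuous (energyDeriv Ω l lx (fun _ => C) fun _ => 0) := by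
  have hq : Continuous (excess Ω l fun _ => C) :=
    continuous_iff_continuousAt.2 fun p => h.continuousAt_excess continuous_const hC
  have hlx := h.cont_x
  unfold energyDeriv
  refine continuous_const.mul ?_
  refine intervalIntegral.continuous_parametric_intervalIntegral_of_continuous'
    (f := fun t y => excess Ω l (fun _ => C) (t, y) * (lx (t, y) - 0)) ?_ _ _
  unfold Function.uncurry
  fun_prop

lemma energy_eq_of_const (h : HarmonicStrip Ω l lx ly lxx c) {C : ℝ} (hC : c < C) {s t : ℝ}
    (hst : s ≤ t) :
    energy Ω l (fun _ => C) t = energy Ω l (fun _ => C) s +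
      ∫ x in s..t, energyDeriv Ω l lx (fun _ => C) (fun _ => 0) x := by
  rw [(h.integral_energyDeriv (fun t => hasDerivAt_const t C) continuous_const hst
    (fun _ _ => hC)).2]
  ring

lemma energyDeriv₂_ge_of_const (h : HarmonicStrip Ω l lx ly lxx c) {C : ℝ} (hC : c < C)
    {t k : ℝ} (hk : 0 ≤ k) (hk2 : k < 1 / 2) {y₀ : ℝ} (hy₀ : (t, y₀) ∉ Ω) :
    2 * k ^ 2 * energy Ω l (fun _ => C) t ≤
        energyDeriv₂ Ω l lx ly (fun _ => C) (fun _ => 0) (fun _ => 0) t ∧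
      2 * k * energyDeriv Ω l lx (fun _ => C) (fun _ => 0) t ≤
        energyDeriv₂ Ω l lx ly (fun _ => C) (fun _ => 0) (fun _ => 0) t := by
  have key := h.energyDeriv₂_ge (a := fun _ => C) (a' := fun _ => 0) (a'' := fun _ => 0)
    continuous_const continuous_const hC hk hk2 hy₀
  have hlx := h.cont_x
  have hi1 := h.intervalIntegrable_excessSlope_sq (a := fun _ => C) continuous_const
    (d := fun p => lx p - 0) (by fun_prop) t 0 (2 * Real.pi)
  have hq := h.continuous_slice_excess (a := fun _ => C) continuous_const (t := t) hC
  have hi2 : IntervalIntegrable (fun y => k ^ 2 * excess Ω l (fun _ => C) (t, y) ^ 2) volume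
    0 (2 * Real.pi) := (by fun_prop : Continuous _).intervalIntegrable _ _
  have hi3 : IntervalIntegrable
    (fun y => 2 * k * (excess Ω l (fun _ => C) (t, y) * (lx (t, y) - 0))) volume
    0 (2 * Real.pi) := (by fun_prop : Continuous _).intervalIntegrable _ _
  have hnn : 0 ≤ ∫ y in (0 : ℝ)..(2 * Real.pi),
      excessSlope Ω l (fun _ => C) (fun p => lx p - 0) (t, y) ^ 2 :=
    intervalIntegral.integral_nonneg Real.two_pi_pos.le fun _ _ => sq_nonneg _
  refine ⟨by linarith, ?_⟩
  have := intervalIntegral.integral_mono_on Real.two_pi_pos.le hi3 (hi1.add hi2) (fun y _ => by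
    rw [← excess_mul_excessSlope (d := fun p => lx p - 0)]
    nlinarith [sq_nonneg (excessSlope Ω l (fun _ => C) (fun p => lx p - 0) (t, y) -
      k * excess Ω l (fun _ => C) (t, y))])
  rw [intervalIntegral.integral_add hi1 hi2, intervalIntegral.integral_const_mul,
    intervalIntegral.integral_const_mul] at this
  have e1 : energy Ω l (fun _ => C) t = ∫ y in (0 : ℝ)..(2 * Real.pi),
    excess Ω l (fun _ => C) (t, y) ^ 2 := rfl
  have e2 : energyDeriv Ω l lx (fun _ => C) (fun _ => 0) t = 2 * ∫ y in (0 : ℝ)..(2 * Real.pi),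
    excess Ω l (fun _ => C) (t, y) * (lx (t, y) - 0) := rfl
  rw [← e1] at this
  rw [e2]
  linarith

/-- Exponential growth of the energy above a constant level. -/
lemma exists_exp_le_energy_of_const (h : HarmonicStrip Ω l lx ly lxx c) {C : ℝ} (hC : c < C)
    {k T : ℝ} (hk : 0 < k) (hk2 : k < 1 / 2) (hT : ∀ t, T ≤ t → ∃ y, (t, y) ∉ Ω)
    (hB : ∀ s, ∃ B, ∀ t ≤ s, energy Ω l (fun _ => C) t ≤ B)
    {p : ℝ × ℝ} (hp : p ∈ Ω) (hlp : C < l p) :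
    ∃ ε > 0, ∃ S, ∃ b, ∀ t, S ≤ t → ε * Real.exp (2 * k * t) - b ≤ energy Ω l (fun _ => C) t := by
  set M := energy Ω l fun _ => C with hM
  set N := energyDeriv Ω l lx (fun _ => C) fun _ => 0 with hN
  have hNc : Continuous N := h.continuous_energyDeriv_of_const hC
  have hN0 : ∀ s, 0 ≤ N s := fun s => by
    obtain ⟨B, hB⟩ := hB s
    exact h.energyDeriv_nonneg_of_const hC hB
  have hMmono : ∀ s t, s ≤ t → M s ≤ M t := fun s t hst => by
    rw [hM, h.energy_eq_of_const hC hst]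
    linarith [intervalIntegral.integral_nonneg hst (fun x _ => hN0 x) (μ := volume)]
  have hMpos : 0 < M p.1 := h.energy_pos continuous_const hC hp hlp
  have hN2 : ∀ s t, s ≤ t →
      IntervalIntegrable (energyDeriv₂ Ω l lx ly (fun _ => C) (fun _ => 0) fun _ => 0) volume s t ∧
      ∫ x in s..t, energyDeriv₂ Ω l lx ly (fun _ => C) (fun _ => 0) (fun _ => 0) x = N t - N s :=
    fun s t hst => h.integral_energyDeriv₂ (fun t => hasDerivAt_const t C)
      (fun t => hasDerivAt_const t 0) continuous_const hst (fun _ _ => hC)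
  set S₀ := max T p.1
  set S := S₀ + 1
  have hNS : 0 < N S := by
    obtain ⟨i, e⟩ := hN2 S₀ S (by simp [S])
    have := intervalIntegral.integral_mono_on (f := fun _ => 2 * k ^ 2 * M p.1)
      (by simp [S] : S₀ ≤ S) intervalIntegrable_const i (fun x hx => by
        obtain ⟨y₀, hy₀⟩ := hT x ((le_max_left _ _).trans hx.1)
        refine le_trans ?_ (h.energyDeriv₂_ge_of_const hC hk.le hk2 hy₀).1
        have := hMmono p.1 x ((le_max_right _ _).trans hx.1)
        gcongr)
    rw [intervalIntegral.integral_const, smul_eq_mul, e] at this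
    have h1 : S - S₀ = 1 := by simp [S]
    have h2 : 0 < 2 * k ^ 2 * M p.1 := by positivity
    rw [h1] at this
    linarith [hN0 S₀]
  have hNge : ∀ t, S ≤ t → N S + 2 * k * ∫ x in S..t, N x ≤ N t := by
    intro t ht
    obtain ⟨i, e⟩ := hN2 S t ht
    have := intervalIntegral.integral_mono_on ht ((hNc.intervalIntegrable S t).const_mul (2 * k)) i
      (fun x hx => by
        obtain ⟨y₀, hy₀⟩ := hT x (by
          have := le_max_left T p.1
          have : S₀ + 1 ≤ x := hx.1
          linarith)
        exact (h.energyDeriv₂_ge_of_const hC hk.le hk2 hy₀).2)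
    rw [intervalIntegral.integral_const_mul, e] at this
    linarith
  let J : ℝ → ℝ := fun t => ((∫ x in S..t, N x) + N S / (2 * k)) * Real.exp (-(2 * k * t))
  have hJ : ∀ t, HasDerivAt J ((N t - 2 * k * (∫ x in S..t, N x) - N S) *
      Real.exp (-(2 * k * t))) t := by
    intro t
    have h1 := ((intervalIntegral.integral_hasDerivAt_right (hNc.intervalIntegrable S t)
      hNc.stronglyMeasurable.stronglyMeasurableAtFilter hNc.continuousAt).add_const
        (N S / (2 * k))).mul (((hasDerivAt_id t).const_mul (2 * k)).neg.exp)
    refine h1.congr_deriv ?_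
    simp only [id, Pi.neg_apply]
    field_simp
    ring
  have hJmono : MonotoneOn J (Set.Ici S) := by
    refine monotoneOn_of_deriv_nonneg (convex_Ici S)
      (fun t _ => (hJ t).continuousAt.continuousWithinAt)
      (fun t _ => (hJ t).differentiableAt.differentiableWithinAt) fun t ht => ?_
    rw [interior_Ici] at ht
    rw [(hJ t).deriv]
    exact mul_nonneg (by linarith [hNge t (le_of_lt ht)]) (Real.exp_pos _).le
  refine ⟨N S / (2 * k) * Real.exp (-(2 * k * S)), by positivity, S, N S / (2 * k), fun t ht => ?_⟩
  have hmain := hJmono (Set.self_mem_Ici) ht ht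
  simp only [J, intervalIntegral.integral_same, zero_add] at hmain
  have h2 := mul_le_mul_of_nonneg_right hmain (Real.exp_pos (2 * k * t)).le
  rw [mul_assoc _ (Real.exp (-(2 * k * t))), ← Real.exp_add, neg_add_cancel, Real.exp_zero,
    mul_one] at h2
  rw [hM, h.energy_eq_of_const hC ht]
  linarith [energy_nonneg (Ω := Ω) (l := l) (a := fun _ => C) S]

/-- Above the level `exp (β t)` the energy is eventually convex. -/
lemma exists_convexOn_energy_exp (h : HarmonicStrip Ω l lx ly lxx c) {C : ℝ} (hC : c < C)
    {β T : ℝ} (hβ : 0 < β) (hβ2 : β < 1 / 2) (hT : ∀ t, T ≤ t → ∃ y, (t, y) ∉ Ω)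
    (hB : ∀ s, ∃ B, ∀ t ≤ s, energy Ω l (fun _ => C) t ≤ B)
    {p : ℝ × ℝ} (hp : p ∈ Ω) (hlp : C < l p) :
    ∃ t₁, ConvexOn ℝ (Set.Ici t₁) (energy Ω l fun t => Real.exp (β * t)) := by
  obtain ⟨k, hβk, hk2⟩ := exists_between hβ2
  have hk : 0 < k := hβ.trans hβk
  obtain ⟨ε, hε, S, b, hgrow⟩ := h.exists_exp_le_energy_of_const hC hk hk2 hT hB hp hlp
  have ha : ∀ t, HasDerivAt (fun t => Real.exp (β * t)) (β * Real.exp (β * t)) t := fun t => by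
    simpa [mul_comm] using ((hasDerivAt_id t).const_mul β).exp
  have ha' : ∀ t, HasDerivAt (fun t => β * Real.exp (β * t)) (β ^ 2 * Real.exp (β * t)) t :=
    fun t => ((ha t).const_mul β).congr_deriv (by ring)
  have hac : Continuous fun t => Real.exp (β * t) := by fun_prop
  have hexp : Tendsto (fun t => Real.exp (β * t)) atTop atTop :=
    Real.tendsto_exp_atTop.comp (tendsto_id.const_mul_atTop hβ)
  set A₁ : ℝ := 2 * Real.pi * (2 * k ^ 2 + β ^ 4 / k ^ 2) with hA₁
  set A₂ : ℝ := k ^ 2 / 2 * b + 2 * Real.pi * (2 * k ^ 2 * C ^ 2) with hA₂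
  have hlim : ∀ᶠ t in atTop,
      A₁ * Real.exp (β * t) ^ 2 + A₂ ≤ k ^ 2 / 2 * ε * Real.exp (2 * k * t) := by
    have hdecay : ∀ r : ℝ, 0 < r → Tendsto (fun t => Real.exp (-(r * t))) atTop (𝓝 0) :=
      fun r hr => Real.tendsto_exp_neg_atTop_nhds_zero.comp (tendsto_id.const_mul_atTop hr)
    have hzero := ((hdecay (2 * (k - β)) (by linarith)).const_mul A₁).add
      ((hdecay (2 * k) (by linarith)).const_mul A₂)
    rw [mul_zero, mul_zero, add_zero] at hzero
    filter_upwards [hzero.eventually_le_const (by positivity : 0 < k ^ 2 / 2 * ε)] with t ht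
    have h2 := mul_le_mul_of_nonneg_right ht (Real.exp_pos (2 * k * t)).le
    refine le_trans (le_of_eq ?_) h2
    have e1 : Real.exp (-(2 * (k - β) * t)) * Real.exp (2 * k * t) = Real.exp (β * t) ^ 2 := by
      rw [← Real.exp_add, ← Real.exp_nat_mul]
      congr 1
      push_cast
      ring
    have e2 : Real.exp (-(2 * k * t)) * Real.exp (2 * k * t) = 1 := by
      rw [← Real.exp_add, neg_add_cancel, Real.exp_zero]
    linear_combination -A₁ * e1 - A₂ * e2
  obtain ⟨t₁, ht₁⟩ := eventually_atTop.1 (hlim.and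
    ((hexp.eventually_gt_atTop c).and ((eventually_ge_atTop T).and (eventually_ge_atTop S))))
  refine ⟨t₁, h.convexOn_energy ha ha' (by fun_prop) (fun x hx => (ht₁ x hx).2.1) fun t ht => ?_⟩
  obtain ⟨hbig, hct, hTt, hSt⟩ := ht₁ t ht
  obtain ⟨y₀, hy₀⟩ := hT t hTt
  refine le_trans ?_ (h.energyDeriv₂_ge hac (by fun_prop) hct hk.le hk2 hy₀)
  have hnn : 0 ≤ ∫ y in (0 : ℝ)..(2 * Real.pi), excessSlope Ω l (fun t => Real.exp (β * t))
      (fun p => lx p - β * Real.exp (β * p.1)) (t, y) ^ 2 :=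
    intervalIntegral.integral_nonneg Real.two_pi_pos.le fun _ _ => sq_nonneg _
  set q := fun y => excess Ω l (fun t => Real.exp (β * t)) (t, y) with hq
  set qC := fun y => excess Ω l (fun _ => C) (t, y) with hqC
  have hqc : Continuous q := h.continuous_slice_excess hac hct
  have hqCc : Continuous qC := h.continuous_slice_excess continuous_const hC
  set A := Real.exp (β * t) with hA
  have hA0 : 0 < A := Real.exp_pos _
  have hle : ∀ y, qC y ≤ q y + (A + |C|) := by
    intro y
    simp only [hq, hqC, excess]
    by_cases hm : (t, y) ∈ Ω
    · rw [Set.indicator_of_mem hm, Set.indicator_of_mem hm]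
      have h1 := le_max_left (l (t, y) - A) 0
      have h2 := le_max_right (l (t, y) - A) 0
      have h3 := neg_abs_le C
      exact max_le (by linarith) (by linarith [abs_nonneg C])
    · rw [Set.indicator_of_notMem hm, Set.indicator_of_notMem hm]
      positivity
  have hpt : ∀ y, k ^ 2 / 2 * qC y ^ 2 - ((2 * k ^ 2 + β ^ 4 / k ^ 2) * A ^ 2 + 2 * k ^ 2 * C ^ 2) ≤
      2 * k ^ 2 * q y ^ 2 - 2 * (β ^ 2 * A) * q y := by
    intro y
    have h0 : 0 ≤ qC y := excess_nonneg _
    have h1 : qC y ^ 2 ≤ 2 * q y ^ 2 + 4 * A ^ 2 + 4 * C ^ 2 := by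
      have h2 : qC y ^ 2 ≤ (q y + (A + |C|)) ^ 2 := by
        have := hle y
        gcongr
      nlinarith [sq_nonneg (q y - (A + |C|)), sq_nonneg (A - |C|), sq_abs C]
    have h3 : 2 * (β ^ 2 * A) * q y ≤ k ^ 2 * q y ^ 2 + β ^ 4 / k ^ 2 * A ^ 2 := by
      have h4 : k ^ 2 * q y ^ 2 + β ^ 4 / k ^ 2 * A ^ 2 - 2 * (β ^ 2 * A) * q y =
          (k * q y - β ^ 2 / k * A) ^ 2 := by
        field_simp
        ring
      linarith [sq_nonneg (k * q y - β ^ 2 / k * A)]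
    nlinarith [mul_le_mul_of_nonneg_left h1 (sq_nonneg k)]
  have hmono := intervalIntegral.integral_mono_on (μ := volume) Real.two_pi_pos.le
    ((by fun_prop : Continuous _).intervalIntegrable _ _)
    ((by fun_prop : Continuous _).intervalIntegrable _ _) (fun y _ => hpt y)
  rw [intervalIntegral.integral_sub ((by fun_prop : Continuous _).intervalIntegrable _ _)
      ((by fun_prop : Continuous _).intervalIntegrable _ _),
    intervalIntegral.integral_sub ((by fun_prop : Continuous _).intervalIntegrable _ _)
      ((by fun_prop : Continuous _).intervalIntegrable _ _),
    intervalIntegral.integral_const_mul, intervalIntegral.integral_const_mul,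
    intervalIntegral.integral_const_mul, intervalIntegral.integral_const, smul_eq_mul,
    sub_zero] at hmono
  have hg := mul_le_mul_of_nonneg_left (hgrow t hSt) (by positivity : 0 ≤ k ^ 2 / 2)
  have e1 : energy Ω l (fun _ => C) t = ∫ y in (0 : ℝ)..(2 * Real.pi), qC y ^ 2 := rfl
  have e2 : energy Ω l (fun t => Real.exp (β * t)) t = ∫ y in (0 : ℝ)..(2 * Real.pi), q y ^ 2 :=
    rfl
  rw [e1] at hg
  rw [e2]
  rw [hA₁, hA₂] at hbig
  linarith

end HarmonicStrip

section logNorm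

/-- The logarithmic derivative `g' / g`, made continuous where `‖g‖ ≤ R`. -/
noncomputable def cutLogDeriv (g : ℂ → ℂ) (R : ℝ) (ζ : ℂ) : ℂ :=
  deriv g ζ * (starRingEnd ℂ) (g ζ) / (max (‖g ζ‖ ^ 2) (R ^ 2) : ℝ)

/-- The derivative of `g' / g`, made continuous where `‖g‖ ≤ R`. -/
noncomputable def cutLogDeriv₂ (g : ℂ → ℂ) (R : ℝ) (ζ : ℂ) : ℂ :=
  deriv (deriv g) ζ * (starRingEnd ℂ) (g ζ) / (max (‖g ζ‖ ^ 2) (R ^ 2) : ℝ) -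
    cutLogDeriv g R ζ ^ 2

/-- The function `log ‖g‖`, made continuous where `‖g‖ ≤ R`. -/
noncomputable def cutLogNorm (g : ℂ → ℂ) (R : ℝ) (ζ : ℂ) : ℝ :=
  1 / 2 * Real.log (max (‖g ζ‖ ^ 2) (R ^ 2))

variable {g : ℂ → ℂ} {R : ℝ}

lemma max_sq_pos (hR : 0 < R) (ζ : ℂ) : 0 < max (‖g ζ‖ ^ 2) (R ^ 2) :=
  lt_max_of_lt_right (by positivity)

lemma max_sq_of_lt (hR : 0 < R) {ζ : ℂ} (hζ : R < ‖g ζ‖) :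
    max (‖g ζ‖ ^ 2) (R ^ 2) = ‖g ζ‖ ^ 2 :=
  max_eq_left (by gcongr)

lemma mul_conj_div {z w : ℂ} : w * (starRingEnd ℂ) z / ((‖z‖ ^ 2 : ℝ) : ℂ) = w / z := by
  by_cases hz : z = 0
  · simp [hz]
  · rw [← Complex.normSq_eq_norm_sq, Complex.normSq_eq_conj_mul_self,
      mul_comm ((starRingEnd ℂ) z) z]
    exact mul_div_mul_right _ _ (by simpa using hz)

lemma cutLogDeriv_of_lt (hR : 0 < R) {ζ : ℂ} (hζ : R < ‖g ζ‖) :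
    cutLogDeriv g R ζ = deriv g ζ / g ζ := by
  rw [cutLogDeriv, max_sq_of_lt hR hζ, mul_conj_div]

lemma cutLogDeriv₂_of_lt (hR : 0 < R) {ζ : ℂ} (hζ : R < ‖g ζ‖) :
    cutLogDeriv₂ g R ζ = deriv (deriv g) ζ / g ζ - (deriv g ζ / g ζ) ^ 2 := by
  rw [cutLogDeriv₂, max_sq_of_lt hR hζ, mul_conj_div, cutLogDeriv_of_lt hR hζ]

lemma cutLogNorm_of_le (hR : 0 < R) {ζ : ℂ} (hζ : R ≤ ‖g ζ‖) :
    cutLogNorm g R ζ = Real.log ‖g ζ‖ := by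
  rw [cutLogNorm, max_eq_left (by gcongr), Real.log_pow]
  push_cast
  ring

lemma cutLogNorm_of_ge {ζ : ℂ} (hζ : ‖g ζ‖ ≤ R) :
    cutLogNorm g R ζ = Real.log R := by
  rw [cutLogNorm, max_eq_right (by gcongr), Real.log_pow]
  push_cast
  ring

lemma continuous_cutLogNorm (hR : 0 < R) (hg : Differentiable ℂ g) :
    Continuous (cutLogNorm g R) := by
  have := hg.continuous
  unfold cutLogNorm
  exact continuous_const.mul (Continuous.log (by fun_prop) fun ζ => (max_sq_pos hR ζ).ne')

lemma continuous_cutLogDeriv (hR : 0 < R) (hg : Differentiable ℂ g) :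
    Continuous (cutLogDeriv g R) := by
  have := hg.continuous
  have := hg.deriv.continuous
  unfold cutLogDeriv
  refine Continuous.div (by fun_prop) (by fun_prop) fun ζ => ?_
  exact_mod_cast (max_sq_pos hR ζ).ne'

lemma continuous_cutLogDeriv₂ (hR : 0 < R) (hg : Differentiable ℂ g) :
    Continuous (cutLogDeriv₂ g R) := by
  have := hg.continuous
  have := hg.deriv.deriv.continuous
  have := continuous_cutLogDeriv hR hg
  unfold cutLogDeriv₂
  refine Continuous.sub (Continuous.div (by fun_prop) (by fun_prop) fun ζ => ?_) (by fun_prop)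
  exact_mod_cast (max_sq_pos hR ζ).ne'

lemma hasDerivAt_cutLogNorm (hR : 0 < R) (hg : Differentiable ℂ g) {γ : ℝ → ℂ} {γ' : ℂ} {s : ℝ}
    (hγ : HasDerivAt γ γ' s) (hs : R < ‖g (γ s)‖) :
    HasDerivAt (fun s => cutLogNorm g R (γ s)) (γ' * cutLogDeriv g R (γ s)).re s := by
  have h1 : HasDerivAt (fun s => g (γ s)) (deriv g (γ s) * γ') s :=
    (hg (γ s)).hasDerivAt.comp s hγ
  have hpos : (0 : ℝ) < ‖g (γ s)‖ ^ 2 := by have := hR.trans hs; positivity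
  have h2 := (h1.norm_sq.log hpos.ne').const_mul (1 / 2)
  refine (h2.congr_of_eventuallyEq ?_).congr_deriv ?_
  · filter_upwards [h1.continuousAt.norm.eventually (lt_mem_nhds hs)] with s' hs'
    rw [cutLogNorm, max_sq_of_lt hR hs']
  · rw [cutLogDeriv, max_sq_of_lt hR hs, ← mul_div_assoc γ', Complex.div_ofReal_re, Complex.inner]
    have : (starRingEnd ℂ) (g (γ s)) * (deriv g (γ s) * γ') =
      γ' * (deriv g (γ s) * (starRingEnd ℂ) (g (γ s))) := by ring
    rw [← this]
    field_simp

lemma hasDerivAt_cutLogDeriv (hR : 0 < R) (hg : Differentiable ℂ g) {γ : ℝ → ℂ} {γ' : ℂ} {s : ℝ}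
    (hγ : HasDerivAt γ γ' s) (hs : R < ‖g (γ s)‖) :
    HasDerivAt (fun s => cutLogDeriv g R (γ s)) (γ' * cutLogDeriv₂ g R (γ s)) s := by
  have hne : g (γ s) ≠ 0 := norm_pos_iff.1 (hR.trans hs)
  have h1 : HasDerivAt (fun ζ => deriv g ζ / g ζ) _ (γ s) :=
    (hg.deriv (γ s)).hasDerivAt.div (hg (γ s)).hasDerivAt hne
  refine ((h1.comp s hγ).congr_of_eventuallyEq ?_).congr_deriv ?_
  · filter_upwards [(hg.continuous.continuousAt.comp hγ.continuousAt).norm.eventually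
      (lt_mem_nhds hs)] with s' hs'
    exact cutLogDeriv_of_lt hR hs'
  · rw [cutLogDeriv₂_of_lt hR hs]
    field_simp

end logNorm

lemma mem_connectedComponentIn_of_mem_closure {α : Type*} [TopologicalSpace α] {F : Set α}
    {x y : α} (hy : y ∈ closure (connectedComponentIn F x)) (hyF : y ∈ F) :
    y ∈ connectedComponentIn F x := by
  have hx : x ∈ F := by
    by_contra hx
    rw [connectedComponentIn_eq_empty hx, closure_empty] at hy
    exact hy
  have hpre : IsPreconnected (insert y (connectedComponentIn F x)) :=
    isPreconnected_connectedComponentIn.subset_closure (Set.subset_insert _ _)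
      (Set.insert_subset hy subset_closure)
  exact hpre.subset_connectedComponentIn (Set.mem_insert_of_mem _ (mem_connectedComponentIn hx))
    (Set.insert_subset hyF (connectedComponentIn_subset F x)) (Set.mem_insert _ _)

/-- The pullback of `log ‖f‖` under `exp`. -/
lemma harmonicStrip_exp {f : ℂ → ℂ} (hf : Differentiable ℂ f) {R : ℝ} (hR : 0 < R) {U : Set ℂ}
    (hUo : IsOpen U) (hUR : ∀ z ∈ U, R < ‖f z‖)
    (hUcl : ∀ z ∈ closure U, R < ‖f z‖ → z ∈ U) :
    HarmonicStrip {p : ℝ × ℝ | Complex.exp (p.1 + p.2 * Complex.I) ∈ U}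
      (fun p => cutLogNorm (fun ζ => f (Complex.exp ζ)) R (p.1 + p.2 * Complex.I))
      (fun p => (cutLogDeriv (fun ζ => f (Complex.exp ζ)) R (p.1 + p.2 * Complex.I)).re)
      (fun p => -(cutLogDeriv (fun ζ => f (Complex.exp ζ)) R (p.1 + p.2 * Complex.I)).im)
      (fun p => (cutLogDeriv₂ (fun ζ => f (Complex.exp ζ)) R (p.1 + p.2 * Complex.I)).re)
      (Real.log R) := by
  have hg : Differentiable ℂ fun ζ => f (Complex.exp ζ) := hf.comp Complex.differentiable_exp
  have hc0 := continuous_cutLogNorm hR hg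
  have hc1 := continuous_cutLogDeriv hR hg
  have hc2 := continuous_cutLogDeriv₂ hR hg
  have hx : ∀ p : ℝ × ℝ, HasDerivAt (fun x : ℝ => (x : ℂ) + p.2 * Complex.I) 1 p.1 :=
    fun p => (Complex.ofRealCLM.hasDerivAt (x := p.1)).add_const _
  have hy : ∀ p : ℝ × ℝ, HasDerivAt (fun y : ℝ => (p.1 : ℂ) + y * Complex.I) Complex.I p.2 := by
    intro p
    have := ((Complex.ofRealCLM.hasDerivAt (x := p.2)).mul_const Complex.I).const_add (p.1 : ℂ)
    simpa using this
  have hexp : ∀ x y : ℝ, Complex.exp (x + (y + 2 * Real.pi : ℝ) * Complex.I) =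
      Complex.exp (x + y * Complex.I) := by
    intro x y
    have : (x : ℂ) + (y + 2 * Real.pi : ℝ) * Complex.I =
      (x + y * Complex.I) + 2 * Real.pi * Complex.I := by push_cast; ring
    rw [this, Complex.exp_periodic]
  have hper : ∀ x y : ℝ, ((x : ℂ) + (y + 2 * Real.pi : ℝ) * Complex.I) =
      (x + y * Complex.I) + 2 * Real.pi * Complex.I := by
    intro x y
    push_cast; ring
  have hderiv : ∀ ζ, deriv (fun ζ => f (Complex.exp ζ)) (ζ + 2 * Real.pi * Complex.I) =
      deriv (fun ζ => f (Complex.exp ζ)) ζ := by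
    intro ζ
    rw [← deriv_comp_add_const]
    congr 1
    funext z
    rw [Complex.exp_periodic]
  refine
    { isOpen := hUo.preimage (by fun_prop)
      cont := by fun_prop
      cont_x := by fun_prop
      cont_y := by fun_prop
      cont_xx := Complex.continuous_re.comp (hc2.comp (by fun_prop))
      deriv_x := fun p hp => ?_
      deriv_y := fun p hp => ?_
      deriv_xx := fun p hp => ?_
      deriv_yy := fun p hp => ?_
      boundary := fun p hp hp' => ?_
      periodic_mem := fun x y => ?_
      periodic := fun x y => ?_
      periodic_y := fun x y => ?_ }
  · simpa using hasDerivAt_cutLogNorm hR hg (hx p) (hUR _ hp)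
  · simpa using hasDerivAt_cutLogNorm hR hg (hy p) (hUR _ hp)
  · have := hasDerivAt_cutLogDeriv hR hg (hx p) (hUR _ hp)
    rw [one_mul] at this
    exact Complex.reCLM.hasFDerivAt.comp_hasDerivAt p.1 this
  · have := hasDerivAt_cutLogDeriv hR hg (hy p) (hUR _ hp)
    have := (Complex.imCLM.hasFDerivAt.comp_hasDerivAt p.2 this).neg
    refine this.congr_deriv ?_
    simp
  · have hcl : Complex.exp (p.1 + p.2 * Complex.I) ∈ closure U :=
      map_mem_closure (f := fun p : ℝ × ℝ => Complex.exp (p.1 + p.2 * Complex.I)) (by fun_prop) hp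
        fun _ h => h
    refine (cutLogNorm_of_ge (not_lt.1 fun hlt => hp' (hUcl _ hcl hlt))).le
  · simp only [Set.mem_ofPred_eq, hexp]
  · simp only [cutLogNorm, hexp]
  · simp only [cutLogDeriv, hexp]
    rw [hper, hderiv]

lemma mAux_exp {f : ℂ → ℂ} (hf : Differentiable ℂ f) {R : ℝ} (hR : 0 < R) {U : Set ℂ}
    (hUo : IsOpen U) (hUR : ∀ z ∈ U, R < ‖f z‖) (β t : ℝ) :
    mAux f β {z ∈ U | 0 ≤ vAux f β z} (Real.exp t) =
      1 / (2 * Real.pi) * HarmonicStrip.energy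
        {p : ℝ × ℝ | Complex.exp (p.1 + p.2 * Complex.I) ∈ U}
        (fun p => cutLogNorm (fun ζ => f (Complex.exp ζ)) R (p.1 + p.2 * Complex.I))
        (fun t => Real.exp (β * t)) t := by
  have hexp : ∀ θ : ℝ, ((Real.exp t : ℝ) : ℂ) * Complex.exp (θ * Complex.I) =
      Complex.exp (t + θ * Complex.I) := fun θ => by
    rw [Complex.exp_add, Complex.ofReal_exp]
  have hnorm : ∀ θ : ℝ, ‖Complex.exp (t + θ * Complex.I)‖ ^ β = Real.exp (β * t) := fun θ => by
    rw [Complex.norm_exp, ← Real.exp_mul]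
    simp [mul_comm]
  have hVm : MeasurableSet {θ : ℝ | Complex.exp (t + θ * Complex.I) ∈
      {z ∈ U | 0 ≤ vAux f β z}} := by
    have hv : Measurable (vAux f β) := by
      have := hf.continuous
      unfold vAux
      fun_prop
    have hV : MeasurableSet {z ∈ U | 0 ≤ vAux f β z} :=
      hUo.measurableSet.inter (measurableSet_le measurable_const hv)
    exact hV.preimage (by fun_prop)
  simp only [mAux, hexp, HarmonicStrip.energy]
  congr 1
  have hset : {θ : ℝ | θ ∈ Set.Icc 0 (2 * Real.pi) ∧ Complex.exp (t + θ * Complex.I) ∈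
      {z ∈ U | 0 ≤ vAux f β z}} = Set.Icc 0 (2 * Real.pi) ∩
      {θ : ℝ | Complex.exp (t + θ * Complex.I) ∈ {z ∈ U | 0 ≤ vAux f β z}} := rfl
  rw [hset, ← setIntegral_indicator hVm, intervalIntegral.integral_of_le Real.two_pi_pos.le,
    integral_Icc_eq_integral_Ioc]
  congr 1
  funext θ
  by_cases hU : Complex.exp (t + θ * Complex.I) ∈ U
  · have hl : cutLogNorm (fun ζ => f (Complex.exp ζ)) R (t + θ * Complex.I) - Real.exp (β * t) =
        vAux f β (Complex.exp (t + θ * Complex.I)) := by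
      rw [cutLogNorm_of_le (g := fun ζ => f (Complex.exp ζ)) hR (hUR _ hU).le, vAux, hnorm]
    have hmem : (t, θ) ∈ {p : ℝ × ℝ | Complex.exp (p.1 + p.2 * Complex.I) ∈ U} := hU
    rw [excess, Set.indicator_of_mem hmem]
    simp only [hl]
    by_cases hv : 0 ≤ vAux f β (Complex.exp (t + θ * Complex.I))
    · rw [Set.indicator_of_mem (by exact ⟨hU, hv⟩), max_eq_left hv]
    · rw [Set.indicator_of_notMem (by exact fun hm => hv hm.2), max_eq_right (not_le.1 hv).le]
      simp
  · have hmem : (t, θ) ∉ {p : ℝ × ℝ | Complex.exp (p.1 + p.2 * Complex.I) ∈ U} := hU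
    rw [Set.indicator_of_notMem (by exact fun hm => hU hm.1), excess,
      Set.indicator_of_notMem hmem]
    simp

lemma energy_exp_bounded {f : ℂ → ℂ} (hf : Differentiable ℂ f) {R C : ℝ} (hR : 0 < R) (U : Set ℂ)
    (s : ℝ) :
    ∃ B, ∀ t ≤ s, HarmonicStrip.energy {p : ℝ × ℝ | Complex.exp (p.1 + p.2 * Complex.I) ∈ U}
        (fun p => cutLogNorm (fun ζ => f (Complex.exp ζ)) R (p.1 + p.2 * Complex.I))
        (fun _ => C) t ≤ B := by
  obtain ⟨K, hK⟩ := (isCompact_closedBall (0 : ℂ) (Real.exp s)).exists_bound_of_continuousOn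
    hf.continuous.continuousOn
  set B₁ : ℝ := 1 / 2 * Real.log (max (K ^ 2) (R ^ 2)) with hB₁
  refine ⟨max (B₁ - C) 0 ^ 2 * (2 * Real.pi), fun t ht => ?_⟩
  have hle : ∀ y : ℝ, cutLogNorm (fun ζ => f (Complex.exp ζ)) R (t + y * Complex.I) ≤ B₁ := by
    intro y
    have hb : ‖f (Complex.exp (t + y * Complex.I))‖ ≤ K := by
      refine hK _ ?_
      rw [mem_closedBall_zero_iff, Complex.norm_exp]
      simpa using ht
    rw [cutLogNorm, hB₁]
    have := max_sq_pos (g := fun ζ => f (Complex.exp ζ)) hR (t + y * Complex.I)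
    gcongr
  have hpt : ∀ y : ℝ, excess {p : ℝ × ℝ | Complex.exp (p.1 + p.2 * Complex.I) ∈ U}
        (fun p => cutLogNorm (fun ζ => f (Complex.exp ζ)) R (p.1 + p.2 * Complex.I))
        (fun _ => C) (t, y) ≤ max (B₁ - C) 0 := by
    intro y
    refine Set.indicator_apply_le' (fun _ => ?_) fun _ => le_max_right _ _
    have := hle y
    gcongr
  refine (le_abs_self _).trans ?_
  have := intervalIntegral.norm_integral_le_of_norm_le_const (a := (0 : ℝ)) (b := 2 * Real.pi)
    (C := max (B₁ - C) 0 ^ 2)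
    (f := fun y => excess {p : ℝ × ℝ | Complex.exp (p.1 + p.2 * Complex.I) ∈ U}
        (fun p => cutLogNorm (fun ζ => f (Complex.exp ζ)) R (p.1 + p.2 * Complex.I))
        (fun _ => C) (t, y) ^ 2) (fun y _ => by
      rw [Real.norm_eq_abs, abs_pow, abs_of_nonneg (excess_nonneg _)]
      have := hpt y
      have := excess_nonneg (Ω := {p : ℝ × ℝ | Complex.exp (p.1 + p.2 * Complex.I) ∈ U})
        (l := fun p => cutLogNorm (fun ζ => f (Complex.exp ζ)) R (p.1 + p.2 * Complex.I))
        (a := fun _ => C) (t, y)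
      gcongr)
  rwa [sub_zero, abs_of_pos Real.two_pi_pos] at this

theorem mAux_convex_in_log
    (f : ℂ → ℂ) (hf : Differentiable ℂ f) (R : ℝ) (hR : 0 < R)
    (U : Set ℂ) (hU : U ∈ componentsAR f R)
    (hcirc : ∀ᶠ r in atTop, ¬ Metric.sphere (0 : ℂ) r ⊆ U)
    (β : ℝ) (hβ0 : 0 < β) (hβ : β < 1 / 2)
    (V : Set ℂ) (hV : V = {z ∈ U | 0 ≤ vAux f β z}) :
    ∃ r₀ : ℝ, 0 < r₀ ∧
      ConvexOn ℝ (Set.Ici (Real.log r₀)) (fun t => mAux f β V (Real.exp t)) := by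
  obtain ⟨z₀, hz₀, rfl⟩ := hU
  set U := connectedComponentIn {w : ℂ | R < ‖f w‖} z₀
  subst hV
  have hA : IsOpen {w : ℂ | R < ‖f w‖} := isOpen_lt continuous_const hf.continuous.norm
  have hUo : IsOpen U := hA.connectedComponentIn
  have hUR : ∀ z ∈ U, R < ‖f z‖ := fun z hz =>
    connectedComponentIn_subset {w : ℂ | R < ‖f w‖} z₀ hz
  have h := harmonicStrip_exp hf hR hUo hUR
    fun z hz hzR => mem_connectedComponentIn_of_mem_closure hz hzR
  obtain ⟨z₁, hz₁, hz₁0⟩ := (dense_compl_singleton (0 : ℂ)).inter_open_nonempty U hUo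
    ⟨z₀, mem_connectedComponentIn hz₀⟩
  have hlog : Complex.exp (Real.log ‖z₁‖ + Complex.arg z₁ * Complex.I) = z₁ := Complex.exp_log hz₁0
  obtain ⟨C, hRC, hC⟩ := exists_between (Real.log_lt_log hR (hUR z₁ hz₁))
  obtain ⟨r₁, hr₁⟩ := eventually_atTop.1 hcirc
  have hT : ∀ t, Real.log (max r₁ 1) ≤ t →
      ∃ y, (t, y) ∉ {p : ℝ × ℝ | Complex.exp (p.1 + p.2 * Complex.I) ∈ U} := by
    intro t ht
    have hrt : r₁ ≤ Real.exp t := (le_max_left _ _).trans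
      ((Real.log_le_iff_le_exp (lt_max_of_lt_right one_pos)).1 ht)
    obtain ⟨w, hw, hwU⟩ := Set.not_subset.1 (hr₁ _ hrt)
    rw [mem_sphere_zero_iff_norm] at hw
    refine ⟨Complex.arg w, fun hm => hwU ?_⟩
    have hm : Complex.exp (t + Complex.arg w * Complex.I) ∈ U := hm
    rwa [Complex.exp_add, ← Complex.ofReal_exp, ← hw, Complex.norm_mul_exp_arg_mul_I] at hm
  obtain ⟨t₁, ht₁⟩ := h.exists_convexOn_energy_exp hRC hβ0 hβ hT
    (energy_exp_bounded hf hR U) (p := (Real.log ‖z₁‖, Complex.arg z₁))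
    (by
      change Complex.exp (Real.log ‖z₁‖ + Complex.arg z₁ * Complex.I) ∈ U
      rwa [hlog])
    (by
      simp only
      rw [cutLogNorm_of_le hR (by rw [hlog]; exact (hUR z₁ hz₁).le), hlog]
      exact hC)
  refine ⟨Real.exp t₁, Real.exp_pos _, ?_⟩
  rw [Real.log_exp]
  simp only [mAux_exp hf hR hUo hUR]
  exact ht₁.smul (by positivity)
end
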